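/- Let F be a real-valued C∞ function on a neighborhood of the origin in ℝ² whose Newton polygon Γ = Γ(F) is nonempty. List the compact edges α of the boundary of Γ; the edge α joins integer points (A_α, B_α) and (A'_α, B'_α) with B'_α > B_α, and set n_α = B'_α − B_α and γ_α = (A_α − A'_α)/(B'_α − B_α). Let A be the x-coordinate of the vertical infinite edge of Γ, B the y-coordinate of the horizontal infinite edge, and n = B + Σ_α n_α. Then there exist ε > 0 and functions as follows such that for all 0 < x, y < ε one has F(x,y) = U(x,y) · ∏_{i=1}^{A}(x − X_i(y)) · ∏_{i=1}^{B}(y − Y_i(x)) · ∏_α ∏_{i=1}^{n_α}(y − Y_{αi}(x)), where: (1) U is a real-valued C∞ function on a neighborhood of the origin with U(0,0) ≠ 0; (2) the X_i and Y_i are ℂ-valued continuous functions on [0,ε) satisfying X_i(t) = O(t^N) and Y_i(t) = O(t^N) as t → 0⁺ for every N > 0; (3) each Y_{αi} is a ℂ-valued continuous function on [0,ε) admitting an asymptotic expansion in powers of x^{1/n!} (i.e. there are coefficients c_m ∈ ℂ with Y_{αi}(x) − Σ_{m=0}^{M} c_m x^{m/n!} = O(x^{(M+1)/n!}) as x → 0⁺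 for every M), whose lowest-order nonzero term is c_{αi} x^{γ_α} with c_{αi} ≠ 0; (4) if Y is any of the functions Y_{αi}, and f(x,y) = ∏_i (y − Y_{αi}(x)) is the product over all indices i for which Y_{αi} has exactly the same asymptotic expansion as Y, then the coefficients (as a polynomial in y) of f(x^{n!}, y) extend to C∞ functions on [0,ε'); (5) if in (4) the asymptotic expansion of Y has all real coefficients, then f is real-valued. -/

import Mathlib

open Set Asymptotics Filter

open scoped Classical

noncomputable section

/-- The Taylor coefficient `c_{n₁ n₂}` of a two-variable function at the origin. -/
def taylorCoeff2 (F : ℝ → ℝ → ℝ) (n₁ n₂ : ℕ) : ℝ :=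
  iteratedDeriv n₁ (fun x => iteratedDeriv n₂ (fun y => F x y) 0) 0 /
    (n₁.factorial * n₂.factorial)

/-- The Newton polygon of a set `K ⊆ ℤ²_{≥0}`: the convex hull in `ℝ²_{≥0}` of
`⋃_{n ∈ K} (n + ℝ²_{≥0})`. -/
def newtonPolygon (K : Set (ℕ × ℕ)) : Set (ℝ × ℝ) :=
  convexHull ℝ {p : ℝ × ℝ | ∃ n ∈ K, ∃ q : ℝ × ℝ,
    0 ≤ q.1 ∧ 0 ≤ q.2 ∧ p = ((n.1 : ℝ) + q.1, (n.2 : ℝ) + q.2)}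

/-- The Newton polygon `Γ(F)` of a function: the Newton polygon of the set of
exponents of the nonzero Taylor coefficients of `F` at the origin. -/
def newtonPolygonOf (F : ℝ → ℝ → ℝ) : Set (ℝ × ℝ) :=
  newtonPolygon {n : ℕ × ℕ | taylorCoeff2 F n.1 n.2 ≠ 0}

/-- Given the vertices `v 0, …, v k` of the Newton polygon (ordered with
strictly increasing abscissas), the compact edge `α` joins `(A'_α, B'_α) = v α`
to `(A_α, B_α) = v (α+1)`; `edgeMult v α = n_α = B'_α - B_α`. -/
def edgeMult {k : ℕ} (v : Fin (k + 1) → ℕ × ℕ) (α : Fin k) : ℕ :=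
  (v α.castSucc).2 - (v α.succ).2

/-- `edgeSlope v α = γ_α = (A_α - A'_α)/(B'_α - B_α)`. -/
def edgeSlope {k : ℕ} (v : Fin (k + 1) → ℕ × ℕ) (α : Fin k) : ℝ :=
  (((v α.succ).1 - (v α.castSucc).1 : ℕ) : ℝ) / ((edgeMult v α : ℕ) : ℝ)

/-- `totalDeg v = n = B + ∑_α n_α`, where `B` is the `y`-coordinate of the
horizontal infinite edge. -/
def totalDeg {k : ℕ} (v : Fin (k + 1) → ℕ × ℕ) : ℕ :=
  (v (Fin.last k)).2 + ∑ α : Fin k, edgeMult v α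

/-- `Y` admits the asymptotic expansion `∑ c_m x^{mq}` (in powers of `x^q`) as
`x → 0⁺`: every partial sum approximates `Y` to the order of the first omitted
power. -/
def HasPuiseuxExpansion (Y : ℝ → ℂ) (q : ℝ) (c : ℕ → ℂ) : Prop :=
  ∀ M : ℕ,
    (fun x : ℝ => Y x - ∑ m ∈ Finset.range (M + 1), c m * ((x ^ ((m : ℝ) * q) : ℝ) : ℂ))
      =O[nhdsWithin 0 (Set.Ioi 0)] fun x : ℝ => x ^ (((M : ℝ) + 1) * q)

namespace NP
open scoped ContDiff

section ModCalc
variable {ι : Type*} {w : ι → ℝ} {D E F G : Type*}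
  [NormedAddCommGroup D] [NormedSpace ℝ D]
  [NormedAddCommGroup E] [NormedSpace ℝ E] [NormedAddCommGroup F] [NormedSpace ℝ F]
  [NormedAddCommGroup G] [NormedSpace ℝ G]

/-- Polynomial bound for a family of nonnegative quantities. -/
def PolyBd {ι : Type*} {X : Type*} (w : ι → ℝ) (q : ι → X → ℝ) : Prop :=
  ∃ C : ℝ, ∃ N : ℕ, 0 ≤ C ∧ ∀ i x, q i x ≤ C * w i ^ N

/-- derivatives up to order `k` are polynomially bounded -/
def ModK (w : ι → ℝ) (k : ℕ) (g : ι → D → E) : Prop :=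
  ∀ j ≤ k, PolyBd w (fun i x => ‖iteratedFDeriv ℝ j (g i) x‖)

/-- moderate families of smooth functions -/
def Mod (w : ι → ℝ) (g : ι → D → E) : Prop :=
  (∀ i, ContDiff ℝ ∞ (g i)) ∧ ∀ k, ModK w k g

lemma PolyBd.add {X : Type*} (hw : ∀ i, 1 ≤ w i) {p q : ι → X → ℝ} (hp : PolyBd w p) (hq : PolyBd w q) :
    PolyBd w (fun i x => p i x + q i x) := by
  obtain ⟨C, N, hC, h⟩ := hp
  obtain ⟨C', N', hC', h'⟩ := hq
  refine ⟨C + C', max N N', by positivity, fun i x => ?_⟩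
  have h1 : w i ^ N ≤ w i ^ (max N N') := pow_le_pow_right₀ (hw i) (le_max_left _ _)
  have h2 : w i ^ N' ≤ w i ^ (max N N') := pow_le_pow_right₀ (hw i) (le_max_right _ _)
  have := h i x
  have := h' i x
  nlinarith [mul_le_mul_of_nonneg_left h1 hC, mul_le_mul_of_nonneg_left h2 hC']

lemma PolyBd.mono {X : Type*} {p q : ι → X → ℝ} (hq : PolyBd w q) (h : ∀ i x, p i x ≤ q i x) :
    PolyBd w p := by
  obtain ⟨C, N, hC, h'⟩ := hq
  exact ⟨C, N, hC, fun i x => (h i x).trans (h' i x)⟩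

lemma PolyBd.mul {X : Type*} (hw : ∀ i, 1 ≤ w i) {p q : ι → X → ℝ} (hp : PolyBd w p) (hq : PolyBd w q)
    (hp0 : ∀ i x, 0 ≤ p i x) (hq0 : ∀ i x, 0 ≤ q i x) :
    PolyBd w (fun i x => p i x * q i x) := by
  obtain ⟨C, N, hC, h⟩ := hp
  obtain ⟨C', N', hC', h'⟩ := hq
  refine ⟨C * C', N + N', by positivity, fun i x => ?_⟩
  have hwi : 0 ≤ w i := zero_le_one.trans (hw i)
  calc p i x * q i x ≤ (C * w i ^ N) * (C' * w i ^ N') :=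
        mul_le_mul (h i x) (h' i x) (hq0 i x) (by positivity)
    _ = C * C' * w i ^ (N + N') := by ring

lemma PolyBd.const {X : Type*} (C : ℝ) : PolyBd w (fun _ (_ : X) => C) :=
  ⟨|C|, 0, abs_nonneg _, fun i x => by simpa using le_abs_self C⟩

lemma PolyBd.sum {X : Type*} (hw : ∀ i, 1 ≤ w i) {κ : Type*} (s : Finset κ) {p : κ → ι → X → ℝ}
    (hp : ∀ k ∈ s, PolyBd w (p k)) : PolyBd w (fun i x => ∑ k ∈ s, p k i x) := by
  induction s using Finset.induction_on with
  | empty => simpa using PolyBd.const (X := X) (w := w) 0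
  | insert a s ha ih =>
    simp only [Finset.sum_insert ha]
    exact (hp a (by simp)).add hw (ih fun k hk => hp k (by simp [hk]))

lemma PolyBd.pow {X : Type*} (hw : ∀ i, 1 ≤ w i) {p : ι → X → ℝ} (hp : PolyBd w p)
    (hp0 : ∀ i x, 0 ≤ p i x) (n : ℕ) : PolyBd w (fun i x => p i x ^ n) := by
  induction n with
  | zero => simpa using PolyBd.const (X := X) (w := w) 1
  | succ n ih =>
    simp only [pow_succ]
    exact ih.mul hw hp (fun i x => pow_nonneg (hp0 i x) n) hp0

lemma ModK.le {k l : ℕ} {g : ι → D → E} (h : ModK w k g) (hl : l ≤ k) : ModK w l g :=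
  fun j hj => h j (hj.trans hl)

lemma ModK.bilin (hw : ∀ i, 1 ≤ w i) {k : ℕ} {f : ι → D → E} {g : ι → D → F} (B : E →L[ℝ] F →L[ℝ] G)
    (hfs : ∀ i, ContDiff ℝ ∞ (f i)) (hgs : ∀ i, ContDiff ℝ ∞ (g i))
    (hf : ModK w k f) (hg : ModK w k g) : ModK w k (fun i x => B (f i x) (g i x)) := by
  intro j hj
  have key : ∀ i x, ‖iteratedFDeriv ℝ j (fun x => B (f i x) (g i x)) x‖ ≤
      ‖B‖ * ∑ l ∈ Finset.range (j + 1), (j.choose l : ℝ) * ‖iteratedFDeriv ℝ l (f i) x‖ *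
        ‖iteratedFDeriv ℝ (j - l) (g i) x‖ := fun i x =>
    B.norm_iteratedFDeriv_le_of_bilinear (N := ∞) (hfs i) (hgs i) x (by exact_mod_cast le_top)
  refine PolyBd.mono ?_ key
  refine (PolyBd.const _).mul hw (PolyBd.sum hw _ fun l hl => ?_) (fun _ _ => by positivity)
    (fun i x => by positivity)
  refine PolyBd.mul hw (PolyBd.mul hw (PolyBd.const _) (hf l ?_) (fun _ _ => by positivity)
    (fun _ _ => norm_nonneg _)) (hg _ (by omega)) (fun _ _ => by positivity) (fun _ _ => norm_nonneg _)
  have := Finset.mem_range.1 hl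
  omega

lemma Mod.bilin (hw : ∀ i, 1 ≤ w i) {f : ι → D → E} {g : ι → D → F} (B : E →L[ℝ] F →L[ℝ] G)
    (hf : Mod w f) (hg : Mod w g) : Mod w (fun i x => B (f i x) (g i x)) :=
  ⟨fun i => B.isBoundedBilinearMap.contDiff.comp₂ (hf.1 i) (hg.1 i),
    fun k => ModK.bilin hw B hf.1 hg.1 (hf.2 k) (hg.2 k)⟩

lemma Mod.mul {A : Type*} [NormedRing A] [NormedAlgebra ℝ A] (hw : ∀ i, 1 ≤ w i) {f g : ι → D → A}
    (hf : Mod w f) (hg : Mod w g) : Mod w (fun i x => f i x * g i x) :=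
  Mod.bilin hw (ContinuousLinearMap.mul ℝ A) hf hg

lemma Mod.smul (hw : ∀ i, 1 ≤ w i) {f : ι → D → ℝ} {g : ι → D → E}
    (hf : Mod w f) (hg : Mod w g) : Mod w (fun i x => f i x • g i x) :=
  Mod.bilin hw (ContinuousLinearMap.lsmul ℝ ℝ) hf hg

lemma Mod.add (hw : ∀ i, 1 ≤ w i) {f g : ι → D → E}
    (hf : Mod w f) (hg : Mod w g) : Mod w (fun i x => f i x + g i x) := by
  refine ⟨fun i => (hf.1 i).add (hg.1 i), fun k j hj => ?_⟩
  refine PolyBd.mono (PolyBd.add hw (hf.2 k j hj) (hg.2 k j hj)) fun i x => ?_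
  have := iteratedFDeriv_add_apply (𝕜 := ℝ) (i := j) (x := x) (((hf.1 i).of_le (by exact_mod_cast le_top)).contDiffAt)
    (((hg.1 i).of_le (by exact_mod_cast le_top)).contDiffAt)
  have h2 : (fun x => f i x + g i x) = f i + g i := rfl
  beta_reduce
  rw [h2, this]
  exact norm_add_le _ _

lemma Mod.const (a : ι → E) (ha : PolyBd w (fun i (_ : Unit) => ‖a i‖)) :
    Mod w (fun i (_ : D) => a i) := by
  refine ⟨fun i => contDiff_const, fun k j _ => ?_⟩
  rcases Nat.eq_zero_or_pos j with rfl | hj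
  · obtain ⟨C, N, hC, h⟩ := ha
    exact ⟨C, N, hC, fun i x => by simpa using h i ()⟩
  · refine PolyBd.mono (PolyBd.const 0) fun i x => ?_
    rw [iteratedFDeriv_const_of_ne (by omega)]
    simp

lemma Mod.sum (hw : ∀ i, 1 ≤ w i) {κ : Type*} (s : Finset κ) {f : κ → ι → D → E}
    (hf : ∀ k ∈ s, Mod w (f k)) : Mod w (fun i x => ∑ k ∈ s, f k i x) := by
  induction s using Finset.induction_on with
  | empty =>
    simp only [Finset.sum_empty]
    exact Mod.const _ (by simpa using PolyBd.const 0)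
  | insert a s ha ih =>
    simp only [Finset.sum_insert ha]
    exact (hf a (by simp)).add hw (ih fun k hk => hf k (by simp [hk]))

lemma Mod.prod {A : Type*} [NormedCommRing A] [NormedAlgebra ℝ A] (hw : ∀ i, 1 ≤ w i) {κ : Type*} (s : Finset κ)
    {f : κ → ι → D → A}
    (hf : ∀ k ∈ s, Mod w (f k)) : Mod w (fun i x => ∏ k ∈ s, f k i x) := by
  induction s using Finset.induction_on with
  | empty =>
    simp only [Finset.prod_empty]
    exact Mod.const _ (PolyBd.const _)
  | insert a s ha ih =>
    simp only [Finset.prod_insert ha]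
    exact (hf a (by simp)).mul hw (ih fun k hk => hf k (by simp [hk]))

lemma Mod.clm (hw : ∀ i, 1 ≤ w i) {f : ι → D → E} (L : ι → E →L[ℝ] F)
    (hL : PolyBd w (fun i (_ : Unit) => ‖L i‖))
    (hf : Mod w f) : Mod w (fun i x => L i (f i x)) :=
  Mod.bilin hw (ContinuousLinearMap.apply ℝ F).flip (Mod.const L hL) hf

/-- precomposition with an affine map -/
lemma Mod.comp_affine (hw : ∀ i, 1 ≤ w i) {f : ι → E → F} (L : ι → D →L[ℝ] E) (b : ι → E)
    (hL : PolyBd w (fun i (_ : Unit) => ‖L i‖))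
    (hf : Mod w f) : Mod w (fun i x => f i (L i x + b i)) := by
  refine ⟨fun i => (hf.1 i).comp ((L i).contDiff.add contDiff_const), fun k j hj => ?_⟩
  obtain ⟨C, N, hC, h⟩ := hf.2 k j hj
  obtain ⟨C', N', hC', h'⟩ := hL
  refine ⟨C * C' ^ j, N + N' * j, by positivity, fun i x => ?_⟩
  have hwi : 0 ≤ w i := zero_le_one.trans (hw i)
  have h1 : ContDiff ℝ ∞ (fun y => f i (y + b i)) := (hf.1 i).comp (contDiff_id.add contDiff_const)
  have h2 := (L i).iteratedFDeriv_comp_right (i := j) h1 x (by exact_mod_cast le_top)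
  have h3 : (fun x => f i (L i x + b i)) = (fun y => f i (y + b i)) ∘ (L i) := rfl
  beta_reduce
  rw [h3, h2]
  refine (ContinuousMultilinearMap.norm_compContinuousLinearMap_le _ _).trans ?_
  have h4 := iteratedFDeriv_comp_add_right (𝕜 := ℝ) (f := f i) j (b i) (L i x)
  rw [h4]
  simp only [Finset.prod_const, Finset.card_univ, Fintype.card_fin]
  calc _ ≤ (C * w i ^ N) * (C' * w i ^ N') ^ j :=
        mul_le_mul (h i _) (pow_le_pow_left₀ (norm_nonneg _) (h' i ()) _) (by positivity) (by positivity)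
    _ = C * C' ^ j * w i ^ (N + N' * j) := by rw [mul_pow, ← pow_mul]; ring

lemma bounded_of_compactSupport {f : D → E} (hf : ContDiff ℝ ∞ f) (hc : HasCompactSupport f) (k : ℕ) :
    ∃ C, 0 ≤ C ∧ ∀ x, ‖iteratedFDeriv ℝ k f x‖ ≤ C := by
  have h1 : HasCompactSupport (iteratedFDeriv ℝ k f) := hc.iteratedFDeriv k
  have h2 : Continuous (iteratedFDeriv ℝ k f) := hf.continuous_iteratedFDeriv (by exact_mod_cast le_top)
  obtain ⟨C, hC⟩ := h1.exists_bound_of_continuous h2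
  exact ⟨|C|, abs_nonneg _, fun x => (hC x).trans (le_abs_self _)⟩

lemma Mod.of_compactSupport {f : D → E} (hf : ContDiff ℝ ∞ f) (hc : HasCompactSupport f) :
    Mod w (fun _ => f) := by
  refine ⟨fun _ => hf, fun k j _ => ?_⟩
  obtain ⟨C, hC, h⟩ := bounded_of_compactSupport hf hc j
  exact ⟨C, 0, hC, fun i x => by simpa using h x⟩

lemma Mod.reindex {κ : Type*} {g : ι → D → E} (h : Mod w g) (e : κ → ι) :
    Mod (fun k => w (e k)) (fun k => g (e k)) := by
  refine ⟨fun i => h.1 _, fun k j hj => ?_⟩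
  obtain ⟨C, N, hC, h⟩ := h.2 k j hj
  exact ⟨C, N, hC, fun i x => h _ x⟩

/-- sums over finsets with polynomially many elements -/
lemma Mod.finsetSum (hw : ∀ i, 1 ≤ w i) {κ : Type*} (S : ι → Finset κ)
    (hS : PolyBd w (fun i (_ : Unit) => ((S i).card : ℝ))) {f : ι × κ → D → E}
    (hf : Mod (fun p => w p.1) f) : Mod w (fun i x => ∑ k ∈ S i, f (i, k) x) := by
  refine ⟨fun i => ContDiff.sum fun k _ => hf.1 _, fun k j hj => ?_⟩
  obtain ⟨C, N, hC, h⟩ := hf.2 k j hj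
  obtain ⟨C', N', hC', h'⟩ := hS
  refine ⟨C' * C, N' + N, by positivity, fun i x => ?_⟩
  have hwi : 0 ≤ w i := zero_le_one.trans (hw i)
  beta_reduce
  rw [iteratedFDeriv_fun_sum_apply fun k _ => ((hf.1 (i, k)).of_le (by exact_mod_cast le_top)).contDiffAt]
  refine (norm_sum_le _ _).trans ((Finset.sum_le_sum fun k _ => h (i, k) x).trans ?_)
  simp only [Finset.sum_const, nsmul_eq_mul, pow_add]
  calc _ ≤ (C' * w i ^ N') * (C * w i ^ N) := by
        refine mul_le_mul_of_nonneg_right (h' i ()) (by positivity)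
    _ = _ := by ring

lemma Mod.inverse {A : Type*} [NormedRing A] [NormedAlgebra ℝ A] [CompleteSpace A]
    (hw : ∀ i, 1 ≤ w i) {g : ι → D → A} (hg : Mod w g) (hu : ∀ i x, IsUnit (g i x))
    (hb : PolyBd w (fun i x => ‖Ring.inverse (g i x)‖)) :
    Mod w (fun i x => Ring.inverse (g i x)) := by
  have hs : ∀ i, ContDiff ℝ ∞ (fun x => Ring.inverse (g i x)) := by
    intro i
    rw [contDiff_iff_contDiffAt]
    intro x
    obtain ⟨u, hu⟩ := hu i x
    have := contDiffAt_ringInverse ℝ (n := ∞) u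
    rw [hu] at this
    exact this.comp x (hg.1 i).contDiffAt
  refine ⟨hs, fun k => ?_⟩
  induction k with
  | zero =>
    intro j hj
    obtain rfl : j = 0 := by omega
    simpa using hb
  | succ k ih =>
    intro j hj
    rcases Nat.eq_zero_or_pos j with rfl | hj0
    · simpa using hb
    obtain ⟨j, rfl⟩ : ∃ j', j = j' + 1 := ⟨j - 1, by omega⟩
    have hfd : ∀ i, fderiv ℝ (fun x => Ring.inverse (g i x)) = fun x =>
        -((ContinuousLinearMap.compL ℝ D A A)
          ((ContinuousLinearMap.mulLeftRight ℝ A (Ring.inverse (g i x))) (Ring.inverse (g i x))))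
          (fderiv ℝ (g i) x) := by
      intro i
      ext1 x
      obtain ⟨u, hu⟩ := hu i x
      have h1 := hasFDerivAt_ringInverse (𝕜 := ℝ) u
      rw [hu] at h1
      have h2 := ((hg.1 i).differentiable (by simp) x).hasFDerivAt
      have h3 := h1.comp x h2
      rw [← hu, Ring.inverse_unit]
      rw [show (fun x => Ring.inverse (g i x)) = Ring.inverse ∘ g i from rfl, h3.fderiv]
      ext y
      simp
    have hgd : ∀ i, ContDiff ℝ ∞ (fderiv ℝ (g i)) := fun i => (hg.1 i).fderiv_right (by simp)
    have hgm : ModK w k (fun i => fderiv ℝ (g i)) := by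
      intro l hl
      have := hg.2 (l + 1) (l + 1) le_rfl
      simpa [norm_iteratedFDeriv_fderiv] using this
    have h1 := ModK.bilin hw (ContinuousLinearMap.mulLeftRight ℝ A) hs hs ih ih
    have h1s : ∀ i, ContDiff ℝ ∞ (fun x => (ContinuousLinearMap.mulLeftRight ℝ A (Ring.inverse (g i x)))
        (Ring.inverse (g i x))) := fun i =>
      (ContinuousLinearMap.mulLeftRight ℝ A).isBoundedBilinearMap.contDiff.comp₂ (hs i) (hs i)
    have h2 := ModK.bilin hw (ContinuousLinearMap.compL ℝ D A A) h1s hgd h1 hgm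
    have h3 := h2 j (by omega)
    refine PolyBd.mono h3 fun i x => ?_
    rw [← norm_iteratedFDeriv_fderiv, hfd]
    rw [show (fun x => -((ContinuousLinearMap.compL ℝ D A A)
          ((ContinuousLinearMap.mulLeftRight ℝ A (Ring.inverse (g i x))) (Ring.inverse (g i x))))
          (fderiv ℝ (g i) x)) = -(fun x => ((ContinuousLinearMap.compL ℝ D A A)
          ((ContinuousLinearMap.mulLeftRight ℝ A (Ring.inverse (g i x))) (Ring.inverse (g i x))))
          (fderiv ℝ (g i) x)) from rfl, iteratedFDeriv_neg_apply, norm_neg]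

end ModCalc
end NP

namespace NP
open scoped ContDiff
open Complex

/-- the Banach algebra of continuous functions on the circle -/
abbrev CA := C(Circle, ℂ)

lemma CA_inverse (g : CA) {b : ℝ} (hb : 0 < b) (h : ∀ z, b ≤ ‖g z‖) :
    IsUnit g ∧ ‖Ring.inverse g‖ ≤ 1 / b ∧ ∀ z, (Ring.inverse g) z = (g z)⁻¹ := by
  have hne : ∀ z, g z ≠ 0 := fun z hz => by
    have := h z
    rw [hz, norm_zero] at this
    linarith
  let k : CA := ⟨fun z => (g z)⁻¹, g.continuous.inv₀ hne⟩
  let u : CAˣ := ⟨g, k, by ext z; simp [k, hne z], by ext z; simp [k, hne z]⟩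
  have hinv : Ring.inverse g = k := Ring.inverse_unit u
  refine ⟨⟨u, rfl⟩, ?_, fun z => by rw [hinv]; rfl⟩
  rw [hinv, ContinuousMap.norm_le _ (by positivity)]
  intro z
  change ‖(g z)⁻¹‖ ≤ _
  rw [norm_inv, ← one_div]
  exact one_div_le_one_div_of_le hb (h z)

lemma circ_ne (ρ : ℝ) (h : 1 < ρ) (a : ℂ) (ha : ‖a‖ = 1) (z : Circle) : (ρ : ℂ) * z - a ≠ 0 := by
  intro h0
  have h1 : (ρ : ℂ) * z = a := sub_eq_zero.1 h0
  have h2 := congrArg norm h1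
  rw [norm_mul, Circle.norm_coe, ha, mul_one, Complex.norm_real, Real.norm_eq_abs] at h2
  have := le_abs_self ρ
  linarith

lemma circ_sub_ge (ρ : ℝ) (a : ℂ) (z : Circle) : |‖a‖ - ρ| ≤ ‖(ρ : ℂ) * z - a‖ ∨ ρ < 0 := by
  by_cases h : ρ < 0
  · exact Or.inr h
  left
  have := abs_norm_sub_norm_le ((ρ : ℂ) * z) a
  rw [norm_mul, Circle.norm_coe, mul_one, Complex.norm_real, Real.norm_eq_abs, abs_of_nonneg (not_lt.1 h)] at this
  rwa [abs_sub_comm]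

/-- inverse of `w + 1` on `|w| = ρ` -/
def vf (ρ : {r : ℝ // 1 < r}) : CA :=
  ⟨fun z => ((ρ.1 : ℂ) * z - (-1))⁻¹, Continuous.inv₀ (by fun_prop) (circ_ne _ ρ.2 _ (by simp))⟩

def uf (ρ : {r : ℝ // 1 < r}) : CA :=
  ⟨fun z => -I * ((ρ.1 : ℂ) * z - 1), by fun_prop⟩ * vf ρ

def af (ρ : {r : ℝ // 1 < r}) : CA := ⟨fun _ => -2 * I, continuous_const⟩ * vf ρ * vf ρ

lemma norm_vf (ρ : {r : ℝ // 1 < r}) : ‖vf ρ‖ ≤ 1 / (ρ.1 - 1) := by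
  have h := ρ.2
  have h0 : 0 < ρ.1 - 1 := by linarith
  rw [ContinuousMap.norm_le _ (by positivity)]
  intro z
  change ‖((ρ.1 : ℂ) * z - (-1))⁻¹‖ ≤ _
  rw [norm_inv, ← one_div]
  apply one_div_le_one_div_of_le h0
  rcases circ_sub_ge ρ.1 (-1) z with h1 | h1
  · refine le_trans ?_ h1
    rw [norm_neg, norm_one, abs_sub_comm]
    exact le_abs_self _
  · linarith

lemma norm_uf (ρ : {r : ℝ // 1 < r}) (h2 : ρ.1 ≤ 2) : ‖uf ρ‖ ≤ 3 / (ρ.1 - 1) := by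
  have h := ρ.2
  have h0 : 0 < ρ.1 - 1 := by linarith
  have h3 : ‖(⟨fun z => -I * ((ρ.1 : ℂ) * z - 1), by fun_prop⟩ : CA)‖ ≤ 3 := by
    rw [ContinuousMap.norm_le _ (by norm_num)]
    intro z
    change ‖-I * ((ρ.1 : ℂ) * z - 1)‖ ≤ _
    rw [norm_mul, norm_neg, norm_I, one_mul]
    refine (norm_sub_le _ _).trans ?_
    rw [norm_mul, Circle.norm_coe, norm_one, mul_one, Complex.norm_real, Real.norm_eq_abs, abs_of_pos (by linarith)]
    linarith
  refine (norm_mul_le _ _).trans ?_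
  refine (mul_le_mul h3 (norm_vf ρ) (norm_nonneg _) (by norm_num)).trans (le_of_eq (by ring))

lemma norm_af (ρ : {r : ℝ // 1 < r}) : ‖af ρ‖ ≤ 2 * (1 / (ρ.1 - 1)) * (1 / (ρ.1 - 1)) := by
  have h := ρ.2
  have h0 : 0 < ρ.1 - 1 := by linarith
  have h3 : ‖(⟨fun _ => -2 * I, continuous_const⟩ : CA)‖ ≤ 2 := by
    rw [ContinuousMap.norm_le _ (by norm_num)]
    intro z
    change ‖-2 * I‖ ≤ 2
    simp
  refine (norm_mul_le _ _).trans (mul_le_mul ((norm_mul_le _ _).trans (mul_le_mul h3 (norm_vf ρ)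
    (norm_nonneg _) (by norm_num))) (norm_vf ρ) (norm_nonneg _) (by positivity))

/-- `(u-μ)(w+1) = -(i+μ)(w-ω)` lower bound -/
lemma uf_sub_ge (ρ : {r : ℝ // 1 < r}) (h2 : ρ.1 ≤ 2) (μ : ℂ) {a b : ℝ} (ha : 0 ≤ a) (hb : 0 ≤ b)
    (h1 : a ≤ ‖I + μ‖) (ha0 : 0 < a)
    (hω : b ≤ |‖(I - μ) / (I + μ)‖ - ρ.1|) (z : Circle) : a * b / 3 ≤ ‖uf ρ z - μ‖ := by
  have h := ρ.2
  have hne : I + μ ≠ 0 := by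
    intro h0
    rw [h0, norm_zero] at h1
    linarith
  have hw := circ_ne ρ.1 h (-1) (by simp) z
  have e : uf ρ z - μ = -((I + μ) * ((ρ.1 : ℂ) * z - (I - μ) / (I + μ))) / ((ρ.1 : ℂ) * z - (-1)) := by
    change (-I * ((ρ.1 : ℂ) * z - 1)) * ((ρ.1 : ℂ) * z - (-1))⁻¹ - μ = _
    field_simp
    ring
  rw [e, norm_div, norm_neg, norm_mul]
  have h3 : ‖(ρ.1 : ℂ) * z - (-1)‖ ≤ 3 := by
    refine (norm_sub_le _ _).trans ?_
    rw [norm_mul, Circle.norm_coe, norm_neg, norm_one, mul_one, Complex.norm_real, Real.norm_eq_abs, abs_of_pos (by linarith)]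
    linarith
  have h4 : b ≤ ‖(ρ.1 : ℂ) * z - (I - μ) / (I + μ)‖ := by
    rcases circ_sub_ge ρ.1 ((I - μ) / (I + μ)) z with h5 | h5
    · exact hω.trans h5
    · linarith
  have h5 : 0 < ‖(ρ.1 : ℂ) * z - (-1)‖ := norm_pos_iff.2 hw
  refine div_le_div₀ (by positivity) (mul_le_mul h1 h4 hb (by positivity)) h5 h3

/-- the functional `g ↦ (1/2πi) ∮_{|w|=ρ} w^m g dw` -/
def Lf (ρ : {r : ℝ // 1 < r}) (m : ℕ) : CA →L[ℝ] ℂ :=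
  LinearMap.mkContinuous
    { toFun := fun g => (1 / (2 * Real.pi) : ℂ) * ∫ θ in (0 : ℝ)..2 * Real.pi,
        ((ρ.1 : ℂ) * Circle.exp θ) ^ (m + 1) * g (Circle.exp θ)
      map_add' := fun f g => by
        rw [← mul_add, ← intervalIntegral.integral_add]
        · simp [mul_add]
        · exact Continuous.intervalIntegrable (by fun_prop) _ _
        · exact Continuous.intervalIntegrable (by fun_prop) _ _
      map_smul' := fun c f => by
        simp only [ContinuousMap.smul_apply, mul_smul_comm, RingHom.id_apply]
        rw [intervalIntegral.integral_smul, mul_smul_comm] }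
    (ρ.1 ^ (m + 1)) (by
      intro g
      have hρ : 0 < ρ.1 := by linarith [ρ.2]
      simp only [LinearMap.coe_mk, AddHom.coe_mk]
      have hpi := Real.pi_pos
      have h1 : ‖∫ θ in (0 : ℝ)..2 * Real.pi, ((ρ.1 : ℂ) * Circle.exp θ) ^ (m + 1) * g (Circle.exp θ)‖
          ≤ (ρ.1 ^ (m + 1) * ‖g‖) * |2 * Real.pi - 0| := by
        apply intervalIntegral.norm_integral_le_of_norm_le_const
        intro θ _
        rw [norm_mul, norm_pow, norm_mul, Circle.norm_coe, mul_one, Complex.norm_real, Real.norm_eq_abs,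
          abs_of_pos hρ]
        exact mul_le_mul_of_nonneg_left (g.norm_coe_le_norm _) (by positivity)
      rw [sub_zero, abs_of_pos (by positivity)] at h1
      rw [norm_mul]
      have h2 : ‖(1 / (2 * Real.pi) : ℂ)‖ = 1 / (2 * Real.pi) := by
        rw [norm_div, norm_mul, Complex.norm_real, Real.norm_eq_abs, abs_of_pos hpi]
        simp
      rw [h2]
      calc _ ≤ 1 / (2 * Real.pi) * ((ρ.1 ^ (m + 1) * ‖g‖) * (2 * Real.pi)) :=
            mul_le_mul_of_nonneg_left h1 (by positivity)
        _ = _ := by field_simp)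

lemma norm_Lf (ρ : {r : ℝ // 1 < r}) (m : ℕ) : ‖Lf ρ m‖ ≤ ρ.1 ^ (m + 1) :=
  LinearMap.mkContinuous_norm_le _ (by have := ρ.2; positivity) _

lemma Lf_cauchy (ρ : {r : ℝ // 1 < r}) (m : ℕ) (z : ℂ) (hz : ‖z‖ = 1) (k : CA)
    (hk : ∀ c : Circle, k c = ((ρ.1 : ℂ) * c - z)⁻¹) : Lf ρ m k = z ^ m := by
  have hd : DiffContOnCl ℂ (fun w : ℂ => w ^ m) (Metric.ball 0 ρ.1) :=
    (differentiable_pow m).diffContOnCl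
  have h1 := hd.two_pi_i_inv_smul_circleIntegral_sub_inv_smul (w := z) (by simp [hz, ρ.2])
  rw [← h1]
  change (1 / (2 * Real.pi) : ℂ) * ∫ θ in (0 : ℝ)..2 * Real.pi,
        ((ρ.1 : ℂ) * Circle.exp θ) ^ (m + 1) * k (Circle.exp θ) = _
  rw [circleIntegral]
  have h2 : ∀ θ : ℝ, deriv (circleMap 0 ρ.1) θ • (circleMap 0 ρ.1 θ - z)⁻¹ • (circleMap 0 ρ.1 θ) ^ m =
      I * (((ρ.1 : ℂ) * Circle.exp θ) ^ (m + 1) * k (Circle.exp θ)) := by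
    intro θ
    rw [deriv_circleMap, hk]
    simp only [circleMap, zero_add, smul_eq_mul, Circle.coe_exp]
    ring
  simp_rw [h2]
  rw [intervalIntegral.integral_const_mul, smul_eq_mul, ← mul_assoc]
  congr 1
  have := Real.pi_ne_zero
  field_simp

/-- pigeonhole for the radii -/
lemma pigeon_radius {n : ℕ} (om : Fin n → ℝ) {h : ℝ} (hh : 0 < h) :
    ∃ l : ℕ, l ≤ n ∧ ∀ j, h / 2 ≤ |om j - (1 + (l + 1) * h)| := by
  by_contra hcon
  push Not at hcon
  have : ∀ l : Fin (n + 1), ∃ j, |om j - (1 + ((l : ℕ) + 1) * h)| < h / 2 := fun l => hcon l (by omega)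
  choose J hJ using this
  obtain ⟨a, b, hab, he⟩ := Fintype.exists_ne_map_eq_of_card_lt J (by simp)
  have h1 := hJ a
  have h2 := hJ b
  rw [he] at h1
  have hne : (a : ℕ) ≠ b := fun h => hab (Fin.ext h)
  have h3 : (1 : ℝ) ≤ |((a : ℕ) : ℝ) - (b : ℕ)| := by
    have : (1 : ℤ) ≤ |((a : ℕ) : ℤ) - (b : ℕ)| := Int.one_le_abs (by omega)
    exact_mod_cast this
  rw [abs_lt] at h1 h2
  rcases le_abs.1 h3 with h4 | h4 <;> nlinarith

lemma exists_roots_fin {n : ℕ} (p : Polynomial ℂ) (hp : p.Monic) (hd : p.natDegree = n) :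
    ∃ μ : Fin n → ℂ, p = ∏ i, (Polynomial.X - Polynomial.C (μ i)) := by
  have h1 := IsAlgClosed.splits p
  have h2 : Multiset.card p.roots = n := by rw [← hd]; exact h1.natDegree_eq_card_roots.symm
  have h3 := h1.eq_prod_roots_of_monic hp
  obtain ⟨l, hl⟩ := Quot.exists_rep p.roots
  have hl' : (l : Multiset ℂ) = p.roots := hl
  rw [← hl'] at h2 h3
  rw [Multiset.coe_card] at h2
  subst h2
  refine ⟨fun i => l.get i, ?_⟩
  rw [h3, Multiset.map_coe, Multiset.prod_coe]
  rw [← List.prod_ofFn]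
  congr 1
  conv_lhs => rw [← List.ofFn_get l]
  rw [List.map_ofFn]
  rfl

end NP

namespace NP
open scoped ContDiff
open Complex

/-- smooth compactly supported truncation of the identity -/
lemma exists_clamp : ∃ χ : ℝ → ℝ, ContDiff ℝ ∞ χ ∧ HasCompactSupport χ ∧ (∀ t, |t| ≤ 1 → χ t = t) ∧
    ∀ t, |χ t| ≤ 2 := by
  let b : ContDiffBump (0 : ℝ) := ⟨1, 2, by norm_num, by norm_num⟩
  refine ⟨fun t => t * b t, contDiff_id.mul b.contDiff, b.hasCompactSupport.mul_left, ?_, ?_⟩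
  · intro t ht
    have : b t = 1 := b.one_of_mem_closedBall (by simpa [b] using ht)
    simp [this]
  · intro t
    by_cases h : |t| ≤ 2
    · rw [abs_mul, abs_of_nonneg b.nonneg]
      nlinarith [b.nonneg (x := t), b.le_one (x := t), abs_nonneg t]
    · have : b t = 0 := b.zero_of_le_dist (by simp [b]; linarith)
      simp [this]

def phi (t : ℝ) : ℝ := Real.smoothTransition (t + 1) - Real.smoothTransition t

lemma phi_contDiff : ContDiff ℝ ∞ phi :=
  (Real.smoothTransition.contDiff.comp (contDiff_id.add contDiff_const)).sub Real.smoothTransition.contDiff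

lemma phi_zero {t : ℝ} (ht : 1 ≤ |t|) : phi t = 0 := by
  unfold phi
  rcases le_abs.1 ht with h | h
  · rw [Real.smoothTransition.one_of_one_le h, Real.smoothTransition.one_of_one_le (by linarith), sub_self]
  · rw [Real.smoothTransition.zero_of_nonpos (by linarith), Real.smoothTransition.zero_of_nonpos (by linarith), sub_self]

lemma phi_compact : HasCompactSupport phi := by
  apply HasCompactSupport.of_support_subset_isCompact (isCompact_Icc (a := (-1 : ℝ)) (b := 1))
  intro t ht
  by_contra h
  apply ht
  apply phi_zero
  by_contra h2
  push Not at h2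
  exact h (abs_le.1 h2.le)

lemma phi_sum (K : ℕ) {t : ℝ} (ht : |t| ≤ K) : ∑ κ ∈ Finset.range (2 * K + 1), phi (t + K - κ) = 1 := by
  have h : ∀ κ : ℕ, phi (t + K - κ) = (fun i : ℕ => Real.smoothTransition (t + K + 1 - i)) κ -
      (fun i : ℕ => Real.smoothTransition (t + K + 1 - i)) (κ + 1) := by
    intro κ
    simp only [phi]
    congr 2 <;> push_cast <;> ring
  simp_rw [h]
  rw [Finset.sum_range_sub']
  rw [abs_le] at ht
  rw [Real.smoothTransition.one_of_one_le (by push_cast; linarith),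
    Real.smoothTransition.zero_of_nonpos (by push_cast; linarith), sub_zero]

lemma poly_diff_quot {A : Type*} [CommRing A] {n : ℕ} (u y : A) (lam : Fin n → A) :
    (u ^ n + ∑ l, lam l * u ^ (l : ℕ)) - (y ^ n + ∑ l, lam l * y ^ (l : ℕ)) =
    (u - y) * ∑ j : Fin n, (u ^ (n - 1 - j) + ∑ l : Fin n, if j < l then lam l * u ^ ((l : ℕ) - 1 - j) else 0)
      * y ^ (j : ℕ) := by
  have key : ∀ l : ℕ, u ^ l - y ^ l = (u - y) * ∑ j ∈ Finset.range l, u ^ (l - 1 - j) * y ^ j := by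
    intro l
    have := (Commute.all y u).mul_geom_sum₂ l
    have e : ∑ j ∈ Finset.range l, u ^ (l - 1 - j) * y ^ j = ∑ j ∈ Finset.range l, y ^ j * u ^ (l - 1 - j) :=
      Finset.sum_congr rfl fun j _ => mul_comm _ _
    rw [e]
    linear_combination this
  have key2 : ∀ l : Fin n, lam l * u ^ (l : ℕ) - lam l * y ^ (l : ℕ) =
      (u - y) * ∑ j : Fin n, (if j < l then lam l * u ^ ((l : ℕ) - 1 - j) else 0) * y ^ (j : ℕ) := by
    intro l
    have h1 : ∑ j : Fin n, (if j < l then lam l * u ^ ((l : ℕ) - 1 - j) else 0) * y ^ (j : ℕ) =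
      ∑ j ∈ Finset.range n, (if j < (l : ℕ) then lam l * u ^ ((l : ℕ) - 1 - j) else 0) * y ^ j := by
      rw [Finset.sum_range]
      rfl
    have h2 : ∑ j ∈ Finset.range n, (if j < (l : ℕ) then lam l * u ^ ((l : ℕ) - 1 - j) else 0) * y ^ j =
        ∑ j ∈ Finset.range l, lam l * (u ^ ((l : ℕ) - 1 - j) * y ^ j) := by
      have hs : Finset.range (l : ℕ) ⊆ Finset.range n := Finset.range_mono l.2.le
      rw [← Finset.sum_subset hs]
      · refine Finset.sum_congr rfl fun j hj => ?_
        rw [if_pos (Finset.mem_range.1 hj)]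
        ring
      · intro j _ hj
        rw [if_neg (by simpa using hj), zero_mul]
    rw [h1, h2, ← Finset.mul_sum, ← mul_sub, key]
    ring
  calc _ = (u ^ n - y ^ n) + ∑ l, (lam l * u ^ (l : ℕ) - lam l * y ^ (l : ℕ)) := by
        rw [Finset.sum_sub_distrib]; ring
    _ = _ := by
      rw [key, Finset.sum_congr rfl fun l _ => key2 l, ← Finset.mul_sum, ← mul_add, Finset.sum_comm,
        Finset.sum_range, ← Finset.sum_add_distrib]
      congr 1
      refine Finset.sum_congr rfl fun j _ => ?_
      rw [add_mul, Finset.sum_mul]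

/-- pointwise bounds -/
lemma good_radius {n : ℕ} (hn : 0 < n) (m : ℕ) (c : Fin n → ℝ) (hc : ∀ j, |c j| ≤ 1 / (2 * n * 2 ^ n)) :
    ∃ ρ : {r : ℝ // 1 < r}, ρ.1 ≤ 2 ∧ 1 / ((n + 1) * (m + 1)) ≤ ρ.1 - 1 ∧ ρ.1 ≤ 1 + 1 / (m + 1) ∧
      (∀ z, (1 / (12 * ((n + 1) * (m + 1)))) ^ n ≤ ‖uf ρ z ^ n + ∑ j, (c j : ℂ) * uf ρ z ^ (j : ℕ)‖) ∧
      ∀ z, ∀ y : ℝ, 1 / (3 * ((n + 1) * (m + 1))) ≤ ‖uf ρ z - y‖ := by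
  set p : Polynomial ℂ := Polynomial.X ^ n + ∑ j : Fin n, Polynomial.C (c j : ℂ) * Polynomial.X ^ (j : ℕ) with hp
  have hdeg : (∑ j : Fin n, Polynomial.C (c j : ℂ) * Polynomial.X ^ (j : ℕ)).degree < ((n : ℕ) : WithBot ℕ) :=
    Polynomial.degree_sum_fin_lt _
  have hmon : p.Monic := Polynomial.monic_X_pow_add hdeg
  have hnd : p.natDegree = n := by
    rw [hp, Polynomial.natDegree_add_eq_left_of_degree_lt, Polynomial.natDegree_X_pow]
    simpa using hdeg
  obtain ⟨μ, hμ⟩ := exists_roots_fin p hmon hnd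
  have hev : ∀ u : ℂ, p.eval u = u ^ n + ∑ j, (c j : ℂ) * u ^ (j : ℕ) := by
    intro u
    simp [hp, Polynomial.eval_finsetSum]
  have hev2 : ∀ u : ℂ, p.eval u = ∏ i, (u - μ i) := by
    intro u
    rw [hμ, Polynomial.eval_prod]
    simp
  have hn' : (0 : ℝ) < n := by exact_mod_cast hn
  have hroot : ∀ i, ‖μ i‖ ≤ 1 / 2 := by
    intro i
    by_contra hcon
    push Not at hcon
    have h0 : p.eval (μ i) = 0 := by
      rw [hev2]
      exact Finset.prod_eq_zero (Finset.mem_univ i) (sub_self _)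
    rw [hev] at h0
    have h1 : ‖μ i‖ ^ n ≤ ∑ j : Fin n, |c j| * ‖μ i‖ ^ (j : ℕ) := by
      have : μ i ^ n = -∑ j, (c j : ℂ) * μ i ^ (j : ℕ) := eq_neg_of_add_eq_zero_left h0
      rw [← norm_pow, this, norm_neg]
      refine (norm_sum_le _ _).trans (le_of_eq (Finset.sum_congr rfl fun j _ => ?_))
      rw [norm_mul, norm_pow, Complex.norm_real, Real.norm_eq_abs]
    have hx : 0 < ‖μ i‖ := by linarith
    have h2 : ∀ j : Fin n, |c j| * ‖μ i‖ ^ (j : ℕ) ≤ 1 / (2 * n) * ‖μ i‖ ^ n := by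
      intro j
      have h3 : (1 : ℝ) ≤ (2 * ‖μ i‖) ^ (n - j) := one_le_pow₀ (by linarith)
      have h4 : ‖μ i‖ ^ n = ‖μ i‖ ^ (j : ℕ) * ‖μ i‖ ^ (n - j) := by rw [← pow_add]; congr 1; omega
      have h5 : (2 : ℝ) ^ (n - j) ≤ 2 ^ n := pow_le_pow_right₀ (by norm_num) (by omega)
      rw [mul_pow] at h3
      have h6 : 1 ≤ 2 ^ n * ‖μ i‖ ^ (n - j) :=
        h3.trans (mul_le_mul_of_nonneg_right h5 (by positivity))
      calc |c j| * ‖μ i‖ ^ (j : ℕ) ≤ 1 / (2 * n * 2 ^ n) * ‖μ i‖ ^ (j : ℕ) :=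
            mul_le_mul_of_nonneg_right (hc j) (by positivity)
        _ ≤ 1 / (2 * n * 2 ^ n) * ‖μ i‖ ^ (j : ℕ) * (2 ^ n * ‖μ i‖ ^ (n - j)) :=
            le_mul_of_one_le_right (by positivity) h6
        _ = 1 / (2 * n) * ‖μ i‖ ^ n := by rw [h4]; field_simp
    have h3 := h1.trans (Finset.sum_le_sum fun j _ => h2 j)
    rw [Finset.sum_const, Finset.card_univ, Fintype.card_fin, nsmul_eq_mul] at h3
    have h4 : (n : ℝ) * (1 / (2 * n) * ‖μ i‖ ^ n) = 1 / 2 * ‖μ i‖ ^ n := by field_simp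
    have h5 : 0 < ‖μ i‖ ^ n := by positivity
    linarith
  have hh : (0 : ℝ) < 1 / ((n + 1) * (m + 1)) := by positivity
  obtain ⟨l, hl, hl2⟩ := pigeon_radius (fun i => ‖(I - μ i) / (I + μ i)‖) hh
  set h : ℝ := 1 / ((n + 1) * (m + 1)) with hdef
  have hl' : (l : ℝ) ≤ n := by exact_mod_cast hl
  have hl0 : (0 : ℝ) ≤ l := by positivity
  have hr1 : h ≤ (l + 1) * h := by nlinarith
  have hr2 : ((l : ℝ) + 1) * h ≤ 1 / (m + 1) := by
    calc ((l : ℝ) + 1) * h ≤ (n + 1) * h := by nlinarith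
      _ = 1 / (m + 1) := by rw [hdef]; field_simp
  have hr3 : (1 : ℝ) / (m + 1) ≤ 1 := by
    rw [div_le_one (by positivity)]
    have : (0 : ℝ) ≤ m := by positivity
    linarith
  refine ⟨⟨1 + (l + 1) * h, by nlinarith⟩, by simp only; linarith, by simp only; linarith, by simp only; linarith, ?_, ?_⟩
  · intro z
    rw [← hev, hev2, norm_prod]
    rw [show (1 / (12 * (((n : ℝ) + 1) * (m + 1)))) ^ n = ∏ _i : Fin n, (1 / (12 * (((n : ℝ) + 1) * (m + 1)))) by simp]
    refine Finset.prod_le_prod (fun _ _ => by positivity) fun i _ => ?_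
    have h1 : (1 : ℝ) / 2 ≤ ‖I + μ i‖ := by
      have := norm_sub_norm_le I (-μ i)
      rw [norm_I, norm_neg, sub_neg_eq_add] at this
      linarith [hroot i]
    have := uf_sub_ge ⟨1 + (l + 1) * h, by nlinarith⟩ (by simp only; linarith) (μ i) (a := 1 / 2) (b := h / 2)
      (by norm_num) (by positivity) h1 (by norm_num) (hl2 i) z
    refine le_trans (le_of_eq ?_) this
    rw [hdef]
    field_simp
    norm_num
  · intro z y
    have hy : ‖I - (y : ℂ)‖ = ‖I + (y : ℂ)‖ := by
      rw [← Complex.norm_conj (I + (y : ℂ))]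
      simp only [map_add, conj_I, conj_ofReal]
      rw [← norm_neg]
      congr 1
      ring
    have h1 : 1 ≤ ‖I + (y : ℂ)‖ := by
      have := Complex.abs_im_le_norm (I + (y : ℂ))
      simpa using this
    have h2 : ‖(I - (y : ℂ)) / (I + (y : ℂ))‖ = 1 := by
      rw [norm_div, hy, div_self (by linarith)]
    have := uf_sub_ge ⟨1 + (l + 1) * h, by nlinarith⟩ (by simp only; linarith) (y : ℂ) (a := 1) (b := h)
      (by norm_num) (by positivity) h1 (by norm_num) (by
        rw [h2]
        simp only
        rw [abs_sub_comm]
        refine le_trans ?_ (le_abs_self _)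
        linarith) z
    refine le_trans (le_of_eq ?_) this
    rw [hdef]
    field_simp

end NP

namespace NP
open scoped ContDiff
open Complex

/-- the algebraic identity behind the division -/
lemma division_alg {n : ℕ} (hn : 0 < n) (ρ : {r : ℝ // 1 < r}) (m : ℕ) (y : ℝ) (lam : Fin n → ℝ) (G invG U invU : CA)
    (hG : G = uf ρ ^ n + ∑ j, lam j • uf ρ ^ (j : ℕ)) (hU : U = uf ρ - algebraMap ℝ CA y)
    (h1 : G * invG = 1) (h2 : U * invU = 1) :
    ((1 + I * y) / (1 - I * y)) ^ m = (y ^ n + ∑ j, lam j * y ^ (j : ℕ)) • Lf ρ m (af ρ * invG * invU) +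
      ∑ j : Fin n, y ^ (j : ℕ) • Lf ρ m (af ρ * (uf ρ ^ (n - 1 - j) +
        ∑ l : Fin n, if j < l then lam l • uf ρ ^ ((l : ℕ) - 1 - j) else 0) * invG
          + if (j : ℕ) = 0 then vf ρ else 0) := by
  have hIy : (1 - I * y : ℂ) ≠ 0 := by
    intro h
    have := congrArg Complex.re h
    simp at this
  have hIy' : (1 + I * y : ℂ) ≠ 0 := by
    intro h
    have := congrArg Complex.re h
    simp at this
  have hz : ‖((1 + I * y) / (1 - I * y) : ℂ)‖ = 1 := by
    have : ‖(1 + I * y : ℂ)‖ = ‖(1 - I * y : ℂ)‖ := by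
      rw [← Complex.norm_conj (1 + I * y : ℂ)]
      simp [sub_eq_add_neg]
    rw [norm_div, this, div_self (norm_ne_zero_iff.2 hIy)]
  have hk : Lf ρ m (af ρ * invU + vf ρ) = ((1 + I * y) / (1 - I * y)) ^ m := by
    refine Lf_cauchy ρ m _ hz _ fun c => ?_
    have hw1 := circ_ne _ ρ.2 (-1) (by simp) c
    have hw2 := circ_ne _ ρ.2 _ hz c
    have hUc : U c * invU c = 1 := by
      have := congrArg (fun f : CA => f c) h2
      simpa using this
    have hUne : U c ≠ 0 := left_ne_zero_of_mul_eq_one hUc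
    have hinv : invU c = (U c)⁻¹ := eq_inv_of_mul_eq_one_right hUc
    have e : U c = uf ρ c - y := by rw [hU]; rfl
    simp only [ContinuousMap.add_apply, ContinuousMap.mul_apply, hinv]
    rw [e] at hUne ⊢
    simp only [uf, af, vf, ContinuousMap.mul_apply, ContinuousMap.coe_mk] at hUne ⊢
    set W : ℂ := (ρ.1 : ℂ) * c
    have hw3 : W * (1 - I * y) - (1 + I * y) ≠ 0 := by
      intro h
      apply hw2
      field_simp
      linear_combination h
    have e2 : -I * (W - 1) * (W - (-1))⁻¹ - y = -I * (W * (1 - I * y) - (1 + I * y)) / (W - (-1)) := by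
      field_simp
      linear_combination (-W*y-y) * I_sq
    rw [e2]
    have e3 : W - (1 + I * y) / (1 - I * y) = (W * (1 - I * y) - (1 + I * y)) / (1 - I * y) := by
      field_simp
    rw [e3]
    field_simp
    ring
  have hdiff := poly_diff_quot (uf ρ) (algebraMap ℝ CA y) (fun l => algebraMap ℝ CA (lam l))
  have hmain : invU = (y ^ n + ∑ j, lam j * y ^ (j : ℕ)) • (invG * invU) + ∑ j : Fin n, y ^ (j : ℕ) •
      ((uf ρ ^ (n - 1 - j) +
        ∑ l : Fin n, if j < l then lam l • uf ρ ^ ((l : ℕ) - 1 - j) else 0) * invG) := by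
    simp only [Algebra.smul_def] at hG ⊢
    rw [← hG, ← hU] at hdiff
    have e1 : algebraMap ℝ CA (y ^ n + ∑ j, lam j * y ^ (j : ℕ)) =
      algebraMap ℝ CA y ^ n + ∑ j, algebraMap ℝ CA (lam j) * algebraMap ℝ CA y ^ (j : ℕ) := by
      simp only [map_add, map_pow, map_sum, map_mul]
    rw [e1]
    set Py := algebraMap ℝ CA y ^ n + ∑ j, algebraMap ℝ CA (lam j) * algebraMap ℝ CA y ^ (j : ℕ)
    set T := ∑ j : Fin n, (uf ρ ^ (n - 1 - j) + ∑ l : Fin n, if j < l then algebraMap ℝ CA (lam l) *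
      uf ρ ^ ((l : ℕ) - 1 - j) else 0) * algebraMap ℝ CA y ^ (j : ℕ) with hT
    have e2 : ∑ j : Fin n, (algebraMap ℝ CA) (y ^ (j : ℕ)) * ((uf ρ ^ (n - 1 - j) +
        ∑ l : Fin n, if j < l then algebraMap ℝ CA (lam l) * uf ρ ^ ((l : ℕ) - 1 - j) else 0) * invG) = T * invG := by
      rw [hT, Finset.sum_mul]
      refine Finset.sum_congr rfl fun j _ => ?_
      rw [map_pow]
      ring
    rw [e2]
    linear_combination invG * invU * hdiff - invU * h1 + T * invG * h2
  rw [← hk]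
  conv_lhs => rw [hmain]
  have e3 : vf ρ = ∑ j : Fin n, y ^ (j : ℕ) • (if (j : ℕ) = 0 then vf ρ else 0) := by
    rw [Finset.sum_eq_single (⟨0, hn⟩ : Fin n)]
    · simp
    · intro b _ hb
      have : (b : ℕ) ≠ 0 := fun h => hb (Fin.ext h)
      simp [this]
    · simp
  conv_lhs => rw [e3]
  rw [mul_add, Finset.mul_sum, add_assoc, ← Finset.sum_add_distrib, map_add, map_sum, mul_smul_comm, map_smul,
    ← mul_assoc]
  congr 1
  refine Finset.sum_congr rfl fun j _ => ?_
  rw [← map_smul, smul_add, mul_smul_comm, mul_assoc]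

end NP

namespace NP
open scoped ContDiff
open Complex

lemma Mod.pow {ι : Type*} {w : ι → ℝ} {D A : Type*} [NormedAddCommGroup D] [NormedSpace ℝ D]
    [NormedCommRing A] [NormedAlgebra ℝ A] (hw : ∀ i, 1 ≤ w i) {f : ι → D → A} (hf : Mod w f) (n : ℕ) :
    Mod w (fun i x => f i x ^ n) := by
  simpa using Mod.prod hw (Finset.range n) (f := fun _ => f) (fun _ _ => hf)

lemma division_pow {n : ℕ} (hn : 0 < n) : ∃ δ : ℝ, 0 < δ ∧ ∃ (Q : ℕ → ℝ × (Fin n → ℝ) → ℂ)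
    (R : Fin n → ℕ → (Fin n → ℝ) → ℂ),
    Mod (fun m : ℕ => (m : ℝ) + 1) Q ∧ (∀ j, Mod (fun m : ℕ => (m : ℝ) + 1) (R j)) ∧
    ∀ (m : ℕ) (y : ℝ) (lam : Fin n → ℝ), |y| ≤ 1 → (∀ j, |lam j| ≤ δ) →
      ((1 + I * y) / (1 - I * y)) ^ m = (y ^ n + ∑ j, lam j * y ^ (j : ℕ)) • Q m (y, lam) +
        ∑ j : Fin n, y ^ (j : ℕ) • R j m lam := by
  obtain ⟨χ, hχs, hχc, hχ1, hχ2⟩ := exists_clamp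
  have hn' : (1 : ℝ) ≤ n := by exact_mod_cast hn
  set δ : ℝ := 1 / (2 * n * 2 ^ n) with hδ
  have hδ0 : 0 < δ := by positivity
  let K : ℕ → ℕ := fun m => (36 * ((n + 1) * (m + 1)) ^ 2) ^ n
  have hK1 : ∀ m, (1 : ℝ) ≤ K m := fun m => by
    have : 1 ≤ K m := Nat.one_le_pow _ _ (by positivity)
    exact_mod_cast this
  have hKc : ∀ m, (K m : ℝ) = (36 * ((n + 1) * (m + 1)) ^ 2) ^ n := fun m => by simp [K]
  let ι := ℕ × (Fin n → ℕ)
  let D := ℝ × (Fin n → ℝ)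
  let w : ι → ℝ := fun i => (i.1 : ℝ) + 1
  have hw : ∀ i, 1 ≤ w i := fun i => by simp [w]
  have hw0 : ∀ m : ℕ, (1 : ℝ) ≤ (m : ℝ) + 1 := fun i => by simp
  let c : ι → Fin n → ℝ := fun i j => δ * (((min (i.2 j) (2 * K i.1) : ℕ) : ℝ) - K i.1) / K i.1
  have hc : ∀ i j, |c i j| ≤ 1 / (2 * n * 2 ^ n) := by
    intro i j
    have h1 := hK1 i.1
    rw [← hδ]
    simp only [c]
    rw [mul_div_assoc, abs_mul, abs_of_pos hδ0]
    refine mul_le_of_le_one_right hδ0.le ?_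
    rw [abs_div, abs_of_pos (by linarith : (0 : ℝ) < K i.1), div_le_one (by linarith), abs_le]
    have h2 : ((min (i.2 j) (2 * K i.1) : ℕ) : ℝ) ≤ 2 * K i.1 := by
      exact_mod_cast min_le_right _ _
    have h3 : (0 : ℝ) ≤ ((min (i.2 j) (2 * K i.1) : ℕ) : ℝ) := by positivity
    constructor <;> linarith
  choose ρ hρ2 hρ1 hρ3 hρG hρU using fun i : ι => good_radius hn i.1 (c i) (hc i)
  let arg : Fin n → ι → D → ℝ := fun j i p => (K i.1 / δ) * p.2 j + (K i.1 - i.2 j)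
  let cl : Fin n → ι → D → ℝ := fun j i p => c i j + (δ / K i.1) * χ (arg j i p)
  let G : ι → D → CA := fun i p => uf (ρ i) ^ n + ∑ j, cl j i p • uf (ρ i) ^ (j : ℕ)
  let U : ι → D → CA := fun i p => uf (ρ i) - algebraMap ℝ CA (χ p.1)
  let bump : ι → D → ℝ := fun i p => ∏ j, phi (arg j i p)
  -- bounds
  have hwP : PolyBd w (fun i (_ : Unit) => w i) := ⟨1, 1, by norm_num, fun i _ => by simp⟩
  have hrho : ∀ i, 1 / ((ρ i).1 - 1) ≤ (n + 1) * w i := by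
    intro i
    have h := hρ1 i
    have h0 : (0 : ℝ) < (n + 1) * w i := by have := hw i; positivity
    rw [div_le_iff₀ (by linarith [(ρ i).2])]
    rw [div_le_iff₀ (by simpa [w] using h0)] at h
    simp only [w]; linarith
  have hNP : PolyBd w (fun i (_ : Unit) => ((n : ℝ) + 1) * w i) :=
    PolyBd.mul hw (PolyBd.const _) hwP (fun _ _ => by positivity) (fun i _ => by linarith [hw i])
  have hvB : PolyBd w (fun i (_ : Unit) => ‖vf (ρ i)‖) :=
    PolyBd.mono hNP fun i _ => (norm_vf _).trans (hrho i)
  have huB0 : ∀ i, ‖uf (ρ i)‖ ≤ 3 * ((n + 1) * w i) := fun i => by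
    refine (norm_uf _ (hρ2 i)).trans ?_
    have := hrho i
    rw [show 3 / ((ρ i).1 - 1) = 3 * (1 / ((ρ i).1 - 1)) by ring]
    linarith
  have huB : PolyBd w (fun i (_ : Unit) => ‖uf (ρ i)‖) :=
    PolyBd.mono (PolyBd.mul hw (PolyBd.const 3) hNP (fun _ _ => by positivity)
      (fun i _ => by have := hw i; positivity)) fun i _ => huB0 i
  have haB : PolyBd w (fun i (_ : Unit) => ‖af (ρ i)‖) := by
    refine PolyBd.mono (PolyBd.mul hw (PolyBd.const 2) (PolyBd.mul hw hNP hNP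
      (fun i _ => by have := hw i; positivity) (fun i _ => by have := hw i; positivity)) (fun _ _ => by positivity)
      (fun i _ => by have := hw i; positivity)) fun i _ => (norm_af _).trans ?_
    beta_reduce
    rw [mul_assoc]
    have h0 : 0 ≤ 1 / ((ρ i).1 - 1) := by have := (ρ i).2; exact div_nonneg zero_le_one (by linarith)
    have := hrho i
    gcongr
  have hLB : PolyBd w (fun i (_ : Unit) => ‖Lf (ρ i) i.1‖) := by
    refine PolyBd.mono (PolyBd.const (Real.exp 1)) fun i _ => (norm_Lf _ _).trans ?_
    have h1 : (ρ i).1 ≤ Real.exp (1 / (i.1 + 1)) := by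
      have := Real.add_one_le_exp (1 / ((i.1 : ℝ) + 1))
      linarith [hρ3 i]
    calc (ρ i).1 ^ (i.1 + 1) ≤ Real.exp (1 / (i.1 + 1)) ^ (i.1 + 1) := by
          have := (ρ i).2; gcongr
      _ = Real.exp 1 := by
        rw [← Real.exp_nat_mul]
        congr 1
        push_cast
        field_simp
  have hKB : PolyBd w (fun i (_ : Unit) => (K i.1 : ℝ)) := by
    refine ⟨(36 * (n + 1) ^ 2) ^ n, 2 * n, by positivity, fun i _ => ?_⟩
    beta_reduce
    rw [hKc]
    simp only [w]
    rw [pow_mul, ← mul_pow]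
    apply le_of_eq
    ring
  have hsB : PolyBd w (fun i (_ : Unit) => ‖δ / K i.1‖) := by
    refine PolyBd.mono (PolyBd.const δ) fun i _ => ?_
    have := hK1 i.1
    rw [Real.norm_of_nonneg (by positivity)]
    exact div_le_self hδ0.le this
  -- moderate families
  have hχm : Mod w (fun _ => χ) := Mod.of_compactSupport hχs hχc
  have hφm : Mod w (fun _ => phi) := Mod.of_compactSupport phi_contDiff phi_compact
  have hlin : ∀ j, PolyBd w (fun i (_ : Unit) => ‖((K i.1 : ℝ) / δ) •
      ((ContinuousLinearMap.proj (R := ℝ) (φ := fun _ : Fin n => ℝ) j).comp (ContinuousLinearMap.snd ℝ ℝ (Fin n → ℝ)))‖) := by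
    intro j
    refine PolyBd.mono (PolyBd.mul hw hKB (PolyBd.const (1 / δ * ‖((ContinuousLinearMap.proj (R := ℝ)
      (φ := fun _ : Fin n => ℝ) j).comp (ContinuousLinearMap.snd ℝ ℝ (Fin n → ℝ)))‖)) (fun _ _ => by positivity)
      (fun _ _ => by positivity)) fun i _ => ?_
    rw [norm_smul, Real.norm_of_nonneg (by positivity)]
    apply le_of_eq
    ring
  have hargm : ∀ {f : ℝ → ℝ}, Mod w (fun _ => f) → ∀ j, Mod w (fun i p => f (arg j i p)) := by
    intro f hf j
    exact Mod.comp_affine hw (fun i : ι => ((K i.1 : ℝ) / δ) •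
      ((ContinuousLinearMap.proj (R := ℝ) (φ := fun _ : Fin n => ℝ) j).comp (ContinuousLinearMap.snd ℝ ℝ (Fin n → ℝ))))
      (fun i => (K i.1 : ℝ) - i.2 j) (hlin j) hf
  have hclm : ∀ j, Mod w (cl j) := by
    intro j
    refine Mod.add hw (Mod.const _ ?_) (Mod.mul hw (Mod.const _ hsB) (hargm hχm j))
    exact PolyBd.mono (PolyBd.const _) fun i _ => hc i j
  have hum : Mod w (fun i (_ : D) => uf (ρ i)) := Mod.const _ huB
  have hGm : Mod w G := Mod.add hw (Mod.pow hw hum n) (Mod.sum hw _ fun j _ =>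
    Mod.smul hw (hclm j) (Mod.pow hw hum _))
  have hUm : Mod w U := by
    have h1 : Mod w (fun (i : ι) (p : D) => χ p.1) := by
      have := Mod.comp_affine hw (fun i : ι => ContinuousLinearMap.fst ℝ ℝ (Fin n → ℝ)) (fun _ => 0)
        (PolyBd.const _) hχm
      simpa using this
    have h2 : Mod w (fun (i : ι) (p : D) => χ p.1 • (-1 : CA)) :=
      Mod.smul hw h1 (Mod.const _ (PolyBd.const _))
    have h3 := Mod.add hw hum h2
    have e : U = fun i p => uf (ρ i) + χ p.1 • (-1 : CA) := by
      funext i p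
      simp only [U, Algebra.algebraMap_eq_smul_one, smul_neg, sub_eq_add_neg]
    rw [e]
    exact h3
  have hbm : Mod w bump := Mod.prod hw _ fun j _ => hargm hφm j
  -- inverses
  have hGb : ∀ i p, ∀ z, 1 / 2 * (1 / (12 * ((n + 1) * w i))) ^ n ≤ ‖G i p z‖ := by
    intro i p z
    have h1 := hρG i z
    have e1 : G i p z = (uf (ρ i) z ^ n + ∑ j, (c i j : ℂ) * uf (ρ i) z ^ (j : ℕ)) +
        ∑ j : Fin n, ((δ / K i.1 * χ (arg j i p) : ℝ) : ℂ) * uf (ρ i) z ^ (j : ℕ) := by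
      simp only [G, cl, ContinuousMap.add_apply, ContinuousMap.pow_apply, ContinuousMap.sum_apply,
        ContinuousMap.smul_apply, real_smul]
      rw [add_assoc, ← Finset.sum_add_distrib]
      congr 1
      refine Finset.sum_congr rfl fun j _ => ?_
      push_cast
      ring
    have hNw : (1 : ℝ) ≤ (n + 1) * w i := by nlinarith [hw i]
    have hK0 := hK1 i.1
    have h2 : ‖∑ j : Fin n, ((δ / K i.1 * χ (arg j i p) : ℝ) : ℂ) * uf (ρ i) z ^ (j : ℕ)‖ ≤
        1 / 2 * (1 / (12 * ((n + 1) * w i))) ^ n := by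
      have h3 : ∀ j : Fin n, ‖((δ / K i.1 * χ (arg j i p) : ℝ) : ℂ) * uf (ρ i) z ^ (j : ℕ)‖ ≤
          δ / K i.1 * 2 * (3 * ((n + 1) * w i)) ^ n := by
        intro j
        rw [norm_mul, norm_real, Real.norm_eq_abs, abs_mul, abs_of_pos (by positivity), norm_pow]
        have h4 : ‖uf (ρ i) z‖ ^ (j : ℕ) ≤ (3 * ((n + 1) * w i)) ^ n := by
          calc _ ≤ (3 * ((n + 1) * w i)) ^ (j : ℕ) := by
                gcongr
                exact ((uf (ρ i)).norm_coe_le_norm z).trans (huB0 i)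
            _ ≤ _ := pow_le_pow_right₀ (by linarith) j.2.le
        have := hχ2 (arg j i p)
        gcongr
      refine (norm_sum_le _ _).trans ((Finset.sum_le_sum fun j _ => h3 j).trans ?_)
      rw [Finset.sum_const, Finset.card_univ, Fintype.card_fin, nsmul_eq_mul, hKc]
      have hwe : (i.1 : ℝ) + 1 = w i := rfl
      rw [hwe]
      set N : ℝ := (n + 1) * w i with hN
      have e5 : (36 * N ^ 2) ^ n = (3 * N) ^ n * (12 * N) ^ n := by
        rw [← mul_pow]; congr 1; ring
      rw [e5, hδ]
      have h2n : (2 : ℝ) ≤ 2 ^ n := le_self_pow₀ (by norm_num) hn.ne'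
      have : (n : ℝ) * (1 / (2 * n * 2 ^ n) / ((3 * N) ^ n * (12 * N) ^ n) * 2 * (3 * N) ^ n)
        = (1 / 2 ^ n) * (1 / (12 * N)) ^ n := by
        rw [one_div_pow (12 * N)]
        field_simp
      rw [this]
      gcongr
    rw [e1]
    have h4 := norm_sub_norm_le (uf (ρ i) z ^ n + ∑ j, (c i j : ℂ) * uf (ρ i) z ^ (j : ℕ))
      (-∑ j : Fin n, ((δ / K i.1 * χ (arg j i p) : ℝ) : ℂ) * uf (ρ i) z ^ (j : ℕ))
    rw [norm_neg, sub_neg_eq_add] at h4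
    have h5 : (1 / (12 * ((n + 1) * w i))) ^ n ≤ ‖uf (ρ i) z ^ n + ∑ j, (c i j : ℂ) * uf (ρ i) z ^ (j : ℕ)‖ := h1
    linarith
  have hUb : ∀ i p, ∀ z, 1 / (3 * ((n + 1) * w i)) ≤ ‖U i p z‖ := fun i p z => hρU i z (χ p.1)
  have hGinv := fun i p => CA_inverse (G i p) (by have := hw i; positivity) (hGb i p)
  have hUinv := fun i p => CA_inverse (U i p) (by have := hw i; positivity) (hUb i p)
  have hGim : Mod w (fun i p => Ring.inverse (G i p)) := by
    refine Mod.inverse hw hGm (fun i p => (hGinv i p).1) ?_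
    refine ⟨2 * (12 * (n + 1)) ^ n, n, by positivity, fun i p => (hGinv i p).2.1.trans (le_of_eq ?_)⟩
    have := hw i
    rw [mul_assoc, ← mul_pow, one_div_pow]
    field_simp
  have hUim : Mod w (fun i p => Ring.inverse (U i p)) := by
    refine Mod.inverse hw hUm (fun i p => (hUinv i p).1) ?_
    refine ⟨3 * (n + 1), 1, by positivity, fun i p => (hUinv i p).2.1.trans (le_of_eq ?_)⟩
    have := hw i
    field_simp
  have ham : Mod w (fun i (_ : D) => af (ρ i)) := Mod.const _ haB
  let q : ι → D → ℂ := fun i p => bump i p • Lf (ρ i) i.1 (af (ρ i) * Ring.inverse (G i p) * Ring.inverse (U i p))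
  have hq : Mod w q := Mod.smul hw hbm (Mod.clm hw _ hLB (Mod.mul hw (Mod.mul hw ham hGim) hUim))
  let r : Fin n → ι → D → ℂ := fun j i p => bump i p • Lf (ρ i) i.1 (af (ρ i) * (uf (ρ i) ^ (n - 1 - j) +
        ∑ l : Fin n, if j < l then cl l i p • uf (ρ i) ^ ((l : ℕ) - 1 - j) else 0) * Ring.inverse (G i p)
          + if (j : ℕ) = 0 then vf (ρ i) else 0)
  have hr : ∀ j, Mod w (r j) := by
    intro j
    refine Mod.smul hw hbm (Mod.clm hw _ hLB (Mod.add hw (Mod.mul hw (Mod.mul hw ham (Mod.add hw (Mod.pow hw hum _)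
      (Mod.sum hw _ fun l _ => ?_))) hGim) ?_))
    · split_ifs
      · exact Mod.smul hw (hclm l) (Mod.pow hw hum _)
      · exact Mod.const _ (by simpa using PolyBd.const 0)
    · split_ifs
      · exact Mod.const _ hvB
      · exact Mod.const _ (by simpa using PolyBd.const 0)
  let S : ℕ → Finset (Fin n → ℕ) := fun m => Fintype.piFinset (fun _ => Finset.range (2 * K m + 1))
  have hS : PolyBd (fun m : ℕ => (m : ℝ) + 1) (fun i (_ : Unit) => ((S i).card : ℝ)) := by
    have hKB' : PolyBd (fun m : ℕ => (m : ℝ) + 1) (fun i (_ : Unit) => (K i : ℝ)) := by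
      obtain ⟨C, N, hC, h⟩ := hKB
      exact ⟨C, N, hC, fun m _ => h (m, fun _ => 0) ()⟩
    have := PolyBd.pow hw0 (PolyBd.add hw0 (PolyBd.mul hw0 (PolyBd.const 2) hKB' (fun _ _ => by positivity)
      (fun _ _ => by positivity)) (PolyBd.const 1)) (fun _ _ => by positivity) n
    refine PolyBd.mono this fun m _ => ?_
    simp [S]
  refine ⟨δ, hδ0, fun m p => ∑ κ ∈ S m, q (m, κ) p, fun j m lam => ∑ κ ∈ S m, r j (m, κ) (0, lam),
    Mod.finsetSum hw0 S hS hq, fun j => ?_, ?_⟩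
  · have h1 := Mod.finsetSum hw0 S hS (hr j)
    have h2 := Mod.comp_affine hw0 (fun _ => ContinuousLinearMap.inr ℝ ℝ (Fin n → ℝ)) (fun _ => 0) (PolyBd.const _) h1
    simpa using h2
  · intro m y lam hy hlam
    have hterm : ∀ κ ∈ S m, bump (m, κ) (y, lam) • ((1 + I * y) / (1 - I * y)) ^ m =
        (y ^ n + ∑ j, lam j * y ^ (j : ℕ)) • q (m, κ) (y, lam) + ∑ j : Fin n, y ^ (j : ℕ) • r j (m, κ) (0, lam) := by
      intro κ hκ
      have hr0 : ∀ j, r j (m, κ) (0, lam) = r j (m, κ) (y, lam) := fun j => rfl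
      simp only [hr0]
      by_cases hb : bump (m, κ) (y, lam) = 0
      · simp [q, r, hb]
      have hcl : ∀ j, cl j (m, κ) (y, lam) = lam j := by
        intro j
        have h1 : phi (arg j (m, κ) (y, lam)) ≠ 0 := fun h => hb (Finset.prod_eq_zero (Finset.mem_univ j) h)
        have h2 : |arg j (m, κ) (y, lam)| ≤ 1 := by
          by_contra h
          exact h1 (phi_zero (not_le.1 h).le)
        have h3 : κ j ≤ 2 * K m := by
          have := Fintype.mem_piFinset.1 hκ j
          simp at this
          omega
        have h4 := hK1 m
        simp only [cl, c]
        rw [hχ1 _ h2]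
        simp only [arg, min_eq_left h3]
        have : (K m : ℝ) ≠ 0 := by linarith
        field_simp
        ring
      have hy' : χ y = y := hχ1 y hy
      have key := division_alg hn (ρ (m, κ)) m y lam (G (m, κ) (y, lam)) (Ring.inverse (G (m, κ) (y, lam)))
        (U (m, κ) (y, lam)) (Ring.inverse (U (m, κ) (y, lam))) (by simp only [G, hcl]) (by simp only [U, hy'])
        (Ring.mul_inverse_cancel _ (hGinv _ _).1) (Ring.mul_inverse_cancel _ (hUinv _ _).1)
      rw [key, smul_add, Finset.smul_sum]
      simp only [q, r, hcl]
      congr 1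
      · rw [smul_comm]
      · refine Finset.sum_congr rfl fun j _ => ?_
        rw [smul_comm]
    have hsum : ∑ κ ∈ S m, bump (m, κ) (y, lam) = 1 := by
      simp only [bump, S]
      have := Finset.prod_univ_sum (fun _ : Fin n => Finset.range (2 * K m + 1))
        (fun j κ => phi (K m / δ * lam j + (K m - κ)))
      rw [← this]
      apply Finset.prod_eq_one
      intro j _
      have h4 := hK1 m
      have := phi_sum (K m) (t := K m / δ * lam j) (by
        rw [abs_mul, abs_of_pos (by positivity), div_mul_eq_mul_div, div_le_iff₀ hδ0]
        exact mul_le_mul_of_nonneg_left (hlam j) (by linarith))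
      rw [← this]
      refine Finset.sum_congr rfl fun κ _ => ?_
      congr 1
      ring
    calc ((1 + I * y) / (1 - I * y)) ^ m = ∑ κ ∈ S m, bump (m, κ) (y, lam) • ((1 + I * y) / (1 - I * y)) ^ m := by
          rw [← Finset.sum_smul, hsum, one_smul]
      _ = _ := by
        rw [Finset.sum_congr rfl hterm, Finset.sum_add_distrib, ← Finset.smul_sum, Finset.sum_comm]
        simp only [Finset.smul_sum]

end NP

namespace NP
open scoped ContDiff
open Complex MeasureTheory

/-- partial Fourier coefficients -/
def fc (m : ℝ) (h : ℝ × ℝ → ℂ) (x : ℝ) : ℂ := ∫ t : ℝ, cexp (-(2 * Real.pi * m * t : ℝ) * I) * h (x, t)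

lemma exp_norm (m t : ℝ) : ‖cexp (-(2 * Real.pi * m * t : ℝ) * I)‖ = 1 := by
  rw [← ofReal_neg, norm_exp_ofReal_mul_I]

lemma fc_dom {h : ℝ × ℝ → ℂ} (hh : Continuous h) (hc : HasCompactSupport h) :
    ∃ b : ℝ → ℝ, Integrable b ∧ ∀ x t, ‖h (x, t)‖ ≤ b t := by
  obtain ⟨C, hC⟩ := hc.exists_bound_of_continuous hh
  obtain ⟨r, hr⟩ := hc.isCompact.isBounded.subset_closedBall 0
  refine ⟨(Icc (-r) r).indicator fun _ => C, (integrable_indicator_iff measurableSet_Icc).2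
    (by simp), fun x t => ?_⟩
  by_cases ht : t ∈ Icc (-r) r
  · rw [indicator_of_mem ht]
    exact hC _
  · rw [indicator_of_notMem ht]
    have : (x, t) ∉ tsupport h := fun h' => by
      have := hr h'
      rw [mem_closedBall_zero_iff] at this
      have h2 : ‖t‖ ≤ r := (norm_snd_le (x, t)).trans this
      exact ht (abs_le.1 h2)
    rw [image_eq_zero_of_notMem_tsupport this, norm_zero]

lemma fc_integrable {h : ℝ × ℝ → ℂ} (hh : Continuous h) (hc : HasCompactSupport h) (m x : ℝ) :
    Integrable (fun t : ℝ => cexp (-(2 * Real.pi * m * t : ℝ) * I) * h (x, t)) := by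
  obtain ⟨b, hb, hb2⟩ := fc_dom hh hc
  refine hb.mono' (Continuous.aestronglyMeasurable (by fun_prop)) (Eventually.of_forall fun t => ?_)
  rw [norm_mul, exp_norm, one_mul]
  exact hb2 x t

lemma fc_bound {h : ℝ × ℝ → ℂ} (hh : Continuous h) (hc : HasCompactSupport h) :
    ∃ C, 0 ≤ C ∧ ∀ m x, ‖fc m h x‖ ≤ C := by
  obtain ⟨b, hb, hb2⟩ := fc_dom hh hc
  refine ⟨∫ t, b t, integral_nonneg fun t => (norm_nonneg _).trans (hb2 0 t), fun m x => ?_⟩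
  refine norm_integral_le_of_norm_le hb (Eventually.of_forall fun t => ?_)
  rw [norm_mul, exp_norm, one_mul]
  exact hb2 x t

def dx (h : ℝ × ℝ → ℂ) : ℝ × ℝ → ℂ := fun p => fderiv ℝ h p (1, 0)
def dt (h : ℝ × ℝ → ℂ) : ℝ × ℝ → ℂ := fun p => fderiv ℝ h p (0, 1)

lemma dir_smooth {h : ℝ × ℝ → ℂ} (hh : ContDiff ℝ ∞ h) (v : ℝ × ℝ) : ContDiff ℝ ∞ (fun p => fderiv ℝ h p v) :=
  (hh.fderiv_right (m := ∞) (by simp)).clm_apply contDiff_const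

lemma dir_compact {h : ℝ × ℝ → ℂ} (hc : HasCompactSupport h) (v : ℝ × ℝ) :
    HasCompactSupport (fun p => fderiv ℝ h p v) := hc.fderiv_apply (𝕜 := ℝ) v

lemma hasDerivAt_dx {h : ℝ × ℝ → ℂ} (hh : ContDiff ℝ ∞ h) (x t : ℝ) :
    HasDerivAt (fun x => h (x, t)) (dx h (x, t)) x := by
  have h1 := (hh.differentiable (by simp) (x, t)).hasFDerivAt
  have h2 : HasDerivAt (fun x : ℝ => (x, t)) ((1 : ℝ), (0 : ℝ)) x := (hasDerivAt_id x).prodMk (hasDerivAt_const x t)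
  exact h1.comp_hasDerivAt x h2

lemma hasDerivAt_dt {h : ℝ × ℝ → ℂ} (hh : ContDiff ℝ ∞ h) (x t : ℝ) :
    HasDerivAt (fun t => h (x, t)) (dt h (x, t)) t := by
  have h1 := (hh.differentiable (by simp) (x, t)).hasFDerivAt
  have h2 : HasDerivAt (fun t : ℝ => (x, t)) ((0 : ℝ), (1 : ℝ)) t := (hasDerivAt_const t x).prodMk (hasDerivAt_id t)
  exact h1.comp_hasDerivAt t h2

lemma fc_hasDerivAt {h : ℝ × ℝ → ℂ} (hh : ContDiff ℝ ∞ h) (hc : HasCompactSupport h) (m x : ℝ) :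
    HasDerivAt (fc m h) (fc m (dx h) x) x := by
  have hs := dir_smooth hh (1, 0)
  obtain ⟨b, hb, hb2⟩ := fc_dom hs.continuous (dir_compact hc (1, 0))
  refine (hasDerivAt_integral_of_dominated_loc_of_deriv_le (bound := b) (univ_mem) (Eventually.of_forall fun x => ?_)
    (fc_integrable hh.continuous hc m x)
    (F' := fun x t => cexp (-(2 * Real.pi * m * t : ℝ) * I) * dx h (x, t)) ?_ ?_ hb ?_).2
  · exact (fc_integrable hh.continuous hc m x).1
  · exact (fc_integrable hs.continuous (dir_compact hc (1, 0)) m x).1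
  · refine Eventually.of_forall fun t x _ => ?_
    rw [norm_mul, exp_norm, one_mul]
    exact hb2 x t
  · refine Eventually.of_forall fun t x _ => ?_
    exact (hasDerivAt_dx hh x t).const_mul _

lemma fc_dt {h : ℝ × ℝ → ℂ} (hh : ContDiff ℝ ∞ h) (hc : HasCompactSupport h) (m x : ℝ) :
    fc m (dt h) x = (2 * Real.pi * I * m) * fc m h x := by
  have hs := dir_smooth hh (0, 1)
  have i1 := fc_integrable hh.continuous hc m x
  have i2 := fc_integrable (h := dt h) hs.continuous (dir_compact hc (0, 1)) m x
  have key := integral_eq_zero_of_hasDerivAt_of_integrable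
    (f := fun t : ℝ => cexp (-(2 * Real.pi * m * t : ℝ) * I) * h (x, t))
    (f' := fun t : ℝ => (-(2 * Real.pi * I * m)) * (cexp (-(2 * Real.pi * m * t : ℝ) * I) * h (x, t)) +
      cexp (-(2 * Real.pi * m * t : ℝ) * I) * dt h (x, t)) (fun t => ?_) ((i1.const_mul _).add i2) i1
  · rw [integral_add (i1.const_mul _) i2, integral_const_mul] at key
    unfold fc
    linear_combination key
  · have h1 : HasDerivAt (fun t : ℝ => -((2 * Real.pi * m * t : ℝ) : ℂ) * I) (-((2 * Real.pi * m : ℝ) : ℂ) * I) t := by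
      have := ((((hasDerivAt_id t).const_mul (2 * Real.pi * m)).ofReal_comp).neg).mul_const I
      simpa using this
    have := h1.cexp.mul (hasDerivAt_dt hh x t)
    refine HasDerivAt.congr_deriv this ?_
    push_cast
    ring

/-- the operator multiplying the coefficients by `m + 1` -/
def Tt (h : ℝ × ℝ → ℂ) : ℝ × ℝ → ℂ := fun p => h p + (1 / (2 * Real.pi * I)) * dt h p

lemma Tt_smooth {h : ℝ × ℝ → ℂ} (hh : ContDiff ℝ ∞ h) : ContDiff ℝ ∞ (Tt h) :=
  hh.add (contDiff_const.mul (dir_smooth hh _))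

lemma Tt_compact {h : ℝ × ℝ → ℂ} (hc : HasCompactSupport h) : HasCompactSupport (Tt h) :=
  hc.add ((dir_compact hc (0, 1)).mul_left)

lemma fc_Tt {h : ℝ × ℝ → ℂ} (hh : ContDiff ℝ ∞ h) (hc : HasCompactSupport h) (m x : ℝ) :
    fc m (Tt h) x = (m + 1) * fc m h x := by
  have hs := dir_smooth hh (0, 1)
  have i1 := fc_integrable hh.continuous hc m x
  have i2 := fc_integrable (h := dt h) hs.continuous (dir_compact hc (0, 1)) m x
  have : fc m (Tt h) x = fc m h x + (1 / (2 * Real.pi * I)) * fc m (dt h) x := by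
    unfold fc
    rw [← integral_const_mul, ← integral_add i1 (i2.const_mul _)]
    congr 1
    funext t
    simp only [Tt]
    ring
  rw [this, fc_dt hh hc]
  have : (Real.pi : ℂ) ≠ 0 := by exact_mod_cast Real.pi_ne_zero
  field_simp
  ring

lemma fc_decay {h : ℝ × ℝ → ℂ} (hh : ContDiff ℝ ∞ h) (hc : HasCompactSupport h) (N : ℕ) :
    ∃ C, 0 ≤ C ∧ ∀ (m : ℕ) x, ‖fc m h x‖ * ((m : ℝ) + 1) ^ N ≤ C := by
  induction N generalizing h with
  | zero =>
    obtain ⟨C, h0, h1⟩ := fc_bound hh.continuous hc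
    exact ⟨C, h0, fun m x => by simpa using h1 m x⟩
  | succ N ih =>
    obtain ⟨C, h0, h1⟩ := ih (Tt_smooth hh) (Tt_compact hc)
    refine ⟨C, h0, fun m x => ?_⟩
    have := h1 m x
    rw [fc_Tt hh hc, norm_mul] at this
    have e : ‖(((m : ℝ) : ℂ) + 1)‖ = (m : ℝ) + 1 := by
      rw [← ofReal_one, ← ofReal_add, norm_real, Real.norm_of_nonneg (by positivity)]
    rw [e] at this
    calc _ = _ := ?_
      _ ≤ C := this
    ring

lemma fc_smooth {h : ℝ × ℝ → ℂ} (hh : ContDiff ℝ ∞ h) (hc : HasCompactSupport h) (m : ℝ) :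
    ContDiff ℝ ∞ (fc m h) := by
  rw [contDiff_infty]
  intro n
  induction n generalizing h with
  | zero =>
    rw [Nat.cast_zero, contDiff_zero]
    exact continuous_iff_continuousAt.2 fun x => (fc_hasDerivAt hh hc m x).continuousAt
  | succ n ih =>
    rw [Nat.cast_succ, contDiff_succ_iff_deriv]
    refine ⟨fun x => (fc_hasDerivAt hh hc m x).differentiableAt, by simp, ?_⟩
    have : deriv (fc m h) = fc m (dx h) := funext fun x => (fc_hasDerivAt hh hc m x).deriv
    rw [this]
    exact ih (dir_smooth hh _) (dir_compact hc _)

lemma fc_decay_deriv {h : ℝ × ℝ → ℂ} (hh : ContDiff ℝ ∞ h) (hc : HasCompactSupport h) (k N : ℕ) :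
    ∃ C, 0 ≤ C ∧ ∀ (m : ℕ) x, ‖iteratedFDeriv ℝ k (fc m h) x‖ * ((m : ℝ) + 1) ^ N ≤ C := by
  simp only [norm_iteratedFDeriv_eq_norm_iteratedDeriv]
  induction k generalizing h with
  | zero => simpa using fc_decay hh hc N
  | succ k ih =>
    obtain ⟨C, h0, h1⟩ := ih (dir_smooth hh (1, 0)) (dir_compact hc (1, 0))
    refine ⟨C, h0, fun m x => ?_⟩
    rw [iteratedDeriv_succ']
    have : deriv (fc m h) = fc m (dx h) := funext fun x => (fc_hasDerivAt hh hc m x).deriv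
    rw [this]
    exact h1 m x

end NP

namespace NP
open scoped ContDiff FourierTransform
open Complex MeasureTheory

lemma fc_eq_fourier (h : ℝ × ℝ → ℂ) (m x : ℝ) : fc m h x = 𝓕 (fun t => h (x, t)) m := by
  rw [Real.fourier_real_eq_integral_exp_smul]
  unfold fc
  congr 1
  funext t
  rw [smul_eq_mul]
  congr 2
  push_cast
  ring

lemma fc_neg (g : ℝ × ℝ → ℝ) (m x : ℝ) : fc (-m) (fun p => (g p : ℂ)) x = starRingEnd ℂ (fc m (fun p => (g p : ℂ)) x) := by
  unfold fc
  rw [← integral_conj]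
  congr 1
  funext t
  rw [map_mul, ← exp_conj, map_mul, map_neg, conj_ofReal, conj_I, conj_ofReal]
  congr 2
  push_cast
  ring

lemma fc_summable {h : ℝ × ℝ → ℂ} (hh : ContDiff ℝ ∞ h) (hc : HasCompactSupport h) (x : ℝ) (z : ℂ) (hz : ‖z‖ = 1) :
    Summable (fun m : ℕ => fc m h x * z ^ m) := by
  obtain ⟨C, h0, h1⟩ := fc_decay hh hc 2
  have hs : Summable (fun m : ℕ => C * (1 / ((m : ℝ) + 1) ^ 2)) := by
    have := (summable_nat_add_iff 1).2 (Real.summable_one_div_nat_pow.2 (one_lt_two))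
    simpa using this.mul_left C
  refine Summable.of_norm_bounded hs fun m => ?_
  rw [norm_mul, norm_pow, hz, one_pow, mul_one, mul_one_div, le_div_iff₀ (by positivity)]
  exact h1 m x

/-- Fourier series of a smooth function supported in a fundamental domain. -/
lemma fc_hasSum {g : ℝ × ℝ → ℝ} (hg : ContDiff ℝ ∞ g) (hc : HasCompactSupport g)
    (hs : ∀ x t, 1 / 3 ≤ |t| → g (x, t) = 0) (x t : ℝ) (ht : |t| ≤ 1 / 3) :
    HasSum (fun m : ℕ => (fc m (if m = 0 then (fun p => (g p : ℂ)) else fun p => 2 * (g p : ℂ)) x *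
      cexp (2 * Real.pi * t * I) ^ m).re) (g (x, t)) := by
  set h : ℝ × ℝ → ℂ := fun p => (g p : ℂ) with hh
  have hhs : ContDiff ℝ ∞ h := ofRealCLM.contDiff.comp hg
  have hhc : HasCompactSupport h := hc.comp_left ofReal_zero
  set z : ℂ := cexp (2 * Real.pi * t * I) with hz
  have hz1 : ‖z‖ = 1 := by
    have := norm_exp_ofReal_mul_I (2 * Real.pi * t)
    rw [hz, ← this]
    push_cast
    rfl
  have hsm := (fc_summable hhs hhc x z hz1).hasSum
  set A := ∑' m : ℕ, fc m h x * z ^ m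
  have hconj : HasSum (fun m : ℕ => fc (-m) h x * (z ^ m)⁻¹) (starRingEnd ℂ A) := by
    have h1 := hsm.map (starRingEnd ℂ) Complex.continuous_conj
    refine h1.congr_fun ?_ |> fun h => h
    intro m
    simp only [Function.comp, map_mul, map_pow]
    rw [fc_neg]
    congr 1
    rw [← inv_pow, Complex.inv_eq_conj hz1]
  let f : ℤ → ℂ := fun n => fc n h x * z ^ n
  have hf1 : HasSum (fun n : ℕ => f n) A := by
    simpa [f] using hsm
  have hf2 : HasSum (fun n : ℕ => f (-n)) (starRingEnd ℂ A) := by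
    simpa [f] using hconj
  have hf := HasSum.of_nat_of_neg hf1 hf2
  -- Poisson
  have hx : ContDiff ℝ ∞ (fun t => h (x, t)) := hhs.comp (contDiff_const.prodMk contDiff_id)
  have hxc : HasCompactSupport (fun t => h (x, t)) := by
    apply HasCompactSupport.of_support_subset_isCompact (isCompact_Icc (a := (-1 / 3 : ℝ)) (b := 1 / 3))
    intro s hs'
    by_contra hcon
    apply hs'
    have : g (x, s) = 0 := hs x s (by
      by_contra h2
      push Not at h2
      have := abs_lt.1 h2
      exact hcon ⟨by linarith, by linarith⟩)
    simp [h, this]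
  have hP := SchwartzMap.tsum_eq_tsum_fourier (hxc.toSchwartzMap hx) t
  have e1 : ∑' n : ℤ, (hxc.toSchwartzMap hx) (t + n) = h (x, t) := by
    rw [tsum_eq_single 0]
    · simp
    · intro n hn
      have h1 : (1 : ℝ) ≤ |(n : ℝ)| := by
        rw [← Int.cast_abs]
        exact_mod_cast Int.one_le_abs hn
      have : g (x, t + n) = 0 := hs x _ (by
        have := abs_sub_abs_le_abs_sub (n : ℝ) (-t)
        rw [abs_neg, sub_neg_eq_add, add_comm] at this
        linarith)
      change h (x, t + n) = 0
      simp [h, this]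
  have e2 : ∀ n : ℤ, 𝓕 (hxc.toSchwartzMap hx) n * fourier n (t : UnitAddCircle) = f n := by
    intro n
    simp only [f]
    rw [fc_eq_fourier, fourier_coe_apply]
    congr 1
    rw [hz, ← exp_int_mul]
    congr 1
    push_cast
    ring
  rw [e1] at hP
  simp_rw [e2] at hP
  rw [hf.tsum_eq] at hP
  have hre : g (x, t) = 2 * A.re - (fc 0 h x).re := by
    have := congrArg Complex.re hP
    simp only [hh, f, sub_re, add_re, conj_re, Int.cast_zero, zpow_zero, mul_one, ofReal_re] at this
    rw [this]
    ring
  rw [hre]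
  have h3 : HasSum (fun m : ℕ => 2 * (fc m h x * z ^ m).re) (2 * A.re) := (hasSum_re hsm).mul_left 2
  have h4 : HasSum (fun m : ℕ => if m = 0 then (fc 0 h x).re else 0) (fc 0 h x).re := by
    exact hasSum_ite_eq 0 _
  refine (h3.sub h4).congr_fun ?_ |> fun h => h
  intro m
  by_cases hm : m = 0
  · subst hm
    simp
    ring
  · have : fc m (fun p => 2 * (g p : ℂ)) x = 2 * fc m h x := by
      unfold fc
      rw [← integral_const_mul]
      congr 1
      funext t
      simp only [h]
      ring
    simp only [hm, if_false]
    rw [this, mul_assoc]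
    simp

end NP

namespace NP
open scoped ContDiff
open Complex

lemma rapid_tsum {D₁ D₂ : Type*} [NormedAddCommGroup D₁] [NormedSpace ℝ D₁] [NormedAddCommGroup D₂]
    [NormedSpace ℝ D₂] (a : ℕ → D₁ → ℂ) (ha : ∀ m, ContDiff ℝ ∞ (a m))
    (hr : ∀ k N : ℕ, ∃ C, 0 ≤ C ∧ ∀ (m : ℕ) x, ‖iteratedFDeriv ℝ k (a m) x‖ * ((m : ℝ) + 1) ^ N ≤ C)
    (q : ℕ → D₂ → ℂ) (hq : Mod (fun m : ℕ => (m : ℝ) + 1) q) :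
    ContDiff ℝ ∞ (fun p : D₁ × D₂ => ∑' m, a m p.1 * q m p.2) ∧
      ∀ x p, Summable (fun m => a m x * q m p) := by
  have hw0 : ∀ m : ℕ, (1 : ℝ) ≤ (m : ℝ) + 1 := fun i => by simp
  have hq2 : Mod (fun m : ℕ => (m : ℝ) + 1) (fun m (p : D₁ × D₂) => q m p.2) := by
    have h2 := Mod.comp_affine hw0 (fun _ => ContinuousLinearMap.snd ℝ D₁ D₂) (fun _ => 0) (PolyBd.const _) hq
    simpa using h2
  have hr2 : ∀ k N : ℕ, ∃ C, 0 ≤ C ∧ ∀ (m : ℕ) x,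
      ‖iteratedFDeriv ℝ k (fun p : D₁ × D₂ => a m p.1) x‖ * ((m : ℝ) + 1) ^ N ≤ C := by
    intro k N
    obtain ⟨C, h0, h1⟩ := hr k N
    refine ⟨C, h0, fun m x => le_trans ?_ (h1 m x.1)⟩
    have h2 := (ContinuousLinearMap.fst ℝ D₁ D₂).iteratedFDeriv_comp_right (i := k) (ha m) x (by exact_mod_cast le_top)
    have h3 : (fun p : D₁ × D₂ => a m p.1) = (a m) ∘ (ContinuousLinearMap.fst ℝ D₁ D₂) := rfl
    rw [h3, h2]
    have h4 : ∏ _i : Fin k, ‖ContinuousLinearMap.fst ℝ D₁ D₂‖ ≤ 1 :=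
      Finset.prod_le_one (fun _ _ => norm_nonneg _) fun _ _ => ContinuousLinearMap.norm_fst_le ℝ D₁ D₂
    gcongr
    exact (ContinuousMultilinearMap.norm_compContinuousLinearMap_le _ _).trans (mul_le_of_le_one_right (norm_nonneg _) h4)
  have key : ∀ k : ℕ, ∃ v : ℕ → ℝ, Summable v ∧ ∀ (m : ℕ) x, ‖iteratedFDeriv ℝ k (fun p : D₁ × D₂ => a m p.1 * q m p.2) x‖ ≤ v m := by
    intro k
    have hl : ∀ l : ℕ, ∃ v : ℕ → ℝ, Summable v ∧ ∀ (m : ℕ) x, (k.choose l : ℝ) *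
        ‖iteratedFDeriv ℝ l (fun p : D₁ × D₂ => a m p.1) x‖ * ‖iteratedFDeriv ℝ (k - l) (fun p : D₁ × D₂ => q m p.2) x‖ ≤ v m := by
      intro l
      obtain ⟨C, N, hC, h⟩ := hq2.2 k (k - l) (Nat.sub_le _ _)
      obtain ⟨C', hC', h'⟩ := hr2 l (N + 2)
      refine ⟨fun m => (k.choose l : ℝ) * C' * C * (1 / ((m : ℝ) + 1) ^ 2), ?_, fun m x => ?_⟩
      · have := (summable_nat_add_iff 1).2 (Real.summable_one_div_nat_pow.2 (one_lt_two))
        simpa using this.mul_left ((k.choose l : ℝ) * C' * C)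
      · have h1 := h m x
        have h2 := h' m x
        have h3 : (0 : ℝ) < ((m : ℝ) + 1) := by positivity
        rw [pow_add, ← mul_assoc] at h2
        calc _ ≤ (k.choose l : ℝ) * ‖iteratedFDeriv ℝ l (fun p : D₁ × D₂ => a m p.1) x‖ * (C * ((m : ℝ) + 1) ^ N) := by
              gcongr
          _ = (k.choose l : ℝ) * C * (‖iteratedFDeriv ℝ l (fun p : D₁ × D₂ => a m p.1) x‖ * ((m : ℝ) + 1) ^ N *
                ((m : ℝ) + 1) ^ 2) * (1 / ((m : ℝ) + 1) ^ 2) := by field_simp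
          _ ≤ (k.choose l : ℝ) * C * C' * (1 / ((m : ℝ) + 1) ^ 2) := by gcongr
          _ = _ := by ring
    choose v hv hv2 using hl
    refine ⟨fun m => ∑ l ∈ Finset.range (k + 1), v l m, summable_sum fun l _ => hv l, fun m x => ?_⟩
    refine (norm_iteratedFDeriv_mul_le (N := ∞) ((ha m).comp contDiff_fst) (hq2.1 m) x (by exact_mod_cast le_top)).trans ?_
    exact Finset.sum_le_sum fun l _ => hv2 l m x
  choose v hv hv2 using key
  refine ⟨contDiff_tsum (fun m => ((ha m).comp contDiff_fst).mul (hq2.1 m)) (fun k _ => hv k) (fun k i x _ => hv2 k i x), ?_⟩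
  intro x p
  refine Summable.of_norm_bounded (hv 0) fun m => ?_
  simpa using hv2 0 m (x, p)

lemma exp_tan (φ : ℝ) (h : Real.cos φ ≠ 0) :
    cexp (2 * φ * I) = (1 + I * (Real.tan φ : ℝ)) / (1 - I * (Real.tan φ : ℝ)) := by
  have h1 : cexp (2 * φ * I) = cexp (φ * I) * cexp (φ * I) := by rw [← Complex.exp_add]; congr 1; ring
  have h2 : cexp (φ * I) * cexp (-φ * I) = 1 := by rw [← Complex.exp_add]; simp
  have h3 : cexp (φ * I) = Real.cos φ + Real.sin φ * I := by rw [exp_mul_I]; simp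
  have h4 : cexp (-φ * I) = Real.cos φ - Real.sin φ * I := by rw [exp_mul_I]; simp [sub_eq_add_neg]
  have hc : (Real.cos φ : ℂ) ≠ 0 := by exact_mod_cast h
  have h5 : cexp (-φ * I) ≠ 0 := exp_ne_zero _
  rw [Real.tan_eq_sin_div_cos]
  have e1 : (1 + I * (Real.sin φ / Real.cos φ : ℝ) : ℂ) = cexp (φ * I) / Real.cos φ := by
    rw [h3]; push_cast at hc ⊢; field_simp
  have e2 : (1 - I * (Real.sin φ / Real.cos φ : ℝ) : ℂ) = cexp (-φ * I) / Real.cos φ := by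
    rw [h4]; push_cast at hc ⊢; field_simp
  rw [e1, e2, h1, div_div_div_cancel_right₀ hc, eq_div_iff h5, mul_assoc, h2, mul_one]

lemma fourier_rep (f : ℝ × ℝ → ℝ) (hf : ContDiff ℝ ∞ f) (hc : HasCompactSupport f) :
    ∃ a : ℕ → ℝ → ℂ, (∀ m, ContDiff ℝ ∞ (a m)) ∧
    (∀ k N : ℕ, ∃ C, 0 ≤ C ∧ ∀ (m : ℕ) x, ‖iteratedFDeriv ℝ k (a m) x‖ * ((m : ℝ) + 1) ^ N ≤ C) ∧
    ∀ x y : ℝ, |y| ≤ 1 / 2 → HasSum (fun m : ℕ => (a m x * ((1 + I * y) / (1 - I * y)) ^ m).re) (f (x, y)) := by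
  let b : ContDiffBump (0 : ℝ) := ⟨1 / 5, 1 / 3, by norm_num, by norm_num⟩
  let g : ℝ × ℝ → ℝ := fun p => b p.2 * f (p.1, Real.tan (Real.pi * p.2))
  have hb0 : ∀ t : ℝ, 1 / 3 ≤ |t| → b t = 0 := fun t ht => b.zero_of_le_dist (by simpa [b] using ht)
  have hcos : ∀ t : ℝ, |t| < 1 / 2 → Real.cos (Real.pi * t) ≠ 0 := by
    intro t ht
    have hp := Real.pi_pos
    have := abs_lt.1 ht
    apply ne_of_gt
    apply Real.cos_pos_of_mem_Ioo
    constructor <;> nlinarith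
  have hg : ContDiff ℝ ∞ g := by
    rw [contDiff_iff_contDiffAt]
    intro p
    by_cases hp : |p.2| < 1 / 2
    · refine (b.contDiff.comp contDiff_snd).contDiffAt.mul (hf.contDiffAt.comp p (contDiffAt_fst.prodMk ?_))
      have h := (Real.contDiffAt_tan (n := ∞)).2 (hcos _ hp)
      exact ContDiffAt.comp (g := Real.tan) (f := fun q : ℝ × ℝ => Real.pi * q.2) p h
        (contDiffAt_const.mul contDiffAt_snd)
    · have : g =ᶠ[nhds p] fun _ => 0 := by
        have h1 : ∀ᶠ q : ℝ × ℝ in nhds p, 1 / 3 < |q.2| := by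
          apply (continuous_snd.abs).continuousAt.eventually_const_lt
          simp only
          push Not at hp
          linarith
        filter_upwards [h1] with q hq
        simp only [g]
        rw [hb0 _ hq.le, zero_mul]
      exact contDiffAt_const.congr_of_eventuallyEq this
  have hgs : ∀ x t, 1 / 3 ≤ |t| → g (x, t) = 0 := fun x t ht => by simp [g, hb0 t ht]
  have hgc : HasCompactSupport g := by
    obtain ⟨r, hr⟩ := hc.isCompact.isBounded.subset_closedBall 0
    refine HasCompactSupport.of_support_subset_isCompact
      ((isCompact_closedBall (0 : ℝ) r).prod (isCompact_closedBall (0 : ℝ) (1 / 3))) ?_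
    rintro ⟨x, t⟩ hxt
    constructor
    · by_contra h
      apply hxt
      have : (x, Real.tan (Real.pi * t)) ∉ tsupport f := fun h' => h (by
        have := hr h'
        rw [mem_closedBall_zero_iff] at this ⊢
        exact (norm_fst_le (x, Real.tan (Real.pi * t))).trans this)
      simp [g, image_eq_zero_of_notMem_tsupport this]
    · by_contra h
      apply hxt
      apply hgs
      simp at h
      linarith
  have h1s : ContDiff ℝ ∞ (fun p => (g p : ℂ)) := ofRealCLM.contDiff.comp hg
  have h1c : HasCompactSupport (fun p => (g p : ℂ)) := hgc.comp_left ofReal_zero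
  have h2s : ContDiff ℝ ∞ (fun p => 2 * (g p : ℂ)) := contDiff_const.mul h1s
  have h2c : HasCompactSupport (fun p => 2 * (g p : ℂ)) := h1c.mul_left
  refine ⟨fun m => fc m (if m = 0 then (fun p => (g p : ℂ)) else fun p => 2 * (g p : ℂ)), ?_, ?_, ?_⟩
  · intro m
    beta_reduce
    split_ifs
    · exact fc_smooth h1s h1c _
    · exact fc_smooth h2s h2c _
  · intro k N
    obtain ⟨C1, h10, h11⟩ := fc_decay_deriv h1s h1c k N
    obtain ⟨C2, h20, h21⟩ := fc_decay_deriv h2s h2c k N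
    refine ⟨C1 + C2, by positivity, fun m x => ?_⟩
    beta_reduce
    split_ifs
    · linarith [h11 m x]
    · linarith [h21 m x]
  · intro x y hy
    set t := Real.arctan y / Real.pi with ht
    have hpi := Real.pi_gt_three
    have hpt : Real.pi * t = Real.arctan y := by rw [ht]; field_simp
    have hat : |Real.arctan y| ≤ 1 / 2 := by
      have : |Real.arctan y| ≤ |y| := by
        have h1 := Real.arctan_lt_pi_div_two y
        have h2 := Real.neg_pi_div_two_lt_arctan y
        rcases le_total 0 y with h0 | h0
        · have h3 := Real.arctan_nonneg.2 h0
          have := Real.le_tan h3 h1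
          rw [Real.tan_arctan] at this
          rwa [abs_of_nonneg h3, abs_of_nonneg h0]
        · have h3 := Real.arctan_le_zero.2 h0
          have := Real.le_tan (x := - Real.arctan y) (by linarith) (by linarith)
          rw [Real.tan_neg, Real.tan_arctan] at this
          rwa [abs_of_nonpos h3, abs_of_nonpos h0]
      linarith
    have htb : |t| ≤ 1 / 6 := by
      rw [ht, abs_div, abs_of_pos Real.pi_pos, div_le_iff₀ Real.pi_pos]
      linarith
    have hb1 : b t = 1 := b.one_of_mem_closedBall (by simp [b]; linarith)
    have := fc_hasSum hg hgc hgs x t (by linarith)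
    have e : g (x, t) = f (x, y) := by simp only [g, hb1, hpt, Real.tan_arctan, one_mul]
    rw [e] at this
    have e2 : cexp (2 * Real.pi * t * I) = (1 + I * y) / (1 - I * y) := by
      have := exp_tan (Real.pi * t) (hcos t (by linarith))
      rw [hpt, Real.tan_arctan, ← hpt] at this
      rw [← this]
      push_cast
      congr 1
      ring
    rw [e2] at this
    exact this

/-- Malgrange division theorem (two real variables, generic polynomial) -/
lemma malgrange_division {n : ℕ} (hn : 0 < n) (f : ℝ × ℝ → ℝ) (hf : ContDiff ℝ ∞ f) (hc : HasCompactSupport f) :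
    ∃ (Q : ℝ × ℝ × (Fin n → ℝ) → ℝ) (R : Fin n → ℝ × (Fin n → ℝ) → ℝ), ContDiff ℝ ∞ Q ∧ (∀ j, ContDiff ℝ ∞ (R j)) ∧
    ∃ δ, 0 < δ ∧ ∀ (x y : ℝ) (lam : Fin n → ℝ), |y| ≤ δ → (∀ j, |lam j| ≤ δ) →
      f (x, y) = Q (x, y, lam) * (y ^ n + ∑ j, lam j * y ^ (j : ℕ)) + ∑ j, R j (x, lam) * y ^ (j : ℕ) := by
  obtain ⟨a, ha1, ha2, ha3⟩ := fourier_rep f hf hc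
  obtain ⟨δ, hδ, q, r, hq, hr, hqr⟩ := division_pow hn
  have hQ := rapid_tsum a ha1 ha2 q hq
  have hR := fun j => rapid_tsum a ha1 ha2 (r j) (hr j)
  refine ⟨fun p => (∑' m, a m p.1 * q m p.2).re, fun j p => (∑' m, a m p.1 * r j m p.2).re,
    reCLM.contDiff.comp hQ.1, fun j => reCLM.contDiff.comp (hR j).1, min δ (1 / 2), by positivity, ?_⟩
  intro x y lam hy hlam
  have hy' : |y| ≤ 1 / 2 := hy.trans (min_le_right _ _)
  have h1 := ha3 x y hy'
  have h2 : HasSum (fun m => (y ^ n + ∑ j, lam j * y ^ (j : ℕ)) * (a m x * q m (y, lam)).re +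
      ∑ j : Fin n, y ^ (j : ℕ) * (a m x * r j m lam).re)
      ((y ^ n + ∑ j, lam j * y ^ (j : ℕ)) * (∑' m, a m x * q m (y, lam)).re +
      ∑ j : Fin n, y ^ (j : ℕ) * (∑' m, a m x * r j m lam).re) := by
    refine ((hasSum_re (hQ.2 x (y, lam)).hasSum).mul_left _).add (hasSum_sum fun j _ => ?_)
    exact (hasSum_re ((hR j).2 x lam).hasSum).mul_left _
  have h3 : (fun m : ℕ => (a m x * ((1 + I * y) / (1 - I * y)) ^ m).re) =
      (fun m => (y ^ n + ∑ j, lam j * y ^ (j : ℕ)) * (a m x * q m (y, lam)).re +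
      ∑ j : Fin n, y ^ (j : ℕ) * (a m x * r j m lam).re) := by
    funext m
    rw [hqr m y lam (by linarith) (fun j => (hlam j).trans (min_le_left _ _)), mul_add, mul_smul_comm, Finset.mul_sum,
      add_re, smul_re, re_sum, smul_eq_mul]
    congr 1
    refine Finset.sum_congr rfl fun j _ => ?_
    rw [mul_smul_comm, smul_re, smul_eq_mul]
  rw [h3] at h1
  rw [h1.unique h2]
  simp only
  congr 1
  · ring
  · exact Finset.sum_congr rfl fun j _ => mul_comm _ _

end NP

namespace NP
open scoped ContDiff Topology

lemma param_hasFDerivAt {E F : Type} [NormedAddCommGroup E] [NormedSpace ℝ E] [FiniteDimensional ℝ E]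
    [NormedAddCommGroup F] [NormedSpace ℝ F] [CompleteSpace F] {f : E × ℝ → F} (hf : ContDiff ℝ ∞ f) (p : E) :
    HasFDerivAt (fun p => ∫ θ in (0:ℝ)..1, f (p, θ))
      (∫ θ in (0:ℝ)..1, (fderiv ℝ f (p, θ)).comp (ContinuousLinearMap.inl ℝ E ℝ)) p := by
  have hcont : Continuous (fun q : E × ℝ => (fderiv ℝ f q).comp (ContinuousLinearMap.inl ℝ E ℝ)) := by
    have := hf.continuous_fderiv (by simp)
    fun_prop
  have hK : IsCompact ((Metric.closedBall p 1) ×ˢ (Icc (0:ℝ) 1)) :=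
    (isCompact_closedBall p 1).prod isCompact_Icc
  obtain ⟨C, hC⟩ := hK.exists_bound_of_continuousOn hcont.continuousOn
  refine (intervalIntegral.hasFDerivAt_integral_of_dominated_of_fderiv_le
    (F' := fun p θ => (fderiv ℝ f (p, θ)).comp (ContinuousLinearMap.inl ℝ E ℝ))
    (bound := fun _ => C) (Metric.ball_mem_nhds p one_pos) ?_ ?_ ?_ ?_ ?_ ?_)
  · exact Eventually.of_forall fun q => (hf.continuous.comp (by fun_prop)).aestronglyMeasurable
  · exact (hf.continuous.comp (by fun_prop)).intervalIntegrable _ _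
  · exact (hcont.comp (g := fun q : E × ℝ => (fderiv ℝ f q).comp (ContinuousLinearMap.inl ℝ E ℝ)) (f := fun θ : ℝ => (p, θ)) (by fun_prop)).aestronglyMeasurable
  · refine Eventually.of_forall fun t ht x hx => hC (x, t) ⟨Metric.ball_subset_closedBall hx, ?_⟩
    rw [uIoc_of_le zero_le_one] at ht
    exact Ioc_subset_Icc_self ht
  · exact intervalIntegrable_const
  · refine Eventually.of_forall fun t ht x hx => ?_
    have h1 : HasFDerivAt f (fderiv ℝ f (x, t)) (x, t) := (hf.differentiable (by simp) _).hasFDerivAt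
    exact h1.comp x (hasFDerivAt_prodMk_left x t)

lemma param_contDiff {E : Type} [NormedAddCommGroup E] [NormedSpace ℝ E] [FiniteDimensional ℝ E] (n : ℕ) :
    ∀ {F : Type} [NormedAddCommGroup F] [NormedSpace ℝ F] [CompleteSpace F] {f : E × ℝ → F}
    (_ : ContDiff ℝ ∞ f), ContDiff ℝ n (fun p => ∫ θ in (0:ℝ)..1, f (p, θ)) := by
  induction n with
  | zero =>
    intro F _ _ _ f hf
    rw [Nat.cast_zero, contDiff_zero]
    exact continuous_iff_continuousAt.2 fun x => (param_hasFDerivAt hf x).continuousAt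
  | succ n ih =>
    intro F _ _ _ f hf
    rw [Nat.cast_succ, contDiff_succ_iff_fderiv]
    refine ⟨fun x => (param_hasFDerivAt hf x).differentiableAt, by simp, ?_⟩
    have : fderiv ℝ (fun p => ∫ θ in (0:ℝ)..1, f (p, θ)) = fun p =>
      ∫ θ in (0:ℝ)..1, (fderiv ℝ f (p, θ)).comp (ContinuousLinearMap.inl ℝ E ℝ) :=
      funext fun x => (param_hasFDerivAt hf x).fderiv
    rw [this]
    exact ih (f := fun q => (fderiv ℝ f q).comp (ContinuousLinearMap.inl ℝ E ℝ))
      ((hf.fderiv_right (m := ∞) (by simp)).clm_comp contDiff_const)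

/-- Hadamard's lemma with parameters -/
lemma hadamard {E F : Type} [NormedAddCommGroup E] [NormedSpace ℝ E] [FiniteDimensional ℝ E]
    [NormedAddCommGroup F] [NormedSpace ℝ F] [CompleteSpace F] {f : E × ℝ → F} (hf : ContDiff ℝ ∞ f) :
    ∃ g : E × ℝ → F, ContDiff ℝ ∞ g ∧ ∀ p t, f (p, t) = f (p, 0) + t • g (p, t) := by
  refine ⟨fun q => ∫ θ in (0:ℝ)..1, fderiv ℝ f (q.1, θ * q.2) (0, 1), ?_, ?_⟩
  · rw [contDiff_infty]
    intro n
    have h : ContDiff ℝ ∞ (fun r : (E × ℝ) × ℝ => fderiv ℝ f (r.1.1, r.2 * r.1.2) (0, 1)) :=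
      (((hf.fderiv_right (m := ∞) (by simp)).comp
        ((contDiff_fst.comp contDiff_fst).prodMk (contDiff_snd.mul (contDiff_snd.comp contDiff_fst))))).clm_apply
        contDiff_const
    exact param_contDiff n h
  · intro p t
    have h1 : ∀ θ : ℝ, HasDerivAt (fun θ : ℝ => f (p, θ * t)) (t • fderiv ℝ f (p, θ * t) (0, 1)) θ := by
      intro θ
      have h1 : HasFDerivAt f (fderiv ℝ f (p, θ * t)) (p, θ * t) :=
        (hf.differentiable (by simp) _).hasFDerivAt
      have h2 : HasDerivAt (fun θ : ℝ => (p, θ * t)) ((0 : E), t) θ := by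
        have h3 : HasDerivAt (fun θ : ℝ => θ * t) t θ := by simpa using (hasDerivAt_id θ).mul_const t
        exact (hasDerivAt_const θ p).prodMk h3
      have := h1.comp_hasDerivAt θ h2
      have e : ((0 : E), t) = t • ((0 : E), (1:ℝ)) := by simp
      rw [e, map_smul] at this
      exact this
    have hc : Continuous (fun θ : ℝ => t • fderiv ℝ f (p, θ * t) (0, 1)) := by
      have h := hf.continuous_fderiv (by simp)
      have h' : Continuous (fun θ : ℝ => fderiv ℝ f (p, θ * t)) := h.comp (by fun_prop)
      fun_prop
    have := intervalIntegral.integral_eq_sub_of_hasDerivAt (a := 0) (b := 1) (fun θ _ => h1 θ)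
      (hc.intervalIntegrable _ _)
    rw [intervalIntegral.integral_smul] at this
    simp only [one_mul, zero_mul] at this
    rw [this]
    abel

/-- iterated version -/
lemma hadamard_iter {E : Type} [NormedAddCommGroup E] [NormedSpace ℝ E] [FiniteDimensional ℝ E]
    {F : Type} [NormedAddCommGroup F] [NormedSpace ℝ F] [CompleteSpace F]
    (N : ℕ) {f : E × ℝ → F} (hf : ContDiff ℝ ∞ f) :
    ∃ (h : ℕ → E → F) (g : E × ℝ → F), (∀ j, ContDiff ℝ ∞ (h j)) ∧ ContDiff ℝ ∞ g ∧
      ∀ p t, f (p, t) = ∑ j ∈ Finset.range N, t ^ j • h j p + t ^ N • g (p, t) := by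
  induction N with
  | zero => exact ⟨fun _ _ => 0, f, fun _ => contDiff_const, hf, by simp⟩
  | succ N ih =>
    obtain ⟨h, g, h1, h2, h3⟩ := ih
    obtain ⟨g', h4, h5⟩ := hadamard h2
    refine ⟨fun j => if j = N then fun p => g (p, 0) else h j, g', ?_, h4, ?_⟩
    · intro j
      beta_reduce
      split_ifs
      · exact h2.comp (contDiff_id.prodMk contDiff_const)
      · exact h1 j
    · intro p t
      rw [h3, h5, Finset.sum_range_succ, smul_add, smul_smul, pow_succ, ← add_assoc]
      congr 2
      · apply Finset.sum_congr rfl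
        intro j hj
        beta_reduce
        rw [if_neg (Finset.mem_range.1 hj).ne]
      · simp

/-- smooth inverse function theorem with smoothness in a neighbourhood -/
lemma smooth_ift {E F : Type} [NormedAddCommGroup E] [NormedSpace ℝ E] [CompleteSpace E]
    [NormedAddCommGroup F] [NormedSpace ℝ F] {G : E → F} (hG : ContDiff ℝ ∞ G) (a : E)
    (L : E ≃L[ℝ] F) (hL : HasFDerivAt G (L : E →L[ℝ] F) a) :
    ∃ g : F → E, g (G a) = a ∧ ContinuousAt g (G a) ∧ ∀ᶠ y in 𝓝 (G a), G (g y) = y ∧ ContDiffAt ℝ ∞ g y := by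
  have hs : HasStrictFDerivAt G (L : E →L[ℝ] F) a := (hG.contDiffAt.hasStrictFDerivAt' hL (by simp))
  let e := hs.toOpenPartialHomeomorph G
  have hcoe : (e : E → F) = G := hs.toOpenPartialHomeomorph_coe
  have hmem : a ∈ e.source := hs.mem_toOpenPartialHomeomorph_source
  have hmem' : G a ∈ e.target := hs.image_mem_toOpenPartialHomeomorph_target
  have hga : e.symm (G a) = a := by
    have := e.left_inv hmem
    rwa [hcoe] at this
  have hcont : ContinuousAt e.symm (G a) := e.continuousAt_symm hmem'
  refine ⟨e.symm, hga, hcont, ?_⟩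
  have h1 : ∀ᶠ x in 𝓝 a, fderiv ℝ G x ∈ Set.range ((↑) : (E ≃L[ℝ] F) → (E →L[ℝ] F)) := by
    have : ContinuousAt (fderiv ℝ G) a := (hG.continuous_fderiv (by simp)).continuousAt
    apply this
    rw [hL.fderiv]
    exact ContinuousLinearEquiv.nhds L
  have h2 : ∀ᶠ y in 𝓝 (G a), fderiv ℝ G (e.symm y) ∈ Set.range ((↑) : (E ≃L[ℝ] F) → (E →L[ℝ] F)) := by
    have := hcont.tendsto
    rw [hga] at this
    exact this.eventually h1
  filter_upwards [h2, e.open_target.mem_nhds hmem'] with y hy hyt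
  refine ⟨by rw [← hcoe]; exact e.right_inv hyt, ?_⟩
  obtain ⟨L', hL'⟩ := hy
  apply e.contDiffAt_symm (f₀' := L') hyt
  · rw [hcoe, hL']
    exact (hG.differentiable (by simp) _).hasFDerivAt
  · rw [hcoe]
    exact hG.contDiffAt

/-- make a function smooth near `0` globally smooth -/
lemma globalize {F : Type} [NormedAddCommGroup F] [NormedSpace ℝ F] {f : ℝ → F}
    (h : ∀ᶠ t in 𝓝 (0:ℝ), ContDiffAt ℝ ∞ f t) : ∃ g : ℝ → F, ContDiff ℝ ∞ g ∧ g =ᶠ[𝓝 0] f := by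
  obtain ⟨χ, h1, -, h2, h3⟩ := exists_clamp
  obtain ⟨r, hr, hb⟩ := Metric.eventually_nhds_iff.1 h
  refine ⟨fun t => f (r / 3 * χ (3 / r * t)), ?_, ?_⟩
  · rw [contDiff_iff_contDiffAt]
    intro t
    refine ContDiffAt.comp (g := f) (f := fun t => r / 3 * χ (3 / r * t)) t (hb ?_) ?_
    · rw [Real.dist_eq, sub_zero, abs_mul, abs_of_pos (by positivity)]
      nlinarith [h3 (3 / r * t)]
    · exact (contDiff_const.mul (h1.comp (contDiff_const.mul contDiff_id))).contDiffAt
  · have : ∀ᶠ t in 𝓝 (0:ℝ), |3 / r * t| < 1 := by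
      have hc : ContinuousAt (fun t : ℝ => |3 / r * t|) 0 := by fun_prop
      exact hc.eventually_lt_const (by simp)
    filter_upwards [this] with t ht
    rw [h2 _ ht.le]
    congr 1
    field_simp

end NP

namespace NP
open scoped ContDiff Topology

lemma det_smooth {m : ℕ} {M : ℝ → Matrix (Fin m) (Fin m) ℝ} (h : ∀ i j, ContDiff ℝ ∞ fun s => M s i j) :
    ContDiff ℝ ∞ fun s => (M s).det := by
  simp only [Matrix.det_apply]
  apply ContDiff.sum
  intro σ _
  apply ContDiff.const_smul
  apply contDiff_prod
  intro i _
  exact h _ _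

lemma adj_smooth {m : ℕ} {M : ℝ → Matrix (Fin m) (Fin m) ℝ} (h : ∀ i j, ContDiff ℝ ∞ fun s => M s i j)
    (i j : Fin m) : ContDiff ℝ ∞ fun s => (M s).adjugate i j := by
  simp only [Matrix.adjugate_apply]
  apply det_smooth
  intro a b
  simp only [Matrix.updateRow_apply]
  split_ifs
  · exact contDiff_const
  · exact h _ _

lemma tougeron {m : ℕ} {R : ℝ × (Fin m → ℝ) → (Fin m → ℝ)} (hR : ContDiff ℝ ∞ R)
    {J : ℝ → Matrix (Fin m) (Fin m) ℝ} (hJ : ∀ i j, ContDiff ℝ ∞ fun s => J s i j)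
    (hJR : ∀ s ν, fderiv ℝ R (s, 0) (0, ν) = (J s).mulVec ν)
    {e : ℕ} {u : ℝ → ℝ} (hu : ContDiff ℝ ∞ u) (hu0 : u 0 ≠ 0) (hdet : ∀ᶠ s in 𝓝 0, (J s).det = s ^ e * u s)
    {ρ : ℝ → Fin m → ℝ} (hρ : ContDiff ℝ ∞ ρ) (hρ0 : ρ 0 = 0) (hRρ : ∀ᶠ s in 𝓝 0, R (s, 0) = s ^ (2 * e) • ρ s) :
    ∃ μ : ℝ → Fin m → ℝ, ContDiff ℝ ∞ μ ∧ μ 0 = 0 ∧ (∀ᶠ s in 𝓝 0, R (s, s ^ e • μ s) = 0) ∧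
      ∀ N : ℕ, (∀ j, (fun s => ρ s j) =O[𝓝 0] fun s => s ^ N) → ∀ i, (fun s => μ s i) =O[𝓝 0] fun s => s ^ N := by
  obtain ⟨h, Ψ, hh, hΨ, hexp⟩ := hadamard_iter 2 (E := ℝ × (Fin m → ℝ)) (f := fun q => R (q.1.1, q.2 • q.1.2))
    (hR.comp ((contDiff_fst.comp contDiff_fst).prodMk (contDiff_snd.smul (contDiff_snd.comp contDiff_fst))))
  simp only [Finset.sum_range_succ, Finset.sum_range_zero, pow_zero, one_smul, zero_add, pow_one] at hexp
  have h0 : ∀ p, h 0 p = R (p.1, 0) := fun p => by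
    have := hexp p 0
    simp at this
    exact this.symm
  have h1 : ∀ p, h 1 p = (J p.1).mulVec p.2 := by
    intro p
    have e1 : HasDerivAt (fun t : ℝ => R (p.1, t • p.2)) ((J p.1).mulVec p.2) 0 := by
      have hf : HasFDerivAt R (fderiv ℝ R (p.1, 0)) (p.1, (0:ℝ) • p.2) := by
        rw [zero_smul]
        exact (hR.differentiable (by simp) _).hasFDerivAt
      have h2 : HasDerivAt (fun t : ℝ => (p.1, t • p.2)) ((0 : ℝ), p.2) 0 := by
        refine (hasDerivAt_const (0:ℝ) p.1).prodMk ?_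
        simpa using (hasDerivAt_id (0:ℝ)).smul_const p.2
      have := hf.comp_hasDerivAt (0:ℝ) h2
      rw [hJR] at this
      exact this
    have e2 : HasDerivAt (fun t : ℝ => R (p.1, t • p.2)) (h 1 p) 0 := by
      have e3 : (fun t : ℝ => R (p.1, t • p.2)) = fun t => h 0 p + t • h 1 p + t ^ 2 • Ψ (p, t) := by
        funext t
        exact hexp p t
      rw [e3]
      have hd : DifferentiableAt ℝ (fun t : ℝ => Ψ (p, t)) 0 :=
        ((hΨ.comp (contDiff_const.prodMk contDiff_id)).differentiable (by simp)) 0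
      have h3 := ((hasDerivAt_const (0:ℝ) (h 0 p)).add ((hasDerivAt_id (0:ℝ)).smul_const (h 1 p))).add
        ((hasDerivAt_pow 2 (0:ℝ)).smul hd.hasDerivAt)
      refine h3.congr_deriv ?_
      simp
    exact e2.unique e1
  have hhom : ∀ s ν (c t : ℝ), Ψ ((s, c • ν), t) = c ^ 2 • Ψ ((s, ν), c * t) := by
    intro s ν c t
    have key : ∀ t : ℝ, t ≠ 0 → Ψ ((s, c • ν), t) = c ^ 2 • Ψ ((s, ν), c * t) := by
      intro t ht
      have a1 := hexp (s, c • ν) t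
      have a2 := hexp (s, ν) (c * t)
      simp only [h0, h1] at a1 a2
      have a3 : t • c • ν = (c * t) • ν := by rw [smul_smul, mul_comm]
      rw [a3, a2, Matrix.mulVec_smul, smul_smul, mul_comm t c] at a1
      have a4 := add_left_cancel a1
      rw [mul_comm c t, mul_pow, ← smul_smul] at a4
      rw [mul_comm c t]
      exact (smul_right_injective _ (pow_ne_zero 2 ht) a4).symm
    have c1 : Continuous fun t : ℝ => Ψ ((s, c • ν), t) := hΨ.continuous.comp (by fun_prop)
    have c2 : Continuous fun t : ℝ => c ^ 2 • Ψ ((s, ν), c * t) := by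
      have := hΨ.continuous
      fun_prop
    have := Continuous.ext_on (dense_compl_singleton (0:ℝ)) c1 c2 (fun t ht => key t ht)
    exact congrFun this t
  have hΨ0 : ∀ s t, Ψ ((s, 0), t) = 0 := by
    intro s t
    have := hhom s 0 0 t
    simpa using this
  let G : ℝ × (Fin m → ℝ) → (Fin m → ℝ) := fun p => u p.1 • p.2 + (J p.1).adjugate.mulVec (ρ p.1) +
    (J p.1).adjugate.mulVec (Ψ (p, p.1 ^ e))
  have hmv : ∀ {w : ℝ × (Fin m → ℝ) → (Fin m → ℝ)}, ContDiff ℝ ∞ w →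
      ContDiff ℝ ∞ fun p : ℝ × (Fin m → ℝ) => (J p.1).adjugate.mulVec (w p) := by
    intro w hw
    rw [contDiff_pi]
    intro i
    simp only [Matrix.mulVec, dotProduct]
    apply ContDiff.sum
    intro j _
    exact ((adj_smooth hJ i j).comp contDiff_fst).mul ((contDiff_pi.1 hw) j)
  have hG : ContDiff ℝ ∞ G := by
    refine (((hu.comp contDiff_fst).smul contDiff_snd).add (hmv (hρ.comp contDiff_fst))).add (hmv ?_)
    exact hΨ.comp (contDiff_id.prodMk (contDiff_fst.pow e))
  have hG0 : G 0 = 0 := by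
    have := hΨ0 0 ((0:ℝ) ^ e)
    simp [G, hρ0, ← Prod.mk_zero_zero, this]
  have hGd : ∀ ν, fderiv ℝ G 0 (0, ν) = u 0 • ν := by
    intro ν
    have e1 : HasDerivAt (fun c : ℝ => G (0, c • ν)) (fderiv ℝ G 0 (0, ν)) 0 := by
      have hf : HasFDerivAt G (fderiv ℝ G 0) (0, (0:ℝ) • ν) := by
        rw [zero_smul]
        exact (hG.differentiable (by simp) _).hasFDerivAt
      have h2 : HasDerivAt (fun t : ℝ => ((0:ℝ), t • ν)) ((0 : ℝ), ν) 0 := by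
        refine (hasDerivAt_const (0:ℝ) (0:ℝ)).prodMk ?_
        simpa using (hasDerivAt_id (0:ℝ)).smul_const ν
      exact hf.comp_hasDerivAt (0:ℝ) h2
    have e2 : HasDerivAt (fun c : ℝ => G (0, c • ν)) (u 0 • ν) 0 := by
      have e3 : (fun c : ℝ => G (0, c • ν)) = fun c => c • (u 0 • ν) + c ^ 2 •
          (J 0).adjugate.mulVec (Ψ ((0, ν), c * 0 ^ e)) := by
        funext c
        simp only [G, hρ0, Matrix.mulVec_zero, add_zero, hhom 0 ν c, Matrix.mulVec_smul]
        rw [smul_comm]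
      rw [e3]
      have hd : DifferentiableAt ℝ (fun c : ℝ => (J 0).adjugate.mulVec (Ψ ((0, ν), c * 0 ^ e))) 0 := by
        have : ContDiff ℝ ∞ (fun c : ℝ => (J 0).adjugate.mulVec (Ψ ((0, ν), c * 0 ^ e))) := by
          rw [contDiff_pi]
          intro i
          simp only [Matrix.mulVec, dotProduct]
          apply ContDiff.sum
          intro j _
          apply contDiff_const.mul
          exact (contDiff_pi.1 hΨ j).comp (contDiff_const.prodMk (contDiff_id.mul contDiff_const))
        exact this.differentiable (by simp) 0
      have h3 := ((hasDerivAt_id (0:ℝ)).smul_const (u 0 • ν)).add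
        ((hasDerivAt_pow 2 (0:ℝ)).smul hd.hasDerivAt)
      refine h3.congr_deriv ?_
      simp
    exact e1.unique e2
  let T : (ℝ × (Fin m → ℝ)) →L[ℝ] (ℝ × (Fin m → ℝ)) := (ContinuousLinearMap.fst ℝ ℝ (Fin m → ℝ)).prod (fderiv ℝ G 0)
  have hTinj : Function.Injective (T : (ℝ × (Fin m → ℝ)) →ₗ[ℝ] (ℝ × (Fin m → ℝ))) := by
    rw [← LinearMap.ker_eq_bot, LinearMap.ker_eq_bot']
    rintro ⟨σ, ν⟩ h
    have h1 : σ = 0 := congrArg Prod.fst h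
    subst h1
    have h2 : fderiv ℝ G 0 (0, ν) = 0 := congrArg Prod.snd h
    rw [hGd] at h2
    have := (smul_eq_zero.1 h2).resolve_left hu0
    rw [this]
    rfl
  let L : (ℝ × (Fin m → ℝ)) ≃L[ℝ] (ℝ × (Fin m → ℝ)) :=
    (LinearEquiv.ofInjectiveEndo (T : (ℝ × (Fin m → ℝ)) →ₗ[ℝ] (ℝ × (Fin m → ℝ))) hTinj).toContinuousLinearEquiv
  have hLT : (L : (ℝ × (Fin m → ℝ)) →L[ℝ] (ℝ × (Fin m → ℝ))) = T := by
    ext1 <;> rfl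
  have hG2 : ContDiff ℝ ∞ (fun p : ℝ × (Fin m → ℝ) => (p.1, G p)) := contDiff_fst.prodMk hG
  obtain ⟨g, hg0, hgc, hg⟩ := smooth_ift hG2 0 L (by
    rw [hLT]
    exact hasFDerivAt_fst.prodMk (hG.differentiable (by simp) _).hasFDerivAt)
  simp only [hG0, Prod.fst_zero, Prod.mk_zero_zero] at hg0 hgc hg
  have hi : Tendsto (fun s : ℝ => (s, (0 : Fin m → ℝ))) (𝓝 0) (𝓝 0) := by
    have : Continuous (fun s : ℝ => (s, (0 : Fin m → ℝ))) := by fun_prop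
    exact this.tendsto' _ _ rfl
  have hgs := hi.eventually hg
  obtain ⟨μ, hμ, hμe⟩ := globalize (f := fun s => (g (s, 0)).2) (by
    filter_upwards [hgs] with s hs
    have := hs.2.comp s (f := fun s : ℝ => (s, (0 : Fin m → ℝ))) (contDiffAt_id.prodMk contDiffAt_const)
    exact contDiffAt_snd.comp s this)
  have hμ0 : μ 0 = 0 := by
    have := hμe.eq_of_nhds
    rw [this]
    simp only [Prod.mk_zero_zero, hg0, Prod.snd_zero]
  have hGμ : ∀ᶠ s in 𝓝 0, G (s, μ s) = 0 := by
    filter_upwards [hgs, hμe] with s hs hs2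
    have a1 : (g (s, 0)).1 = s := congrArg Prod.fst hs.1
    have a2 : G (g (s, 0)) = 0 := congrArg Prod.snd hs.1
    have a3 : (s, μ s) = g (s, 0) := Prod.ext a1.symm hs2
    rw [a3, a2]
  refine ⟨μ, hμ, hμ0, ?_, ?_⟩
  · have hu' : ∀ᶠ s in 𝓝 0, u s ≠ 0 := hu.continuous.continuousAt.eventually_ne hu0
    filter_upwards [hGμ, hu', hdet, hRρ] with s hs hus hdet hRρ
    by_cases hcase : s ^ e = 0
    · rw [hcase, zero_smul, hRρ, mul_comm, pow_mul, hcase]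
      simp
    · have hd : (J s).det ≠ 0 := by rw [hdet]; exact mul_ne_zero hcase hus
      have a1 := hexp (s, μ s) (s ^ e)
      simp only [h0, h1, hRρ] at a1
      have a2 : (J s).adjugate.mulVec (R (s, s ^ e • μ s)) = s ^ (2 * e) • G (s, μ s) := by
        rw [a1]
        simp only [G, Matrix.mulVec_add, Matrix.mulVec_smul, Matrix.mulVec_mulVec, Matrix.adjugate_mul,
          hdet, Matrix.smul_mulVec, Matrix.one_mulVec, smul_add, smul_smul]
        have : s ^ e * (s ^ e * u s) = s ^ (2 * e) * u s := by ring
        rw [this, ← pow_mul, mul_comm e 2]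
        abel
      rw [hs, smul_zero] at a2
      have a3 : (J s).mulVec ((J s).adjugate.mulVec (R (s, s ^ e • μ s))) = (J s).det • R (s, s ^ e • μ s) := by
        rw [Matrix.mulVec_mulVec, Matrix.mul_adjugate, Matrix.smul_mulVec, Matrix.one_mulVec]
      rw [a2, Matrix.mulVec_zero] at a3
      exact (smul_eq_zero.1 a3.symm).resolve_left hd
  · intro N hN i
    have hst : HasStrictFDerivAt G (fderiv ℝ G 0) 0 := hG.contDiffAt.hasStrictFDerivAt (by simp)
    have hb := hst.isLittleO.def (c := |u 0| / 2) (by positivity)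
    have ht : Tendsto (fun s : ℝ => ((s, μ s), (s, (0 : Fin m → ℝ)))) (𝓝 0) (𝓝 (0, 0)) := by
      have : Continuous (fun s : ℝ => ((s, μ s), (s, (0 : Fin m → ℝ)))) := by
        have := hμ.continuous
        fun_prop
      exact this.tendsto' _ _ (by simp [hμ0])
    have hbd : (fun s => μ s) =O[𝓝 0] fun s => G (s, 0) := by
      apply IsBigO.of_bound (2 / |u 0|)
      filter_upwards [ht.eventually hb, hGμ] with s hs hs2
      have hu1 : 0 < |u 0| := abs_pos.2 hu0
      have e1 : (s, μ s) - (s, (0 : Fin m → ℝ)) = (0, μ s) := by simp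
      simp only [e1, hGd, hs2] at hs
      have e2 : ‖((0:ℝ), μ s)‖ = ‖μ s‖ := by
        rw [Prod.norm_def]; simp
      rw [e2] at hs
      have e3 : ‖u 0 • μ s‖ ≤ ‖0 - G (s, 0) - u 0 • μ s‖ + ‖G (s, 0)‖ := by
        have := norm_add_le (-(0 - G (s, 0) - u 0 • μ s)) (-G (s, 0))
        rw [norm_neg, norm_neg] at this
        have e4 : -(0 - G (s, 0) - u 0 • μ s) + -G (s, 0) = u 0 • μ s := by
          rw [zero_sub, neg_sub, sub_neg_eq_add]
          exact add_neg_cancel_right _ _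
        rwa [e4] at this
      rw [norm_smul, Real.norm_eq_abs] at e3
      rw [div_mul_eq_mul_div, le_div_iff₀ hu1]
      nlinarith
    have hi : (fun s => μ s i) =O[𝓝 0] fun s => G (s, 0) :=
      (IsBigO.of_bound 1 (Eventually.of_forall fun s => by simpa using norm_le_pi_norm (μ s) i)).trans hbd
    refine hi.trans ?_
    rw [isBigO_pi]
    intro l
    have hGl : ∀ s, G (s, 0) l = ∑ j, (J s).adjugate l j * ρ s j := by
      intro s
      simp only [G, smul_zero, zero_add, hΨ0, Matrix.mulVec_zero, add_zero]
      rfl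
    simp only [hGl]
    apply IsBigO.fun_sum
    intro j _
    have := ((adj_smooth hJ l j).continuous.tendsto 0).isBigO_one ℝ
    simpa using this.mul (hN j)

end NP

namespace NP
open scoped ContDiff Topology

lemma coef_ext (N : ℕ) : ∀ (i : ℕ) (_ : i < N) (c : ℕ → ℝ) (k : ℝ → ℝ) (_ : ContinuousAt k 0)
    (_ : ∀ᶠ t in 𝓝 (0:ℝ), ∑ j ∈ Finset.range N, c j * t ^ j = t ^ i * k t),
    (∀ j < i, c j = 0) ∧ c i = k 0 := by
  induction N with
  | zero => intro i hi; omega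
  | succ N ih =>
    intro i hi c k hk h
    have h0 := h.self_of_nhds
    rw [Finset.sum_range_succ'] at h0
    simp only [pow_succ, mul_zero, Finset.sum_const_zero, pow_zero, mul_one, zero_add] at h0
    rcases i with _ | i
    · simpa using h0
    · simp only [pow_succ, mul_zero, zero_mul] at h0
      have h1 : ∀ᶠ t in 𝓝[≠] (0:ℝ), ∑ j ∈ Finset.range N, c (j + 1) * t ^ j = t ^ i * k t := by
        filter_upwards [h.filter_mono nhdsWithin_le_nhds, self_mem_nhdsWithin] with t ht ht0
        rw [Finset.sum_range_succ', h0] at ht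
        have ht0' : t ≠ 0 := ht0
        apply mul_left_cancel₀ ht0'
        rw [Finset.mul_sum]
        simp only [zero_mul, add_zero] at ht
        rw [pow_succ, mul_assoc, mul_left_comm] at ht
        rw [← ht]
        apply Finset.sum_congr rfl
        intro j _
        ring
      have h2 : ∀ᶠ t in 𝓝 (0:ℝ), ∑ j ∈ Finset.range N, c (j + 1) * t ^ j = t ^ i * k t := by
        have hz : ∑ j ∈ Finset.range N, c (j + 1) * (0:ℝ) ^ j = 0 ^ i * k 0 := by
          have t1 : Tendsto (fun t : ℝ => ∑ j ∈ Finset.range N, c (j + 1) * t ^ j) (𝓝[≠] 0)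
              (𝓝 (∑ j ∈ Finset.range N, c (j + 1) * (0:ℝ) ^ j)) := by
            have : Continuous (fun t : ℝ => ∑ j ∈ Finset.range N, c (j + 1) * t ^ j) := by fun_prop
            exact (this.tendsto 0).mono_left nhdsWithin_le_nhds
          have t2 : Tendsto (fun t : ℝ => t ^ i * k t) (𝓝[≠] 0) (𝓝 (0 ^ i * k 0)) := by
            have : ContinuousAt (fun t : ℝ => t ^ i * k t) 0 := (continuousAt_id.pow i).mul hk
            exact this.tendsto.mono_left nhdsWithin_le_nhds
          exact tendsto_nhds_unique (t1.congr' h1) t2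
        rw [eventually_nhdsWithin_iff] at h1
        filter_upwards [h1] with t ht
        by_cases h : t = 0
        · rw [h]; exact hz
        · exact ht h
      have := ih i (by omega) (fun j => c (j + 1)) k hk h2
      refine ⟨fun j hj => ?_, this.2⟩
      rcases j with _ | j
      · exact h0
      · exact this.1 j (by omega)

lemma coef_ext_fin {m : ℕ} (i : Fin m) (c : Fin m → ℝ) (k : ℝ → ℝ) (hk : ContinuousAt k 0)
    (h : ∀ᶠ t in 𝓝 (0:ℝ), ∑ j, c j * t ^ (j : ℕ) = t ^ (i : ℕ) * k t) :
    (∀ j < i, c j = 0) ∧ c i = k 0 := by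
  have := coef_ext m i i.2 (fun j => if hj : j < m then c ⟨j, hj⟩ else 0) k hk (by
    filter_upwards [h] with t ht
    rw [← ht, Finset.sum_range]
    simp)
  refine ⟨fun j hj => ?_, ?_⟩
  · simpa using this.1 j hj
  · simpa using this.2

lemma coef_ext_fin' {m : ℕ} (c : Fin m → ℝ) (k : ℝ → ℝ) (hk : ContinuousAt k 0)
    (h : ∀ᶠ t in 𝓝 (0:ℝ), ∑ j, c j * t ^ (j : ℕ) = t ^ m * k t) :
    (∀ j, c j = 0) ∧ k 0 = 0 := by
  have := coef_ext (m + 1) m (by omega) (fun j => if hj : j < m then c ⟨j, hj⟩ else 0) k hk (by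
    filter_upwards [h] with t ht
    rw [← ht, Finset.sum_range_succ, Finset.sum_range]
    simp)
  refine ⟨fun j => ?_, ?_⟩
  · simpa using this.1 j j.2
  · simpa using this.2.symm

/-- preparation lemma -/
lemma prep {m d : ℕ} {H : ℝ × ℝ → ℝ} (hH : ContDiff ℝ ∞ H) {h : ℕ → ℝ → ℝ} {q : ℝ × ℝ → ℝ}
    (hq : ContDiff ℝ ∞ q)
    (hexp : ∀ s t, H (s, t) = ∑ j ∈ Finset.range m, t ^ j • h j s + t ^ m • q (s, t))
    {u : ℝ → ℝ} (hu : ContDiff ℝ ∞ u) (hu0 : u 0 ≠ 0) (hqu : ∀ s, q (s, 0) = s ^ d * u s)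
    {ρ : ℕ → ℝ → ℝ} (hρ : ∀ j, ContDiff ℝ ∞ (ρ j)) (hρ0 : ∀ j < m, ρ j 0 = 0)
    (hhρ : ∀ j < m, ∀ s, h j s = s ^ (2 * (d * m)) * ρ j s) :
    ∃ (V : ℝ × ℝ → ℝ) (lam : Fin m → ℝ → ℝ), ContDiff ℝ ∞ V ∧ (∀ j, ContDiff ℝ ∞ (lam j)) ∧ (∀ j, lam j 0 = 0) ∧
      (∀ᶠ p in 𝓝 (0 : ℝ × ℝ), H p = V p * (p.2 ^ m + ∑ j, lam j p.1 * p.2 ^ (j : ℕ))) ∧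
      ∀ N : ℕ, (∀ j < m, ρ j =O[𝓝 0] fun s => s ^ N) → ∀ j, lam j =O[𝓝 0] fun s => s ^ N := by
  rcases Nat.eq_zero_or_pos m with hm | hm
  · subst hm
    exact ⟨H, fun j => j.elim0, hH, fun j => j.elim0, fun j => j.elim0, by simp, fun _ _ j => j.elim0⟩
  let b : ContDiffBump (0 : ℝ × ℝ) := ⟨1, 2, by norm_num, by norm_num⟩
  have hb : ∀ s t : ℝ, |s| < 1 → |t| < 1 → b (s, t) = 1 := by
    intro s t hs ht
    apply b.one_of_mem_closedBall
    rw [mem_closedBall_zero_iff, Prod.norm_def]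
    exact (max_lt hs ht).le
  obtain ⟨Q, R, hQ, hR, δ, hδ, hdiv⟩ := malgrange_division hm (fun p => b p * H p) (b.contDiff.mul hH)
    (b.hasCompactSupport.mul_right)
  have hsm : ∀ᶠ t in 𝓝 (0:ℝ), |t| < 1 ∧ |t| < δ := by
    have : Continuous (fun t : ℝ => |t|) := continuous_abs
    exact (this.continuousAt.eventually_lt_const (by simp)).and (this.continuousAt.eventually_lt_const (by simpa))
  have hdiv' : ∀ s t (lam : Fin m → ℝ), |s| < 1 → |t| < 1 → |t| < δ → (∀ j, |lam j| ≤ δ) →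
      H (s, t) = Q (s, t, lam) * (t ^ m + ∑ j, lam j * t ^ (j:ℕ)) + ∑ j, R j (s, lam) * t ^ (j:ℕ) := by
    intro s t lam hs ht ht2 hl
    rw [← hdiv s t lam ht2.le hl, hb s t hs ht, one_mul]
  let RR : ℝ × (Fin m → ℝ) → (Fin m → ℝ) := fun p j => R j p
  have hRR : ContDiff ℝ ∞ RR := contDiff_pi.2 hR
  let J : ℝ → Matrix (Fin m) (Fin m) ℝ := fun s j i => fderiv ℝ RR (s, 0) (0, Pi.single i 1) j
  have hJ : ∀ i j, ContDiff ℝ ∞ fun s => J s i j := by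
    intro i j
    have : ContDiff ℝ ∞ fun s : ℝ => fderiv ℝ RR (s, 0) (0, Pi.single j 1) :=
      ((hRR.fderiv_right (m := ∞) (by simp)).comp (contDiff_id.prodMk contDiff_const)).clm_apply contDiff_const
    exact contDiff_pi.1 this i
  have hJR : ∀ s ν, fderiv ℝ RR (s, 0) (0, ν) = (J s).mulVec ν := by
    intro s ν
    have e1 : ((0:ℝ), ν) = ∑ i, ν i • ((0:ℝ), (Pi.single i 1 : Fin m → ℝ)) := by
      ext j
      · simp [Prod.fst_sum]
      · simp [Prod.snd_sum, Finset.sum_apply, Pi.single_apply]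
    rw [e1, map_sum]
    ext j
    simp only [map_smul, Finset.sum_apply, Pi.smul_apply, Matrix.mulVec, dotProduct, J, smul_eq_mul]
    apply Finset.sum_congr rfl
    intro i _
    ring
  -- values at λ = 0
  have hval : ∀ s, |s| < 1 → (∀ j : Fin m, R j (s, 0) = h j s) ∧ Q (s, 0, 0) = q (s, 0) := by
    intro s hs
    have hk : ContinuousAt (fun t => q (s, t) - Q (s, t, 0)) 0 := by
      have h1 := hQ.continuous
      have h2 := hq.continuous
      fun_prop
    have := coef_ext_fin' (fun j : Fin m => R j (s, 0) - h j s) _ hk (by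
      filter_upwards [hsm] with t ht
      have a1 := hdiv' s t 0 hs ht.1 ht.2 (by simp [hδ.le])
      rw [hexp, Finset.sum_range] at a1
      simp only [Pi.zero_apply, zero_mul, Finset.sum_const_zero, add_zero, smul_eq_mul] at a1
      simp only [sub_mul, Finset.sum_sub_distrib]
      have : ∑ x : Fin m, h x s * t ^ (x:ℕ) = ∑ x : Fin m, t ^ (x:ℕ) * h x s :=
        Finset.sum_congr rfl fun _ _ => mul_comm _ _
      rw [this]
      linarith)
    exact ⟨fun j => sub_eq_zero.1 (this.1 j), (sub_eq_zero.1 this.2).symm⟩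
  have htri : ∀ s, |s| < 1 → ∀ i, (∀ j < i, J s j i = 0) ∧ J s i i = - q (s, 0) := by
    intro s hs i
    let D : ℝ → ℝ := fun t => fderiv ℝ Q (s, t, 0) (0, 0, Pi.single i 1)
    have hD : Continuous D := by
      have h1 := hQ.continuous_fderiv (by simp)
      have h2 : Continuous fun t : ℝ => fderiv ℝ Q (s, t, 0) := h1.comp (by fun_prop)
      fun_prop
    have hk : ContinuousAt (fun t => - Q (s, t, 0) - t ^ (m - i : ℕ) * D t) 0 := by
      have h1 := hQ.continuous
      fun_prop
    have := coef_ext_fin i (fun j => J s j i) _ hk (by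
      filter_upwards [hsm] with t ht
      have p1 : HasDerivAt (fun c : ℝ => (s, t, c • (Pi.single i 1 : Fin m → ℝ))) ((0:ℝ), (0:ℝ), (Pi.single i 1 : Fin m → ℝ)) 0 := by
        refine (hasDerivAt_const (0:ℝ) s).prodMk ((hasDerivAt_const (0:ℝ) t).prodMk ?_)
        simpa using (hasDerivAt_id (0:ℝ)).smul_const (Pi.single i 1 : Fin m → ℝ)
      have p2 : HasDerivAt (fun c : ℝ => (s, c • (Pi.single i 1 : Fin m → ℝ))) ((0:ℝ), (Pi.single i 1 : Fin m → ℝ)) 0 := by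
        refine (hasDerivAt_const (0:ℝ) s).prodMk ?_
        simpa using (hasDerivAt_id (0:ℝ)).smul_const (Pi.single i 1 : Fin m → ℝ)
      have d1 : HasDerivAt (fun c : ℝ => Q (s, t, c • (Pi.single i 1 : Fin m → ℝ))) (D t) 0 := by
        have hf : HasFDerivAt Q (fderiv ℝ Q (s, t, 0)) (s, t, (0:ℝ) • (Pi.single i 1 : Fin m → ℝ)) := by
          rw [zero_smul]
          exact (hQ.differentiable (by simp) _).hasFDerivAt
        exact hf.comp_hasDerivAt (0:ℝ) p1
      have d2 : HasDerivAt (fun c : ℝ => RR (s, c • (Pi.single i 1 : Fin m → ℝ))) (fun j => J s j i) 0 := by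
        have hf : HasFDerivAt RR (fderiv ℝ RR (s, 0)) (s, (0:ℝ) • (Pi.single i 1 : Fin m → ℝ)) := by
          rw [zero_smul]
          exact (hRR.differentiable (by simp) _).hasFDerivAt
        exact hf.comp_hasDerivAt (0:ℝ) p2
      have d2' := hasDerivAt_pi.1 d2
      have d3 : HasDerivAt (fun c : ℝ => t ^ m + c * t ^ (i:ℕ)) (t ^ (i:ℕ)) 0 := by
        simpa using ((hasDerivAt_id (0:ℝ)).mul_const (t ^ (i:ℕ))).const_add (t ^ m)
      have d4 := (d1.mul d3).add (HasDerivAt.fun_sum (u := Finset.univ) (fun j _ => (d2' j).mul_const (t ^ (j:ℕ))))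
      have d5 : HasDerivAt (fun c : ℝ => H (s, t)) 0 0 := hasDerivAt_const _ _
      have d6 := d4.congr_of_eventuallyEq (f₁ := fun c : ℝ => H (s, t)) (by
        filter_upwards [hsm] with c hc
        rw [hdiv' s t (c • Pi.single i 1) hs ht.1 ht.2 (by
          intro j
          simp only [Pi.smul_apply, Pi.single_apply, smul_eq_mul]
          split_ifs
          · simpa using hc.2.le
          · simpa using hδ.le)]
        simp [Pi.single_apply, RR])
      have d7 := d5.unique d6
      simp only [zero_smul, zero_mul, add_zero] at d7
      have : t ^ m = t ^ (i:ℕ) * t ^ (m - i : ℕ) := by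
        rw [← pow_add]; congr 1; have := i.2; omega
      rw [this] at d7
      linarith)
    refine ⟨this.1, ?_⟩
    rw [this.2, (hval s hs).2, zero_pow (by have := i.2; omega), zero_mul, sub_zero]
  have hs1 : ∀ᶠ s in 𝓝 (0:ℝ), |s| < 1 := hsm.mono fun s h => h.1
  obtain ⟨μ, hμ, hμ0, hμR, hμO⟩ := tougeron hRR hJ hJR (e := d * m) (u := fun s => (- u s) ^ m) (hu.neg.pow m)
    (pow_ne_zero _ (neg_ne_zero.2 hu0)) (by
      filter_upwards [hs1] with s hs
      rw [Matrix.det_of_isLowerTriangular]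
      · simp only [(htri s hs _).2, Finset.prod_const, Finset.card_univ, Fintype.card_fin, hqu]
        rw [pow_mul, ← mul_pow]
        ring
      · intro j i hij
        exact (htri s hs i).1 j hij)
    (ρ := fun s j => ρ j s) (contDiff_pi.2 fun j => hρ j) (by ext j; exact hρ0 j j.2) (by
      filter_upwards [hs1] with s hs
      ext j
      simp only [RR, (hval s hs).1 j, hhρ j j.2, Pi.smul_apply, smul_eq_mul])
  let lam : Fin m → ℝ → ℝ := fun j s => s ^ (d * m) * μ s j
  have hlam : ∀ j, ContDiff ℝ ∞ (lam j) := fun j => (contDiff_id.pow _).mul (contDiff_pi.1 hμ j)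
  have hlam0 : ∀ j, lam j 0 = 0 := fun j => by simp [lam, hμ0]
  refine ⟨fun p => Q (p.1, p.2, fun j => lam j p.1), lam, ?_, hlam, hlam0, ?_, ?_⟩
  · refine hQ.comp (contDiff_fst.prodMk (contDiff_snd.prodMk ?_))
    exact contDiff_pi.2 fun j => (hlam j).comp contDiff_fst
  · have hl : ∀ᶠ s in 𝓝 (0:ℝ), ∀ j, |lam j s| ≤ δ := by
      rw [eventually_all]
      intro j
      have : ContinuousAt (fun s => |lam j s|) 0 := (hlam j).continuous.abs.continuousAt
      exact (this.eventually_lt_const (by beta_reduce; rw [hlam0, abs_zero]; exact hδ)).mono fun s h => h.le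
    have f1 : Tendsto (Prod.fst : ℝ × ℝ → ℝ) (𝓝 0) (𝓝 0) := continuous_fst.tendsto' _ _ rfl
    have f2 : Tendsto (Prod.snd : ℝ × ℝ → ℝ) (𝓝 0) (𝓝 0) := continuous_snd.tendsto' _ _ rfl
    filter_upwards [f1.eventually hl, f1.eventually hs1, f2.eventually hsm, f1.eventually hμR] with p p1 p2 p3 p4
    have a1 := hdiv' p.1 p.2 (fun j => lam j p.1) p2 p3.1 p3.2 p1
    have a2 : ∀ j, R j (p.1, fun j => lam j p.1) = 0 := fun j => congrFun p4 j
    simp only [a2, zero_mul, Finset.sum_const_zero, add_zero] at a1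
    exact a1
  · intro N hN j
    have h1 := hμO N (fun j => hN j j.2) j
    have h2 : (fun s : ℝ => s ^ (d * m)) =O[𝓝 0] fun _ => (1:ℝ) :=
      ((continuous_pow (d * m)).tendsto 0).isBigO_one ℝ
    simpa using h2.mul h1

end NP

namespace NP
open scoped ContDiff Topology

section one
variable {F : Type} [NormedAddCommGroup F] [NormedSpace ℝ F]

lemma had1 [CompleteSpace F] {a : ℝ → F} (ha : ContDiff ℝ ∞ a) :
    ∃ b : ℝ → F, ContDiff ℝ ∞ b ∧ ∀ t, a t = a 0 + t • b t := by
  obtain ⟨g, hg, h⟩ := hadamard (E := ℝ) (f := fun p : ℝ × ℝ => a p.2) (ha.comp contDiff_snd)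
  exact ⟨fun t => g (0, t), hg.comp (contDiff_const.prodMk contDiff_id), fun t => h 0 t⟩

lemma iterDeriv_smooth {a : ℝ → F} (ha : ContDiff ℝ ∞ a) (j : ℕ) : ContDiff ℝ ∞ (iteratedDeriv j a) := by
  induction j with
  | zero => simpa [iteratedDeriv_zero] using ha
  | succ j ih =>
    rw [iteratedDeriv_succ]
    exact (contDiff_infty_iff_deriv.1 ih).2

lemma iterDeriv_id_smul {b : ℝ → F} (hb : ContDiff ℝ ∞ b) (j : ℕ) (t : ℝ) :
    iteratedDeriv (j + 1) (fun t => t • b t) t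
      = ((j : ℝ) + 1) • iteratedDeriv j b t + t • iteratedDeriv (j + 1) b t := by
  have hd : ∀ k t, HasDerivAt (iteratedDeriv k b) (iteratedDeriv (k+1) b t) t := by
    intro k t
    rw [iteratedDeriv_succ]
    exact (((iterDeriv_smooth hb k).differentiable (by simp)) t).hasDerivAt
  induction j generalizing t with
  | zero =>
    rw [iteratedDeriv_succ, iteratedDeriv_zero]
    have := ((hasDerivAt_id t).smul (hd 0 t)).deriv
    simp only [iteratedDeriv_zero, id] at this
    simp only [zero_add, iteratedDeriv_zero]
    refine Eq.trans this ?_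
    simp [add_comm]
  | succ j ih =>
    rw [iteratedDeriv_succ]
    have : iteratedDeriv (j + 1) (fun t => t • b t) = fun t => ((j : ℝ) + 1) • iteratedDeriv j b t + t • iteratedDeriv (j + 1) b t := funext ih
    rw [this]
    refine Eq.trans (((hd j t).const_smul ((j:ℝ)+1)).add ((hasDerivAt_id t).smul (hd (j+1) t))).deriv ?_
    push_cast
    simp only [id, one_smul]
    module

lemma taylor1 [CompleteSpace F] (N : ℕ) : ∀ {a : ℝ → F} (_ : ContDiff ℝ ∞ a),
    ∃ b : ℝ → F, ContDiff ℝ ∞ b ∧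
      ∀ t, a t = ∑ j ∈ Finset.range N, t ^ j • (((j.factorial : ℝ))⁻¹ • iteratedDeriv j a 0) + t ^ N • b t := by
  induction N with
  | zero => intro a ha; exact ⟨a, ha, by simp⟩
  | succ N ih =>
    intro a ha
    obtain ⟨b, hb, hab⟩ := had1 ha
    obtain ⟨b', hb', h⟩ := ih hb
    refine ⟨b', hb', fun t => ?_⟩
    have key : ∀ j, iteratedDeriv (j+1) a 0 = ((j:ℝ)+1) • iteratedDeriv j b 0 := by
      intro j
      have h1 : a = fun t => (fun t => t • b t) t + a 0 := by ext t; rw [hab t, add_comm]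
      rw [h1, iteratedDeriv_succ', deriv_add_const', ← iteratedDeriv_succ', iterDeriv_id_smul hb]
      simp
    rw [Finset.sum_range_succ', hab t, h t]
    simp only [key, iteratedDeriv_zero, pow_zero, Nat.factorial_zero, Nat.cast_one, inv_one, one_smul]
    rw [smul_add, Finset.smul_sum, smul_smul, ← pow_succ']
    have : ∀ j, t • t ^ j • ((j.factorial : ℝ))⁻¹ • iteratedDeriv j b 0 = t ^ (j+1) • (((j+1).factorial : ℝ))⁻¹ • ((j:ℝ)+1) • iteratedDeriv j b 0 := by
      intro j
      rw [Nat.factorial_succ]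
      simp only [smul_smul]
      congr 1
      push_cast
      have : (j:ℝ)+1 ≠ 0 := by positivity
      have h2 : (j.factorial : ℝ) ≠ 0 := by positivity
      field_simp
      ring
    simp only [this]
    abel

/-- flat at zero -/
def Flat (a : ℝ → F) : Prop := ∀ N : ℕ, ∃ b : ℝ → F, ContDiff ℝ ∞ b ∧ ∀ t, a t = t ^ N • b t

lemma smul_pow_cancel {N : ℕ} {a b : ℝ → F} (ha : Continuous a) (hb : Continuous b)
    (h : ∀ t, t ^ N • a t = t ^ N • b t) : a = b := by
  apply Continuous.ext_on (s := {0}ᶜ) (dense_compl_singleton 0) ha hb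
  intro t ht
  have ht : t ≠ 0 := ht
  exact smul_right_injective F (pow_ne_zero N ht) (h t)

lemma Flat.div {a : ℝ → F} (ha : Flat a) (N : ℕ) : ∃ b : ℝ → F, ContDiff ℝ ∞ b ∧ Flat b ∧ ∀ t, a t = t ^ N • b t := by
  obtain ⟨b, hb, h⟩ := ha N
  refine ⟨b, hb, fun M => ?_, h⟩
  obtain ⟨c, hc, h'⟩ := ha (N + M)
  refine ⟨c, hc, fun t => ?_⟩
  have : b = fun t => t ^ M • c t := by
    apply smul_pow_cancel (N := N) hb.continuous (by have := hc.continuous; fun_prop)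
    intro t
    rw [← h, h', pow_add, mul_smul]
  exact congrFun this t

lemma Flat.smooth {a : ℝ → F} (ha : Flat a) : ContDiff ℝ ∞ a := by
  obtain ⟨b, hb, h⟩ := ha 0
  have : a = b := by ext t; simpa using h t
  rwa [this]

lemma Flat.isBigO {a : ℝ → F} (ha : Flat a) (N : ℕ) : a =O[𝓝 0] fun t => t ^ N := by
  obtain ⟨b, hb, h⟩ := ha N
  have h1 : a = fun t => t ^ N • b t := funext h
  have h2 : b =O[𝓝 0] (fun _ => (1:ℝ)) := hb.continuous.continuousAt.isBigO_one ℝ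
  rw [h1]
  simpa using (isBigO_refl (fun t : ℝ => t ^ N) (𝓝 0)).smul h2

lemma Flat.zero {a : ℝ → F} (ha : Flat a) : a 0 = 0 := by
  obtain ⟨b, hb, h⟩ := ha 1
  simpa using h 0

lemma flat_of_coef [CompleteSpace F] {a : ℝ → F} (ha : ContDiff ℝ ∞ a) (h : ∀ j, iteratedDeriv j a 0 = 0) : Flat a := by
  intro N
  obtain ⟨b, hb, h1⟩ := taylor1 N ha
  exact ⟨b, hb, fun t => by rw [h1 t]; simp [h]⟩

/-- low-order vanishing -/
lemma div_of_coef [CompleteSpace F] {a : ℝ → F} (ha : ContDiff ℝ ∞ a) (N : ℕ) (h : ∀ j < N, iteratedDeriv j a 0 = 0) :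
    ∃ b : ℝ → F, ContDiff ℝ ∞ b ∧ b 0 = ((N.factorial : ℝ))⁻¹ • iteratedDeriv N a 0 ∧ ∀ t, a t = t ^ N • b t := by
  obtain ⟨b, hb, h1⟩ := taylor1 (N+1) ha
  refine ⟨fun t => ((N.factorial : ℝ))⁻¹ • iteratedDeriv N a 0 + t • b t, by fun_prop, by simp, fun t => ?_⟩
  rw [h1 t, Finset.sum_range_succ, Finset.sum_eq_zero]
  · rw [smul_add, zero_add, pow_succ, mul_smul]
  · intro j hj
    rw [h j (Finset.mem_range.1 hj)]; simp

lemma flat_or [CompleteSpace F] {a : ℝ → F} (ha : ContDiff ℝ ∞ a) :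
    Flat a ∨ ∃ (o : ℕ) (b : ℝ → F), ContDiff ℝ ∞ b ∧ b 0 ≠ 0 ∧ ∀ t, a t = t ^ o • b t := by
  by_cases h : ∀ j, iteratedDeriv j a 0 = 0
  · exact Or.inl (flat_of_coef ha h)
  · push Not at h
    right
    have h1 := Nat.find_spec h
    obtain ⟨b, hb, hb0, hab⟩ := div_of_coef ha (Nat.find h) (fun j hj => not_not.1 (Nat.find_min h hj))
    refine ⟨_, b, hb, ?_, hab⟩
    rw [hb0]
    exact smul_ne_zero (by positivity) h1

lemma flat_of_isBigO [CompleteSpace F] {a : ℝ → F} (ha : ContDiff ℝ ∞ a) {l : Filter ℝ} [l.NeBot] (hl : l ≤ 𝓝[≠] 0)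
    (h : ∀ N : ℕ, a =O[l] fun t => t ^ N) : Flat a := by
  rcases flat_or ha with h1 | ⟨o, b, hb, hb0, hab⟩
  · exact h1
  exfalso
  obtain ⟨C, hC⟩ := (h (o+1)).bound
  have ht : Tendsto (fun t => ‖b t‖) l (𝓝 ‖b 0‖) := (hb.continuous.norm.tendsto 0).mono_left (hl.trans nhdsWithin_le_nhds)
  have ht2 : Tendsto (fun t : ℝ => C * ‖t‖) l (𝓝 (C * ‖(0:ℝ)‖)) :=
    ((continuous_const.mul continuous_norm).tendsto 0).mono_left (hl.trans nhdsWithin_le_nhds)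
  have : ‖b 0‖ ≤ C * ‖(0:ℝ)‖ := by
    apply le_of_tendsto_of_tendsto ht ht2
    filter_upwards [hC, hl self_mem_nhdsWithin] with t h1 h2
    have h2 : t ≠ 0 := h2
    rw [hab, norm_smul, norm_pow, norm_pow, pow_succ] at h1
    have : 0 < ‖t‖ ^ o := by positivity
    nlinarith
  simp at this
  exact hb0 this

end one
end NP

namespace NP
open scoped ContDiff Topology

/-- partial derivatives in the second variable are smooth -/
lemma iterDeriv_snd_smooth (j : ℕ) : ∀ {G : ℝ × ℝ → ℝ} (_ : ContDiff ℝ ∞ G),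
    ∃ D : ℝ × ℝ → ℝ, ContDiff ℝ ∞ D ∧ ∀ x y, iteratedDeriv j (fun y => G (x, y)) y = D (x, y) := by
  induction j with
  | zero => intro G hG; exact ⟨G, hG, by simp⟩
  | succ j ih =>
    intro G hG
    have h1 : ContDiff ℝ ∞ (fun p : ℝ × ℝ => fderiv ℝ G p (0, 1)) :=
      (hG.fderiv_right (m := ∞) (by simp)).clm_apply contDiff_const
    obtain ⟨D, hD, h⟩ := ih h1
    refine ⟨D, hD, fun x y => ?_⟩
    rw [iteratedDeriv_succ', ← h]
    congr 1
    ext y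
    have h2 : HasFDerivAt G (fderiv ℝ G (x, y)) (x, y) := (hG.differentiable (by simp) _).hasFDerivAt
    have h3 : HasDerivAt (fun y : ℝ => (x, y)) ((0:ℝ), (1:ℝ)) y := (hasDerivAt_const y x).prodMk (hasDerivAt_id y)
    exact (h2.comp_hasDerivAt y h3).deriv

lemma coef_unique {N : ℕ} {f : ℝ → ℝ} (hf : ContDiff ℝ ∞ f) {c : ℕ → ℝ} {b : ℝ → ℝ} (hb : ContDiff ℝ ∞ b)
    (h : ∀ t, f t = ∑ j ∈ Finset.range N, t ^ j * c j + t ^ N * b t) {j : ℕ} (hj : j < N) :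
    iteratedDeriv j f 0 = j.factorial * c j := by
  obtain ⟨b', hb', h'⟩ := taylor1 N hf
  have := (coef_ext N j hj (fun j => c j - ((j.factorial : ℝ))⁻¹ * iteratedDeriv j f 0)
    (fun t => t ^ (N - j) * (b' t - b t)) (by
      have := hb.continuous; have := hb'.continuous
      exact Continuous.continuousAt (by fun_prop)) (by
      filter_upwards with t
      have h1 := (h t).symm.trans (h' t)
      rw [← mul_assoc, ← pow_add, Nat.add_sub_cancel' hj.le]
      simp only [smul_eq_mul] at h1
      have : ∑ j ∈ Finset.range N, (c j - ((j.factorial : ℝ))⁻¹ * iteratedDeriv j f 0) * t ^ j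
         = ∑ j ∈ Finset.range N, t ^ j * c j - ∑ j ∈ Finset.range N, t ^ j * (((j.factorial : ℝ))⁻¹ * iteratedDeriv j f 0) := by
        rw [← Finset.sum_sub_distrib]; exact Finset.sum_congr rfl fun _ _ => by ring
      rw [this]; linarith)).2
  have h0 : (0:ℝ) ^ (N - j) = 0 := zero_pow (by omega)
  simp only [h0, zero_mul] at this
  have h2 : (j.factorial : ℝ) ≠ 0 := by positivity
  field_simp at this
  linarith

lemma tc_coef {F : ℝ × ℝ → ℝ} (hF : ContDiff ℝ ∞ F) {N : ℕ} {g : ℕ → ℝ → ℝ} (hg : ∀ i, ContDiff ℝ ∞ (g i)) {q : ℝ × ℝ → ℝ}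
    (hq : ContDiff ℝ ∞ q) (h : ∀ y x, F (x, y) = ∑ i ∈ Finset.range N, x ^ i • g i y + x ^ N • q (y, x)) {i : ℕ} (hi : i < N) (j : ℕ) :
    iteratedDeriv j (g i) 0 = j.factorial * taylorCoeff2 (fun x y => F (x, y)) i j := by
  obtain ⟨D, hD, hDF⟩ := iterDeriv_snd_smooth j hF
  obtain ⟨E, hE, hEq⟩ := iterDeriv_snd_smooth j (G := fun p => q (p.2, p.1)) (hq.comp (contDiff_snd.prodMk contDiff_fst))
  have key : ∀ x, iteratedDeriv j (fun y => F (x, y)) 0 = ∑ i ∈ Finset.range N, x ^ i * iteratedDeriv j (g i) 0 + x ^ N * E (x, 0) := by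
    intro x
    have h1 : (fun y => F (x, y)) = fun y => (∑ i ∈ Finset.range N, x ^ i * g i y) + x ^ N * q (y, x) := by
      ext y; simpa using h y x
    have hcd : ∀ (g : ℝ → ℝ), ContDiff ℝ ∞ g → ContDiffAt ℝ j g 0 := fun g hg => (hg.of_le (by exact_mod_cast le_top)).contDiffAt
    have hq1 : ContDiff ℝ ∞ (fun y => q (y, x)) := hq.comp (contDiff_id.prodMk contDiff_const)
    rw [h1, iteratedDeriv_fun_add]
    · rw [iteratedDeriv_fun_sum, iteratedDeriv_const_mul_field, hEq]
      · congr 1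
        apply Finset.sum_congr rfl
        intro i _
        rw [iteratedDeriv_const_mul_field]
      · intro i _
        exact hcd _ (contDiff_const.mul (hg i))
    · exact hcd _ (ContDiff.sum fun i _ => contDiff_const.mul (hg i))
    · exact hcd _ (contDiff_const.mul hq1)
  have h2 : ContDiff ℝ ∞ fun x => D (x, 0) := hD.comp (contDiff_id.prodMk contDiff_const)
  have h3 := coef_unique (N := N) h2 (c := fun i => iteratedDeriv j (g i) 0) (b := fun x => E (x, 0))
    (hE.comp (contDiff_id.prodMk contDiff_const)) (fun x => by rw [← hDF, key]) hi
  unfold taylorCoeff2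
  simp only [hDF]
  rw [h3]
  have h2 : (j.factorial : ℝ) ≠ 0 := by positivity
  have h2' : (i.factorial : ℝ) ≠ 0 := by positivity
  field_simp

end NP

namespace NP
open scoped ContDiff Topology

lemma prep2 {F : ℝ × ℝ → ℝ} (hF : ContDiff ℝ ∞ F) {A n : ℕ}
    (h1 : ∀ i < A, ∀ j, taylorCoeff2 (fun x y => F (x, y)) i j = 0)
    (h2 : ∀ j < n, taylorCoeff2 (fun x y => F (x, y)) A j = 0)
    (h3 : taylorCoeff2 (fun x y => F (x, y)) A n ≠ 0) :
    ∃ (U : ℝ × ℝ → ℝ) (lam : Fin A → ℝ → ℝ) (mu : Fin n → ℝ → ℝ), ContDiff ℝ ∞ U ∧ U 0 ≠ 0 ∧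
      (∀ j, ContDiff ℝ ∞ (lam j)) ∧ (∀ j N, lam j =O[𝓝 0] fun t => t ^ N) ∧
      (∀ j, ContDiff ℝ ∞ (mu j)) ∧ (∀ j, mu j 0 = 0) ∧
      ∀ᶠ p in 𝓝 (0 : ℝ × ℝ), F p = U p * (p.1 ^ A + ∑ j, lam j p.2 * p.1 ^ (j:ℕ)) * (p.2 ^ n + ∑ j, mu j p.1 * p.2 ^ (j : ℕ)) := by
  have hH : ContDiff ℝ ∞ (fun p : ℝ × ℝ => F (p.2, p.1)) := hF.comp (contDiff_snd.prodMk contDiff_fst)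
  obtain ⟨g, q', hg, hq', hexp'⟩ := hadamard_iter (A + 1) hH
  have hco : ∀ i < A + 1, ∀ j, iteratedDeriv j (g i) 0 = j.factorial * taylorCoeff2 (fun x y => F (x, y)) i j :=
    fun i hi j => tc_coef hF hg hq' hexp' hi j
  have hgflat : ∀ i < A, Flat (g i) := fun i hi => flat_of_coef (hg i) fun j => by
    rw [hco i (by omega), h1 i hi j, mul_zero]
  obtain ⟨u, hu, hu0, hgu⟩ := div_of_coef (hg A) n (fun j hj => by rw [hco A (by omega), h2 j hj, mul_zero])
  have hu0' : u 0 ≠ 0 := by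
    rw [hu0, hco A (by omega)]
    exact smul_ne_zero (by positivity) (mul_ne_zero (by positivity) h3)
  have hρ : ∀ i, ∃ ρ : ℝ → ℝ, ContDiff ℝ ∞ ρ ∧ Flat ρ ∧ (i < A → ∀ t, g i t = t ^ (2 * (n * A)) * ρ t) := by
    intro i
    by_cases hi : i < A
    · obtain ⟨b, hb, hbf, h⟩ := (hgflat i hi).div (2 * (n * A))
      exact ⟨b, hb, hbf, fun _ => h⟩
    · exact ⟨fun _ => 0, contDiff_const, fun N => ⟨fun _ => 0, contDiff_const, by simp⟩, fun h => absurd h hi⟩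
  choose ρ hρ hρf hgρ using hρ
  let q : ℝ × ℝ → ℝ := fun p => g A p.1 + p.2 * q' p
  have hq : ContDiff ℝ ∞ q := ((hg A).comp contDiff_fst).add (contDiff_snd.mul hq')
  have hexp : ∀ s t, F (t, s) = ∑ j ∈ Finset.range A, t ^ j • g j s + t ^ A • q (s, t) := by
    intro s t
    rw [hexp' s t, Finset.sum_range_succ]
    simp only [q, smul_eq_mul]
    ring
  obtain ⟨V, lam, hV, hlam, hlam0, hVeq, hlamO⟩ := prep hH hq hexp hu hu0' (d := n) (fun s => by simp [q, hgu]) hρ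
    (fun j _ => (hρf j).zero) (fun j hj => hgρ j hj)
  have hlamO' : ∀ j N, lam j =O[𝓝 0] fun t => t ^ N := fun j N => hlamO N (fun i _ => (hρf i).isBigO N) j
  have hlamF : ∀ j, Flat (lam j) := fun j => flat_of_isBigO (hlam j) le_rfl fun N => (hlamO' j N).mono nhdsWithin_le_nhds
  -- restrict to the curve x = y ^ M
  set M := n + 1 with hM
  have hgb : ∀ i, ∃ b : ℝ → ℝ, ContDiff ℝ ∞ b ∧ (i < A → ∀ t, g i t = t ^ (A * M + n + 1) * b t) := by
    intro i
    by_cases hi : i < A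
    · obtain ⟨b, hb, h⟩ := (hgflat i hi) (A * M + n + 1)
      exact ⟨b, hb, fun _ => h⟩
    · exact ⟨fun _ => 0, contDiff_const, fun h => absurd h hi⟩
  choose b hb hgb using hgb
  have hl : ∀ j, ∃ l : ℝ → ℝ, ContDiff ℝ ∞ l ∧ ∀ t, lam j t = t ^ (A * M + 1) * l t := fun j => hlamF j _
  choose l hl hlaml using hl
  obtain ⟨V', hV', hVV'⟩ := hadamard hV
  let s1 : ℝ → ℝ := fun y => ∑ i ∈ Finset.range A, y ^ (i * M) * b i y + q' (y, y ^ M)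
  let s2 : ℝ → ℝ := fun y => ∑ j : Fin A, l j y * y ^ ((j:ℕ) * M)
  have hs1 : Continuous s1 := by
    have := fun i => (hb i).continuous
    have := hq'.continuous
    exact (continuous_finsetSum _ fun i _ => by fun_prop).add (by fun_prop)
  have hs2 : Continuous s2 := by
    have := fun i => (hl i).continuous
    exact (continuous_finsetSum _ fun i _ => by fun_prop)
  have hcurve : Tendsto (fun y : ℝ => (y, y ^ M)) (𝓝 0) (𝓝 (0 : ℝ × ℝ)) := by
    have : Continuous (fun y : ℝ => (y, y ^ M)) := by fun_prop
    simpa [hM, Prod.zero_eq_mk] using this.tendsto 0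
  let k : ℝ → ℝ := fun y => (u y + y * s1 y) / (1 + y * s2 y) - y * V' (y, y ^ M)
  have hk : ContinuousAt k 0 := by
    have := hu.continuous
    have := hV'.continuous
    apply ContinuousAt.sub
    · apply ContinuousAt.div
      · exact Continuous.continuousAt (by fun_prop)
      · exact Continuous.continuousAt (by fun_prop)
      · simp
    · exact Continuous.continuousAt (by fun_prop)
  have hk0 : k 0 = u 0 := by simp [k]
  have hne : ∀ᶠ y in 𝓝 (0:ℝ), 1 + y * s2 y ≠ 0 := by
    have : ContinuousAt (fun y => 1 + y * s2 y) 0 := Continuous.continuousAt (by fun_prop)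
    exact this.eventually_ne (by simp)
  have hVk' : ∀ᶠ y in 𝓝[≠] (0:ℝ), V (y, 0) = y ^ n * k y := by
    filter_upwards [(hcurve.eventually hVeq).filter_mono nhdsWithin_le_nhds, hne.filter_mono nhdsWithin_le_nhds, self_mem_nhdsWithin] with y hy hy1 hy0
    have hy0 : y ≠ 0 := hy0
    have e1 : F (y ^ M, y) = y ^ (A * M) * (y ^ n * (u y + y * s1 y)) := by
      rw [hexp]
      have : ∀ i ∈ Finset.range A, (y ^ M) ^ i • g i y = y ^ (A * M) * (y ^ n * y) * (y ^ (i * M) * b i y) := by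
        intro i hi
        rw [hgb i (Finset.mem_range.1 hi), smul_eq_mul]
        ring
      rw [Finset.sum_congr rfl this, ← Finset.mul_sum]
      simp only [q, s1, hgu, smul_eq_mul]
      generalize q' (y, y ^ M) = Q
      rw [hM]
      ring
    have e2 : (y ^ M) ^ A + ∑ j : Fin A, lam j y * (y ^ M) ^ (j:ℕ) = y ^ (A * M) * (1 + y * s2 y) := by
      simp only [s2, hlaml, Finset.mul_sum, mul_add]
      congr 1
      · ring
      · exact Finset.sum_congr rfl fun j _ => by ring
    rw [e1, e2, hVV'] at hy
    have hyA : y ^ (A * M) ≠ 0 := pow_ne_zero _ hy0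
    have hy' : y ^ n * (u y + y * s1 y) = (V (y, 0) + y ^ M * V' (y, y ^ M)) * (1 + y * s2 y) := by
      apply mul_left_cancel₀ hyA
      rw [hy, smul_eq_mul]; ring
    simp only [k]
    rw [mul_sub, ← mul_div_assoc, hy', mul_div_assoc, div_self hy1, hM]
    ring
  have hVk : ∀ᶠ y in 𝓝 (0:ℝ), V (y, 0) = y ^ n * k y := by
    have hc : Continuous fun y : ℝ => V (y, 0) := by have := hV.continuous; fun_prop
    have hc2 : ContinuousAt (fun y => y ^ n * k y) 0 := (Continuous.continuousAt (by fun_prop)).mul hk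
    have : V (0, 0) = 0 ^ n * k 0 := by
      have t1 : Tendsto (fun y : ℝ => V (y, 0)) (𝓝[≠] 0) (𝓝 (V (0,0))) := (hc.tendsto 0).mono_left nhdsWithin_le_nhds
      have t2 : Tendsto (fun y => y ^ n * k y) (𝓝[≠] 0) (𝓝 (0 ^ n * k 0)) := hc2.tendsto.mono_left nhdsWithin_le_nhds
      exact tendsto_nhds_unique (t1.congr' hVk') t2
    rw [eventually_nhdsWithin_iff] at hVk'
    filter_upwards [hVk'] with y hy
    by_cases h0 : y = 0
    · rw [h0, this]
    · exact hy h0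
  -- second preparation
  let W : ℝ × ℝ → ℝ := fun p => V (p.2, p.1)
  have hW : ContDiff ℝ ∞ W := hV.comp (contDiff_snd.prodMk contDiff_fst)
  obtain ⟨h, r, hh, hr, hWexp⟩ := hadamard_iter n hW
  have hlow : (∀ j < n, h j 0 = 0) ∧ r (0, 0) = u 0 := by
    have hrc : Continuous fun y : ℝ => r (0, y) := by have := hr.continuous; fun_prop
    have hkey : ∀ᶠ t in 𝓝 (0:ℝ), ∑ j ∈ Finset.range (n+1), (if j < n then h j 0 else r (0,0)) * t ^ j = t ^ n * (k t - (r (0, t) - r (0,0))) := by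
      filter_upwards [hVk] with t ht
      rw [Finset.sum_range_succ]
      have e := hWexp 0 t
      simp only [W] at e
      rw [ht] at e
      have : ∑ j ∈ Finset.range n, (if j < n then h j 0 else r (0,0)) * t ^ j = ∑ j ∈ Finset.range n, t ^ j • h j 0 :=
        Finset.sum_congr rfl fun j hj => by rw [if_pos (Finset.mem_range.1 hj), smul_eq_mul, mul_comm]
      rw [this]
      simp only [smul_eq_mul, lt_irrefl, if_false] at e ⊢
      linarith
    have := coef_ext (n+1) n (by omega) _ _ (hk.sub ((hrc.sub continuous_const).continuousAt)) hkey
    refine ⟨fun j hj => by simpa [hj] using this.1 j hj, ?_⟩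
    simpa [hk0] using this.2
  have hr1 : ContDiff ℝ ∞ fun s : ℝ => r (s, 0) := hr.comp (contDiff_id.prodMk contDiff_const)
  obtain ⟨U, mu, hU, hmu, hmu0, hUeq, -⟩ := prep hW hr hWexp (d := 0) (u := fun s => r (s, 0)) hr1 (by simpa [hlow.2] using hu0') (fun s => by simp)
    hh hlow.1 (fun j _ s => by simp)
  refine ⟨U, lam, mu, hU, ?_, hlam, hlamO', hmu, hmu0, ?_⟩
  · -- U 0 ≠ 0
    intro hU0
    have hU0 : U (0, 0) = 0 := hU0
    have hUc : Continuous fun y : ℝ => U (0, y) := by have := hU.continuous; fun_prop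
    have hc0 : Tendsto (fun y : ℝ => ((0:ℝ), y)) (𝓝 0) (𝓝 (0 : ℝ × ℝ)) := by
      have : Continuous (fun y : ℝ => ((0:ℝ), y)) := by fun_prop
      simpa [Prod.zero_eq_mk] using this.tendsto 0
    have : ∀ᶠ y in 𝓝[≠] (0:ℝ), U (0, y) = k y := by
      filter_upwards [(hc0.eventually hUeq).filter_mono nhdsWithin_le_nhds, hVk.filter_mono nhdsWithin_le_nhds, self_mem_nhdsWithin] with y h1 h2 h3
      have h3 : y ≠ 0 := h3
      simp only [W, hmu0, zero_mul, Finset.sum_const_zero, add_zero] at h1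
      rw [h2, mul_comm] at h1
      exact (mul_right_cancel₀ (pow_ne_zero n h3) h1).symm
    have t1 : Tendsto (fun y : ℝ => U (0, y)) (𝓝[≠] 0) (𝓝 (U (0,0))) := (hUc.tendsto 0).mono_left nhdsWithin_le_nhds
    have t2 : Tendsto k (𝓝[≠] 0) (𝓝 (k 0)) := hk.tendsto.mono_left nhdsWithin_le_nhds
    have := tendsto_nhds_unique (t1.congr' this) t2
    rw [hU0, hk0] at this
    exact hu0' this.symm
  · have hsw : Tendsto (fun p : ℝ × ℝ => (p.2, p.1)) (𝓝 0) (𝓝 (0 : ℝ × ℝ)) := by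
      have : Continuous (fun p : ℝ × ℝ => (p.2, p.1)) := by fun_prop
      simpa [Prod.zero_eq_mk] using this.tendsto 0
    filter_upwards [hsw.eventually hVeq, hUeq] with p hp1 hp2
    simp only [W] at hp1 hp2
    rw [hp1, hp2]
    ring

end NP

namespace NP
open scoped ContDiff Topology
open Polynomial

/-- smooth families of monic complex polynomials of degree `d` -/
structure SP (d : ℕ) (P : ℝ → ℂ[X]) : Prop where
  monic : ∀ t, (P t).Monic
  deg : ∀ t, (P t).natDegree = d
  smooth : ∀ i, ContDiff ℝ ∞ fun t => (P t).coeff i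

def Lc (a k : ℕ) : (Fin a → ℂ) →L[ℝ] ℂ :=
  if h : k < a then ContinuousLinearMap.proj (R := ℝ) (φ := fun _ : Fin a => ℂ) ⟨k, h⟩ else 0

def lin {a : ℕ} (u : Fin a → ℂ) : ℂ[X] := ∑ i : Fin a, monomial (i:ℕ) (u i)

lemma lin_coeff {a : ℕ} (u : Fin a → ℂ) (k : ℕ) : (lin u).coeff k = Lc a k u := by
  unfold lin Lc
  rw [finsetSum_coeff]
  simp only [coeff_monomial]
  split_ifs with h
  · rw [Finset.sum_eq_single ⟨k, h⟩]
    · simp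
    · intro b _ hb
      rw [if_neg]
      intro h'
      exact hb (Fin.ext h')
    · simp
  · apply Finset.sum_eq_zero
    intro i _
    rw [if_neg]
    intro h'
    exact h (h' ▸ i.2)

lemma lin_degree {a : ℕ} (u : Fin a → ℂ) : (lin u).degree < a := by
  rw [degree_lt_iff_coeff_zero]
  intro m hm
  rw [lin_coeff, Lc, dif_neg (by omega)]
  rfl

def mkp {a : ℕ} (u : Fin a → ℂ) : ℂ[X] := X ^ a + lin u

lemma mkp_coeff {a : ℕ} (u : Fin a → ℂ) (k : ℕ) : (mkp u).coeff k = (X ^ a : ℂ[X]).coeff k + Lc a k u := by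
  rw [mkp, coeff_add, lin_coeff]

lemma mkp_monic {a : ℕ} (u : Fin a → ℂ) : (mkp u).Monic := monic_X_pow_add (lin_degree u)

lemma mkp_natDegree {a : ℕ} (u : Fin a → ℂ) : (mkp u).natDegree = a := by
  apply natDegree_eq_of_degree_eq_some
  rw [mkp, degree_add_eq_left_of_degree_lt]
  · simp
  · simpa using lin_degree u

lemma eq_mkp {a : ℕ} {p : ℂ[X]} (hp : p.Monic) (hd : p.natDegree = a) : p = mkp (fun i : Fin a => p.coeff i) := by
  ext k
  rw [mkp_coeff, coeff_X_pow, Lc]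
  rcases lt_trichotomy k a with h | h | h
  · rw [if_neg (by omega), dif_pos h]; simp
  · subst h; rw [if_pos rfl, dif_neg (by omega), ← hd]; simpa [Monic] using hp
  · rw [if_neg (by omega), dif_neg (by omega), coeff_eq_zero_of_natDegree_lt (by omega)]; simp

def Gmap (a b : ℕ) (z : (Fin a → ℂ) × (Fin b → ℂ)) : Fin (a + b) → ℂ := fun i => (mkp z.1 * mkp z.2).coeff i

lemma mkp_coeff_hasFDerivAt {a : ℕ} (u : Fin a → ℂ) (k : ℕ) : HasFDerivAt (𝕜 := ℝ) (fun u => (mkp u).coeff k) (Lc a k) u := by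
  simp only [mkp_coeff]
  exact (Lc a k).hasFDerivAt.const_add _

lemma Gmap_smooth (a b : ℕ) : ContDiff ℝ ∞ (Gmap a b) := by
  rw [contDiff_pi]
  intro i
  simp only [Gmap, coeff_mul, mkp_coeff]
  apply ContDiff.sum
  intro x _
  exact (contDiff_const.add ((Lc a _).contDiff.comp contDiff_fst)).mul (contDiff_const.add ((Lc b _).contDiff.comp contDiff_snd))

lemma Gmap_fderiv (a b : ℕ) (z δ : (Fin a → ℂ) × (Fin b → ℂ)) (i : Fin (a + b)) :
    fderiv ℝ (Gmap a b) z δ i = (mkp z.1 * lin δ.2 + lin δ.1 * mkp z.2).coeff i := by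
  have h : HasFDerivAt (𝕜 := ℝ) (fun z => Gmap a b z i) ((ContinuousLinearMap.proj i).comp (fderiv ℝ (Gmap a b) z)) z :=
    (ContinuousLinearMap.hasFDerivAt (ContinuousLinearMap.proj (R := ℝ) (φ := fun _ : Fin (a+b) => ℂ) i)).comp z
      (((Gmap_smooth a b).differentiable (by simp)) z).hasFDerivAt
  have h2 : HasFDerivAt (𝕜 := ℝ) (fun z => Gmap a b z i) (∑ x ∈ Finset.HasAntidiagonal.antidiagonal (i:ℕ),
      ((mkp z.1).coeff x.1 • (Lc b x.2).comp (ContinuousLinearMap.snd ℝ _ _) + (mkp z.2).coeff x.2 • (Lc a x.1).comp (ContinuousLinearMap.fst ℝ _ _))) z := by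
    simp only [Gmap, coeff_mul]
    apply HasFDerivAt.fun_sum
    intro x _
    exact ((mkp_coeff_hasFDerivAt z.1 x.1).comp z hasFDerivAt_fst).mul ((mkp_coeff_hasFDerivAt z.2 x.2).comp z hasFDerivAt_snd)
  have h3 := congrArg (fun L => L δ) (h.unique h2)
  simp only [ContinuousLinearMap.comp_apply, ContinuousLinearMap.proj_apply] at h3
  rw [h3, coeff_add, coeff_mul, coeff_mul, ← Finset.sum_add_distrib, ContinuousLinearMap.sum_apply]
  apply Finset.sum_congr rfl
  intro x _
  simp [lin_coeff]
  ring

lemma lin_eq_zero {a : ℕ} {u : Fin a → ℂ} (h : lin u = 0) : u = 0 := by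
  ext i
  have := lin_coeff u i
  rw [h, Lc, dif_pos i.2] at this
  simpa using this.symm

lemma Gmap_inj {a b : ℕ} {z : (Fin a → ℂ) × (Fin b → ℂ)} (hz : IsCoprime (mkp z.1) (mkp z.2)) :
    Function.Injective (fderiv ℝ (Gmap a b) z) := by
  rw [injective_iff_map_eq_zero]
  intro δ h
  have h0 : mkp z.1 * lin δ.2 + lin δ.1 * mkp z.2 = 0 := by
    ext k
    by_cases hk : k < a + b
    · have := Gmap_fderiv a b z δ ⟨k, hk⟩
      rw [h] at this
      simpa using this.symm
    · rw [coeff_zero]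
      apply coeff_eq_zero_of_degree_lt
      have hm1 : (mkp z.1).degree = a := by rw [degree_eq_natDegree (mkp_monic _).ne_zero, mkp_natDegree]
      have hm2 : (mkp z.2).degree = b := by rw [degree_eq_natDegree (mkp_monic _).ne_zero, mkp_natDegree]
      have hle : ((a + b : ℕ) : WithBot ℕ) ≤ k := by exact_mod_cast (not_lt.1 hk)
      refine lt_of_lt_of_le ?_ hle
      refine lt_of_le_of_lt (degree_add_le _ _) (max_lt ?_ ?_)
      · rw [degree_mul, hm1]
        push_cast
        exact WithBot.add_lt_add_left (by simp) (lin_degree _)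
      · rw [degree_mul, hm2]
        push_cast
        exact WithBot.add_lt_add_right (by simp) (lin_degree _)
  have h1 : mkp z.1 ∣ lin δ.1 := by
    apply hz.dvd_of_dvd_mul_right
    exact ⟨-lin δ.2, by linear_combination h0⟩
  have h2 : mkp z.2 ∣ lin δ.2 := by
    apply hz.symm.dvd_of_dvd_mul_left
    exact ⟨-lin δ.1, by linear_combination h0⟩
  have e1 : lin δ.1 = 0 := eq_zero_of_dvd_of_degree_lt h1 (by
    rw [degree_eq_natDegree (mkp_monic _).ne_zero, mkp_natDegree]; exact lin_degree _)
  have e2 : lin δ.2 = 0 := eq_zero_of_dvd_of_degree_lt h2 (by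
    rw [degree_eq_natDegree (mkp_monic _).ne_zero, mkp_natDegree]; exact lin_degree _)
  exact Prod.ext (lin_eq_zero e1) (lin_eq_zero e2)

lemma SP_mkp {a : ℕ} {u : ℝ → Fin a → ℂ} (hu : ContDiff ℝ ∞ u) : SP a (fun t => mkp (u t)) :=
  ⟨fun t => mkp_monic _, fun t => mkp_natDegree _, fun i => by
    simp only [mkp_coeff]
    exact contDiff_const.add ((Lc a i).contDiff.comp hu)⟩

lemma hensel2 {a b : ℕ} {P : ℝ → ℂ[X]} (hP : SP (a + b) P) {p q : ℂ[X]} (hp : p.Monic) (hq : q.Monic)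
    (hpd : p.natDegree = a) (hqd : q.natDegree = b) (hc : IsCoprime p q) (h0 : P 0 = p * q) :
    ∃ p' q' : ℝ → ℂ[X], SP a p' ∧ SP b q' ∧ p' 0 = p ∧ q' 0 = q ∧ ∀ᶠ t in 𝓝 0, P t = p' t * q' t := by
  set z : (Fin a → ℂ) × (Fin b → ℂ) := (fun i => p.coeff i, fun i => q.coeff i) with hz
  have ep : p = mkp z.1 := eq_mkp hp hpd
  have eq : q = mkp z.2 := eq_mkp hq hqd
  have hinj : Function.Injective (fderiv ℝ (Gmap a b) z) := Gmap_inj (by rw [← ep, ← eq]; exact hc)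
  let L0 : ((Fin a → ℂ) × (Fin b → ℂ)) ≃ₗ[ℝ] (Fin (a+b) → ℂ) :=
    LinearEquiv.ofInjectiveOfFinrankEq (fderiv ℝ (Gmap a b) z).toLinearMap hinj (by
      simp [Module.finrank_prod, Module.finrank_pi_fintype]; ring)
  have hL : HasFDerivAt (Gmap a b) ((L0.toContinuousLinearEquiv : ((Fin a → ℂ) × (Fin b → ℂ)) →L[ℝ] (Fin (a+b) → ℂ))) z := by
    have h1 := (((Gmap_smooth a b).differentiable (by simp)) z).hasFDerivAt
    refine h1.congr_fderiv ?_
    exact ContinuousLinearMap.ext fun δ => rfl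
  obtain ⟨g, hg0, hgc, hg⟩ := smooth_ift (Gmap_smooth a b) z _ hL
  let co : ℝ → Fin (a+b) → ℂ := fun t i => (P t).coeff i
  have hco : ContDiff ℝ ∞ co := contDiff_pi.2 fun i => hP.smooth i
  have hco0 : co 0 = Gmap a b z := by
    ext i; simp only [co, Gmap, h0, ← ep, ← eq]
  have hten : Tendsto co (𝓝 0) (𝓝 (Gmap a b z)) := by rw [← hco0]; exact hco.continuous.tendsto 0
  have hev := hten.eventually hg
  obtain ⟨w, hw, hwg⟩ := globalize (f := fun t => g (co t)) (by
    filter_upwards [hev] with t ht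
    exact ht.2.comp t hco.contDiffAt)
  have hw0 : w 0 = z := by rw [hwg.self_of_nhds]; beta_reduce; rw [hco0, hg0]
  refine ⟨fun t => mkp (w t).1, fun t => mkp (w t).2, SP_mkp (contDiff_fst.comp hw), SP_mkp (contDiff_snd.comp hw),
    by simp only [hw0]; exact ep.symm, by simp only [hw0]; exact eq.symm, ?_⟩
  filter_upwards [hev, hwg] with t ht ht2
  have e1 : Gmap a b (w t) = co t := by rw [ht2]; exact ht.1
  have m1 : (mkp (w t).1 * mkp (w t).2).Monic := (mkp_monic _).mul (mkp_monic _)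
  have d1 : (mkp (w t).1 * mkp (w t).2).natDegree = a + b := by
    rw [(mkp_monic _).natDegree_mul (mkp_monic _), mkp_natDegree, mkp_natDegree]
  rw [eq_mkp m1 d1, eq_mkp (hP.monic t) (hP.deg t)]
  congr 1
  exact e1.symm

lemma SP.one : SP 0 (fun _ => 1) := ⟨fun _ => monic_one, fun _ => natDegree_one, fun _ => contDiff_const⟩

lemma SP.mul {a b : ℕ} {p q : ℝ → ℂ[X]} (hp : SP a p) (hq : SP b q) : SP (a + b) (fun t => p t * q t) :=
  ⟨fun t => (hp.monic t).mul (hq.monic t), fun t => by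
    rw [(hp.monic t).natDegree_mul (hq.monic t), hp.deg, hq.deg], fun i => by
    simp only [coeff_mul]
    exact ContDiff.sum fun x _ => (hp.smooth _).mul (hq.smooth _)⟩

lemma hensel (S : Finset ℂ) (m : ℂ → ℕ) : ∀ {P : ℝ → ℂ[X]} (_ : SP (∑ r ∈ S, m r) P) (_ : P 0 = ∏ r ∈ S, (X - C r) ^ m r),
    ∃ p : ℂ → ℝ → ℂ[X], (∀ r ∈ S, SP (m r) (p r)) ∧ (∀ r ∈ S, p r 0 = (X - C r) ^ m r) ∧ ∀ᶠ t in 𝓝 0, P t = ∏ r ∈ S, p r t := by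
  induction S using Finset.induction_on with
  | empty =>
    intro P hP h0
    refine ⟨fun _ _ => 1, by simp, by simp, ?_⟩
    filter_upwards with t
    simp only [Finset.prod_empty]
    exact (hP.monic t).natDegree_eq_zero.1 (by simpa using hP.deg t)
  | insert r S hr ih =>
    intro P hP h0
    rw [Finset.sum_insert hr] at hP
    rw [Finset.prod_insert hr] at h0
    have hmon : (∏ s ∈ S, (X - C s) ^ m s : ℂ[X]).Monic := monic_prod_of_monic _ _ fun s _ => (monic_X_sub_C s).pow _
    have hdeg : (∏ s ∈ S, (X - C s) ^ m s : ℂ[X]).natDegree = ∑ s ∈ S, m s := by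
      rw [natDegree_prod_of_monic _ _ fun s _ => (monic_X_sub_C s).pow _]
      simp
    obtain ⟨p', q', hp', hq', hp0, hq0, hev⟩ := hensel2 hP ((monic_X_sub_C r).pow _) hmon (by simp) hdeg (by
      apply IsCoprime.prod_right
      intro s hs
      apply IsCoprime.pow
      apply pairwise_coprime_X_sub_C (s := fun x : ℂ => x) Function.injective_id
      rintro rfl
      exact hr hs) h0
    obtain ⟨p, hp, hp0', hpe⟩ := ih hq' hq0
    have hne : ∀ s ∈ S, s ≠ r := fun s hs h => hr (h ▸ hs)
    refine ⟨fun s => if s = r then p' else p s, ?_, ?_, ?_⟩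
    · intro s hs
      rcases Finset.mem_insert.1 hs with rfl | hs
      · simpa using hp'
      · simpa [hne s hs] using hp s hs
    · intro s hs
      rcases Finset.mem_insert.1 hs with rfl | hs
      · simpa using hp0
      · simpa [hne s hs] using hp0' s hs
    · filter_upwards [hev, hpe] with t h1 h2
      rw [Finset.prod_insert hr, h1, h2]
      simp only [if_true]
      congr 1
      exact Finset.prod_congr rfl fun s hs => by simp [hne s hs]

end NP

namespace NP
open scoped ContDiff Topology
open Polynomial

lemma SP.comp_smooth {d : ℕ} {P : ℝ → ℂ[X]} (hP : SP d P) {f : ℝ → ℝ} (hf : ContDiff ℝ ∞ f) : SP d (fun t => P (f t)) :=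
  ⟨fun t => hP.monic _, fun t => hP.deg _, fun i => (hP.smooth i).comp hf⟩

lemma monic_scale {p : ℂ[X]} (hp : p.Monic) (s : ℂ) : (p.scaleRoots s).Monic := (monic_scaleRoots_iff s).2 hp

lemma SP.scale {d : ℕ} {P : ℝ → ℂ[X]} (hP : SP d P) (e : ℕ) : SP d (fun t => (P t).scaleRoots ((t:ℂ) ^ e)) :=
  ⟨fun t => monic_scale (hP.monic t) _, fun t => by rw [natDegree_scaleRoots, hP.deg], fun i => by
    simp only [coeff_scaleRoots, hP.deg]
    have : ContDiff ℝ ∞ (fun t : ℝ => (t:ℂ)) := Complex.ofRealCLM.contDiff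
    exact (hP.smooth i).mul ((this.pow e).pow _)⟩

lemma shift_coeff_smooth {a : ℝ → ℂ} (ha : ContDiff ℝ ∞ a) (j : ℕ) : ∀ i, ContDiff ℝ ∞ fun t => ((X + C (a t)) ^ j).coeff i := by
  induction j with
  | zero => intro i; simp only [pow_zero]; exact contDiff_const
  | succ j ih =>
    intro i
    simp only [pow_succ, coeff_mul]
    refine ContDiff.sum fun x _ => (ih _).mul ?_
    simp only [coeff_add, coeff_C]
    split_ifs
    · exact contDiff_const.add ha
    · exact contDiff_const

lemma SP.shift {d : ℕ} {P : ℝ → ℂ[X]} (hP : SP d P) {a : ℝ → ℂ} (ha : ContDiff ℝ ∞ a) :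
    SP d (fun t => (P t).comp (X + C (a t))) :=
  ⟨fun t => (hP.monic t).comp_X_add_C _, fun t => by rw [natDegree_comp, hP.deg]; simp, fun i => by
    simp only [comp, eval₂_eq_sum_range, hP.deg, finsetSum_coeff, coeff_C_mul]
    exact ContDiff.sum fun j _ => (hP.smooth j).mul (shift_coeff_smooth ha j i)⟩

structure Pure (m : ℕ) (p : ℝ → ℂ[X]) (c : ℝ → ℂ) : Prop where
  sp : SP m p
  smooth : ContDiff ℝ ∞ c
  close : ∀ N : ℕ, ∃ K : ℝ, ∀ᶠ t in 𝓝[>] (0:ℝ), ∀ z, (p t).IsRoot z → ‖z - c t‖ ≤ K * t ^ N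

def Split (P : ℝ → ℂ[X]) : Prop :=
  ∃ (k : ℕ) (m : Fin k → ℕ) (p : Fin k → ℝ → ℂ[X]) (c : Fin k → ℝ → ℂ),
    (∀ i, Pure (m i) (p i) (c i)) ∧ ∀ᶠ t in 𝓝[>] (0:ℝ), P t = ∏ i, p i t

lemma Split.congr {P Q : ℝ → ℂ[X]} (hP : Split P) (h : ∀ᶠ t in 𝓝[>] (0:ℝ), Q t = P t) : Split Q := by
  obtain ⟨k, m, p, c, h1, h2⟩ := hP
  exact ⟨k, m, p, c, h1, by filter_upwards [h, h2] with t a b; rw [a, b]⟩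

lemma Split.one : Split (fun _ => 1) := ⟨0, fun _ => 0, fun _ _ => 1, fun _ _ => 0, fun i => i.elim0, by simp⟩

lemma Split.mul {P Q : ℝ → ℂ[X]} (hP : Split P) (hQ : Split Q) : Split (fun t => P t * Q t) := by
  obtain ⟨k, m, p, c, h1, h2⟩ := hP
  obtain ⟨k', m', p', c', h1', h2'⟩ := hQ
  refine ⟨k + k', Fin.append m m', Fin.append p p', Fin.append c c', ?_, ?_⟩
  · intro i
    refine Fin.addCases (fun i => ?_) (fun i => ?_) i
    · simpa using h1 i
    · simpa using h1' i
  · filter_upwards [h2, h2'] with t a b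
    rw [Fin.prod_univ_add, a, b]
    simp

lemma Split.prod {ι : Type*} (S : Finset ι) (P : ι → ℝ → ℂ[X]) (h : ∀ i ∈ S, Split (P i)) : Split (fun t => ∏ i ∈ S, P i t) := by
  induction S using Finset.induction_on with
  | empty => simpa using Split.one
  | insert a S ha ih =>
    simp only [Finset.prod_insert ha]
    exact (h a (by simp)).mul (ih fun i hi => h i (Finset.mem_insert_of_mem hi))

lemma Pure.split {m : ℕ} {p : ℝ → ℂ[X]} {c : ℝ → ℂ} (h : Pure m p c) : Split p :=
  ⟨1, fun _ => m, fun _ => p, fun _ => c, fun _ => h, by simp⟩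

lemma tendsto_pow_right {k : ℕ} (hk : 0 < k) : Tendsto (fun t : ℝ => t ^ k) (𝓝[>] 0) (𝓝[>] 0) := by
  apply tendsto_nhdsWithin_of_tendsto_nhds_of_eventually_within
  · have : Continuous fun t : ℝ => t ^ k := by fun_prop
    have h := this.tendsto 0
    rw [zero_pow hk.ne'] at h
    exact h.mono_left nhdsWithin_le_nhds
  · filter_upwards [self_mem_nhdsWithin] with t ht
    exact pow_pos (mem_Ioi.1 ht) k

lemma ev_lt_one : ∀ᶠ t in 𝓝[>] (0:ℝ), 0 < t ∧ t < 1 := by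
  filter_upwards [Ioo_mem_nhdsGT (show (0:ℝ) < 1 by norm_num)] with t ht
  exact ht

lemma Pure.comp_pow {m : ℕ} {p : ℝ → ℂ[X]} {c : ℝ → ℂ} (h : Pure m p c) {k : ℕ} (hk : 0 < k) :
    Pure m (fun t => p (t ^ k)) (fun t => c (t ^ k)) := by
  refine ⟨h.sp.comp_smooth (contDiff_id.pow k), h.smooth.comp (contDiff_id.pow k), fun N => ?_⟩
  obtain ⟨K, hK⟩ := h.close N
  refine ⟨|K|, ?_⟩
  filter_upwards [(tendsto_pow_right hk).eventually hK, ev_lt_one] with t ht h01 z hz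
  refine (ht z hz).trans ?_
  rw [← pow_mul]
  have : t ^ (k * N) ≤ t ^ N := pow_le_pow_of_le_one h01.1.le h01.2.le (Nat.le_mul_of_pos_left N hk)
  have h0 : 0 ≤ t ^ (k * N) := pow_nonneg h01.1.le _
  calc K * t ^ (k * N) ≤ |K| * t ^ (k * N) := mul_le_mul_of_nonneg_right (le_abs_self K) h0
    _ ≤ _ := mul_le_mul_of_nonneg_left this (abs_nonneg K)

lemma Split.comp_pow {P : ℝ → ℂ[X]} (hP : Split P) {k : ℕ} (hk : 0 < k) : Split (fun t => P (t ^ k)) := by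
  obtain ⟨n, m, p, c, h1, h2⟩ := hP
  exact ⟨n, m, fun i t => p i (t ^ k), fun i t => c i (t ^ k), fun i => (h1 i).comp_pow hk, (tendsto_pow_right hk).eventually h2⟩

lemma Pure.scale {m : ℕ} {p : ℝ → ℂ[X]} {c : ℝ → ℂ} (h : Pure m p c) (e : ℕ) :
    Pure m (fun t => (p t).scaleRoots ((t:ℂ) ^ e)) (fun t => (t:ℂ) ^ e * c t) := by
  have : ContDiff ℝ ∞ (fun t : ℝ => (t:ℂ)) := Complex.ofRealCLM.contDiff
  refine ⟨h.sp.scale e, (this.pow e).mul h.smooth, fun N => ?_⟩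
  obtain ⟨K, hK⟩ := h.close N
  refine ⟨K, ?_⟩
  filter_upwards [hK, ev_lt_one] with t ht h01 z hz
  have hs : ((t:ℂ) ^ e) ≠ 0 := pow_ne_zero _ (by exact_mod_cast h01.1.ne')
  have hroot : (p t).IsRoot (((t:ℂ) ^ e)⁻¹ * z) := by
    have := scaleRoots_eval₂_mul (p := p t) (RingHom.id ℂ) (((t:ℂ) ^ e)⁻¹ * z) ((t:ℂ)^e)
    simp only [RingHom.id_apply, mul_inv_cancel_left₀ hs] at this
    rw [IsRoot.def] at hz ⊢
    rw [eval₂_id, eval₂_id, hz] at this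
    exact (mul_eq_zero.1 this.symm).resolve_left (pow_ne_zero _ hs)
  have h1 := ht _ hroot
  have h2 : z - (t:ℂ)^e * c t = (t:ℂ)^e * (((t:ℂ) ^ e)⁻¹ * z - c t) := by
    rw [mul_sub, mul_inv_cancel_left₀ hs]
  rw [h2, norm_mul]
  have h3 : ‖(t:ℂ)^e‖ ≤ 1 := by
    rw [norm_pow, Complex.norm_real, Real.norm_eq_abs, abs_of_pos h01.1]
    exact pow_le_one₀ h01.1.le h01.2.le
  calc _ ≤ 1 * ‖((t:ℂ) ^ e)⁻¹ * z - c t‖ := mul_le_mul_of_nonneg_right h3 (norm_nonneg _)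
    _ ≤ _ := by rw [one_mul]; exact h1

lemma scaleRoots_prod {ι : Type*} (S : Finset ι) (p : ι → ℂ[X]) (s : ℂ) : (∏ i ∈ S, p i).scaleRoots s = ∏ i ∈ S, (p i).scaleRoots s := by
  induction S using Finset.induction_on with
  | empty => simp
  | insert a S ha ih => rw [Finset.prod_insert ha, Finset.prod_insert ha, mul_scaleRoots_of_noZeroDivisors, ih]

lemma Split.scale {P : ℝ → ℂ[X]} (hP : Split P) (e : ℕ) : Split (fun t => (P t).scaleRoots ((t:ℂ) ^ e)) := by
  obtain ⟨n, m, p, c, h1, h2⟩ := hP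
  refine ⟨n, m, fun i t => (p i t).scaleRoots ((t:ℂ) ^ e), fun i t => (t:ℂ) ^ e * c i t, fun i => (h1 i).scale e, ?_⟩
  filter_upwards [h2] with t ht
  rw [ht, scaleRoots_prod]

lemma Pure.shift {m : ℕ} {p : ℝ → ℂ[X]} {c : ℝ → ℂ} (h : Pure m p c) {a : ℝ → ℂ} (ha : ContDiff ℝ ∞ a) :
    Pure m (fun t => (p t).comp (X + C (a t))) (fun t => c t - a t) := by
  refine ⟨h.sp.shift ha, h.smooth.sub ha, fun N => ?_⟩
  obtain ⟨K, hK⟩ := h.close N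
  refine ⟨K, ?_⟩
  filter_upwards [hK] with t ht z hz
  have : (p t).IsRoot (z + a t) := by simpa [IsRoot.def, eval_comp] using hz
  have := ht _ this
  rwa [show z - (c t - a t) = z + a t - c t by ring]

lemma Split.shift {P : ℝ → ℂ[X]} (hP : Split P) {a : ℝ → ℂ} (ha : ContDiff ℝ ∞ a) : Split (fun t => (P t).comp (X + C (a t))) := by
  obtain ⟨n, m, p, c, h1, h2⟩ := hP
  refine ⟨n, m, fun i t => (p i t).comp (X + C (a t)), fun i t => c i t - a t, fun i => (h1 i).shift ha, ?_⟩
  filter_upwards [h2] with t ht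
  rw [ht, prod_comp]

/-- root bound -/
lemma root_bound {d : ℕ} {p : ℂ[X]} (hp : p.Monic) (hd : p.natDegree = d) {ρ : ℝ} (hρ : 0 ≤ ρ)
    (h : ∀ j < d, ‖p.coeff j‖ ≤ ρ ^ (d - j)) {z : ℂ} (hz : p.IsRoot z) : ‖z‖ ≤ 2 * ρ := by
  by_contra! hlt
  have hz0 : 0 < ‖z‖ := by linarith
  have h1 : z ^ d = - ∑ j ∈ Finset.range d, p.coeff j * z ^ j := by
    have := hz
    rw [IsRoot.def, eval_eq_sum_range, hd, Finset.sum_range_succ, ← hd, hp.coeff_natDegree, hd, one_mul] at this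
    linear_combination this
  have h2 : ‖z‖ ^ d ≤ ∑ j ∈ Finset.range d, ‖z‖ ^ d * (1/2) ^ (d - j) := by
    rw [← norm_pow]
    conv_lhs => rw [h1, norm_neg]
    refine (norm_sum_le _ _).trans (Finset.sum_le_sum fun j hj => ?_)
    have hj := Finset.mem_range.1 hj
    rw [norm_mul, norm_pow, norm_pow]
    calc ‖p.coeff j‖ * ‖z‖ ^ j ≤ ρ ^ (d - j) * ‖z‖ ^ j := by gcongr; exact h j hj
      _ ≤ (‖z‖ * (1/2)) ^ (d - j) * ‖z‖ ^ j := by gcongr; linarith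
      _ = ‖z‖ ^ d * (1/2) ^ (d - j) := by
        rw [mul_pow]
        nth_rewrite 3 [← Nat.sub_add_cancel hj.le]
        rw [pow_add]; ring
  rw [← Finset.mul_sum] at h2
  have h3 : ∑ j ∈ Finset.range d, ((1:ℝ)/2) ^ (d - j) < 1 := by
    have : ∀ d : ℕ, ∑ j ∈ Finset.range d, ((1:ℝ)/2) ^ (d - j) = 1 - (1/2)^d := by
      intro d
      induction d with
      | zero => simp
      | succ d ih =>
        rw [Finset.sum_range_succ', ]
        simp only [Nat.add_sub_add_right, ih, Nat.sub_zero]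
        rw [pow_succ]; ring
    rw [this]
    have : (0:ℝ) < (1/2)^d := by positivity
    linarith
  have : 0 < ‖z‖ ^ d := by positivity
  nlinarith

end NP

namespace NP
open scoped ContDiff Topology
open Polynomial

lemma mult_orbit {d q : ℕ} {φ : ℂ[X]} (hφ : φ.Monic) (hd : φ.natDegree = d) (hq : 0 < q)
    (hdiv : ∀ j, φ.coeff j ≠ 0 → q ∣ d - j) {r : ℂ} (hr : r ≠ 0) : q * φ.rootMultiplicity r ≤ d := by
  set ζ := Complex.exp (2 * Real.pi * Complex.I / q) with hζ
  have hp : IsPrimitiveRoot ζ q := Complex.isPrimitiveRoot_exp q hq.ne'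
  have hζ0 : ζ ≠ 0 := hp.ne_zero hq.ne'
  have hsc : φ.scaleRoots ζ = φ := by
    ext j
    rw [coeff_scaleRoots, hd]
    by_cases h : φ.coeff j = 0
    · simp [h]
    · obtain ⟨e, he⟩ := hdiv j h
      rw [he, pow_mul, hp.pow_eq_one, one_pow, mul_one]
  have hm : ∀ k : ℕ, φ.rootMultiplicity (ζ ^ k * r) = φ.rootMultiplicity r := by
    intro k
    induction k with
    | zero => simp
    | succ k ih =>
      rw [← ih, pow_succ', mul_assoc]
      nth_rewrite 1 [← hsc]
      exact rootMultiplicity_scaleRoots φ (IsLeftCancelMulZero.mul_left_cancel_of_ne_zero hζ0)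
  let T := (Finset.range q).image fun k => ζ ^ k * r
  have hT : T.card = q := by
    rw [Finset.card_image_of_injOn, Finset.card_range]
    intro i hi j hj hij
    have : ζ ^ i = ζ ^ j := mul_right_cancel₀ hr hij
    exact hp.pow_inj (by simpa using hi) (by simpa using hj) this
  have h1 : ∑ s ∈ T, φ.roots.count s = q * φ.rootMultiplicity r := by
    rw [Finset.sum_congr rfl (g := fun _ => φ.rootMultiplicity r), Finset.sum_const, hT, smul_eq_mul]
    intro s hs
    obtain ⟨k, -, rfl⟩ := Finset.mem_image.1 hs
    rw [count_roots, hm]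
  rw [← h1]
  calc ∑ s ∈ T, φ.roots.count s ≤ ∑ s ∈ T ∪ φ.roots.toFinset, φ.roots.count s :=
        Finset.sum_le_sum_of_subset Finset.subset_union_left
    _ = φ.roots.card := Multiset.sum_count_eq_card fun a ha => Finset.mem_union_right _ (Multiset.mem_toFinset.2 ha)
    _ ≤ d := by rw [← hd]; exact card_roots' φ

lemma mult_bound {d q j0 : ℕ} {φ : ℂ[X]} (hφ : φ.Monic) (hd : φ.natDegree = d) (hq : 0 < q)
    (hdiv : ∀ j, φ.coeff j ≠ 0 → q ∣ d - j) (hj0 : j0 + q ≤ d) (hc : φ.coeff j0 ≠ 0) (htr : φ.coeff (d - 1) = 0)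
    {r : ℂ} (hr : φ.IsRoot r) : φ.rootMultiplicity r < d ∧ q * (φ.rootMultiplicity r).factorial ∣ d.factorial := by
  have hm1 : 0 < φ.rootMultiplicity r := (rootMultiplicity_pos hφ.ne_zero).2 hr
  by_cases hr0 : r = 0
  · subst hr0
    have hle : φ.rootMultiplicity 0 ≤ j0 := by
      by_contra! hlt
      have := pow_rootMultiplicity_dvd φ 0
      rw [C_0, sub_zero, X_pow_dvd_iff] at this
      exact hc (this j0 hlt)
    refine ⟨by omega, ?_⟩
    set m := φ.rootMultiplicity 0
    have h1 : m.factorial * (d - m).factorial ∣ d.factorial := Nat.factorial_mul_factorial_dvd_factorial (by omega)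
    refine dvd_trans ?_ h1
    rw [mul_comm]
    exact mul_dvd_mul_left _ (Nat.dvd_factorial hq (by omega))
  · have ho := mult_orbit hφ hd hq hdiv hr0
    set m := φ.rootMultiplicity r with hm
    have hmd : m < d := by
      rcases Nat.lt_or_ge 1 q with h | h
      · nlinarith
      · by_contra! hge
        have hmd : m = d := by
          apply le_antisymm _ hge
          have := hq; nlinarith
        have h1 : (X - C r) ^ d ∣ φ := by rw [← hmd]; exact pow_rootMultiplicity_dvd φ r
        have h2 : (X - C r) ^ d = φ := (eq_of_monic_of_dvd_of_natDegree_le ((monic_X_sub_C r).pow d) hφ h1 (by rw [hd]; simp)).symm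
        rw [← h2, sub_eq_add_neg, ← C_neg, coeff_X_add_C_pow] at htr
        have hd1 : d - (d - 1) = 1 := by omega
        rw [hd1, pow_one] at htr
        have hch : d.choose (d - 1) = d := by
          obtain ⟨e, rfl⟩ : ∃ e, d = e + 1 := ⟨d - 1, by omega⟩
          simp
        rw [hch] at htr
        rcases mul_eq_zero.1 htr with h | h
        · exact hr0 (by simpa using h)
        · have : d = 0 := by exact_mod_cast h
          omega
    refine ⟨hmd, ?_⟩
    rcases Nat.lt_or_ge 1 q with h | h
    · have h3 : m < q * m := by nlinarith
      obtain ⟨e, he⟩ : ∃ e, q * m = e + 1 := ⟨q * m - 1, by omega⟩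
      refine dvd_trans ?_ (Nat.factorial_dvd_factorial ho)
      rw [he, Nat.factorial_succ, ← he]
      exact mul_dvd_mul (Dvd.intro _ rfl) (Nat.factorial_dvd_factorial (by omega))
    · have : q = 1 := by omega
      rw [this, one_mul]
      exact Nat.factorial_dvd_factorial hmd.le

/-- all lower coefficients flat: pure with centre `0` -/
lemma pure_of_flat {d : ℕ} {P : ℝ → ℂ[X]} (hP : SP d P) (hfl : ∀ j < d, Flat fun t => (P t).coeff j) : Pure d P (fun _ => 0) := by
  refine ⟨hP, contDiff_const, fun N => ?_⟩
  have : ∀ j : Fin d, ∃ K : ℝ, ∀ᶠ t in 𝓝[>] (0:ℝ), ‖(P t).coeff j‖ ≤ K * t ^ (N * d) := by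
    intro j
    obtain ⟨K, hK⟩ := ((hfl j j.2).isBigO (N * d)).bound
    refine ⟨K, ?_⟩
    filter_upwards [hK.filter_mono nhdsWithin_le_nhds, ev_lt_one] with t h1 h2
    rwa [norm_pow, Real.norm_eq_abs, abs_of_pos h2.1] at h1
  choose K hK using this
  set L : ℝ := 1 + ∑ j, |K j| with hL
  have hL1 : 1 ≤ L := by
    have : 0 ≤ ∑ j, |K j| := Finset.sum_nonneg fun _ _ => abs_nonneg _
    linarith
  refine ⟨2 * L, ?_⟩
  filter_upwards [eventually_all.2 hK, ev_lt_one] with t h1 h2 z hz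
  rw [sub_zero, mul_assoc]
  have ht0 := h2.1.le
  refine root_bound (hP.monic t) (hP.deg t) (by positivity) ?_ hz
  intro j hj
  have hKL : K ⟨j, hj⟩ ≤ L := by
    have := Finset.single_le_sum (f := fun j => |K j|) (fun i _ => abs_nonneg _) (Finset.mem_univ ⟨j, hj⟩)
    have := le_abs_self (K ⟨j, hj⟩)
    linarith
  calc ‖(P t).coeff j‖ ≤ K ⟨j, hj⟩ * t ^ (N * d) := h1 ⟨j, hj⟩
    _ ≤ L * t ^ (N * d) := by gcongr
    _ ≤ L ^ (d - j) * (t ^ N) ^ (d - j) := by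
      rw [← pow_mul]
      apply mul_le_mul _ _ (by positivity) (by positivity)
      · exact le_self_pow₀ hL1 (by omega)
      · exact pow_le_pow_of_le_one ht0 h2.2.le (Nat.mul_le_mul_left N (by omega))
    _ = (L * t ^ N) ^ (d - j) := by rw [mul_pow]

lemma sp_of_coeffs {d : ℕ} (b : ℕ → ℝ → ℂ) (hb : ∀ j, ContDiff ℝ ∞ (b j)) :
    ∃ P : ℝ → ℂ[X], SP d P ∧ ∀ t, ∀ j < d, (P t).coeff j = b j t := by
  refine ⟨fun t => mkp (fun i : Fin d => b i t), SP_mkp (contDiff_pi.2 fun i => hb i), fun t j hj => ?_⟩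
  rw [mkp_coeff, Lc, dif_pos hj, coeff_X_pow, if_neg hj.ne]
  simp

/-- Newton rescaling step. -/
lemma newton_step {d : ℕ} {P : ℝ → ℂ[X]} (hP : SP d P) (htr : ∀ t, (P t).coeff (d - 1) = 0)
    (hnf : ∃ j < d, ¬ Flat fun t => (P t).coeff j) :
    ∃ (p q j0 : ℕ) (Q : ℝ → ℂ[X]), 0 < q ∧ j0 + q ≤ d ∧ SP d Q ∧ (∀ t, P (t ^ q) = (Q t).scaleRoots ((t:ℂ) ^ p)) ∧
      (∀ j, (Q 0).coeff j ≠ 0 → q ∣ d - j) ∧ (Q 0).coeff j0 ≠ 0 ∧ (Q 0).coeff (d - 1) = 0 := by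
  have hex : ∀ j, ∃ (o : ℕ) (b : ℝ → ℂ), (¬ Flat fun t => (P t).coeff j) → (ContDiff ℝ ∞ b ∧ b 0 ≠ 0 ∧ ∀ t, (P t).coeff j = t ^ o • b t) := by
    intro j
    rcases flat_or (hP.smooth j) with h | ⟨o, b, h⟩
    · exact ⟨0, fun _ => 0, fun h' => absurd h h'⟩
    · exact ⟨o, b, fun _ => h⟩
  choose o b hob using hex
  obtain ⟨j0, hj0m, hmin⟩ := Finset.exists_min_image ((Finset.range d).filter fun j => ¬ Flat fun t => (P t).coeff j)
    (fun j => (o j : ℚ) / ((d - j : ℕ) : ℚ)) (by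
      obtain ⟨j, h1, h2⟩ := hnf
      exact ⟨j, by simp [h1, h2]⟩)
  rw [Finset.mem_filter, Finset.mem_range] at hj0m
  obtain ⟨hj0, hj0f⟩ := hj0m
  set g := Nat.gcd (o j0) (d - j0) with hg
  have hgpos : 0 < g := Nat.gcd_pos_of_pos_right _ (by omega)
  obtain ⟨p, hp⟩ : g ∣ o j0 := Nat.gcd_dvd_left _ _
  obtain ⟨q, hq⟩ : g ∣ d - j0 := Nat.gcd_dvd_right _ _
  have hcop : Nat.Coprime p q := by
    have h := Nat.coprime_div_gcd_div_gcd (m := o j0) (n := d - j0) hgpos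
    rw [← hg, hp, hq, Nat.mul_div_cancel_left _ hgpos, Nat.mul_div_cancel_left _ hgpos] at h
    exact h
  have hqpos : 0 < q := by
    rcases Nat.eq_zero_or_pos q with h | h
    · rw [h] at hq; omega
    · exact h
  have hqle : q ≤ d - j0 := by rw [hq]; exact Nat.le_mul_of_pos_left q hgpos
  have hslope : ∀ j < d, (¬ Flat fun t => (P t).coeff j) → p * (d - j) ≤ q * o j := by
    intro j hj hjf
    have h := hmin j (by simp [hj, hjf])
    have h1 : (0:ℚ) < ((d - j : ℕ) : ℚ) := by exact_mod_cast (by omega : 0 < d - j)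
    have h2 : (0:ℚ) < ((d - j0 : ℕ) : ℚ) := by exact_mod_cast (by omega : 0 < d - j0)
    rw [div_le_div_iff₀ h2 h1] at h
    have h3 : o j0 * (d - j) ≤ o j * (d - j0) := by exact_mod_cast h
    rw [hp, hq] at h3
    apply Nat.le_of_mul_le_mul_left _ hgpos
    calc g * (p * (d - j)) = g * p * (d - j) := by ring
      _ ≤ o j * (g * q) := h3
      _ = _ := by ring
  -- new coefficients
  have hB : ∀ j, ∃ B : ℝ → ℂ, ContDiff ℝ ∞ B ∧ (j < d → (∀ t, (P (t ^ q)).coeff j = t ^ (p * (d - j)) • B t) ∧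
      (B 0 ≠ 0 → q ∣ d - j) ∧ (j = j0 → B 0 ≠ 0)) := by
    intro j
    by_cases hj : j < d
    swap
    · exact ⟨fun _ => 0, contDiff_const, fun h => absurd h hj⟩
    by_cases hjf : Flat fun t => (P t).coeff j
    · obtain ⟨B, hB, hBf, hBe⟩ := hjf.div (p * (d - j))
      have e : ∀ t : ℝ, t ^ (q * (p * (d - j))) = t ^ (p * (d - j)) * t ^ ((q - 1) * (p * (d - j))) := by
        intro t
        rw [← pow_add]; congr 1
        obtain ⟨q', rfl⟩ : ∃ q', q = q' + 1 := ⟨q - 1, by omega⟩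
        simp only [Nat.add_sub_cancel]; ring
      refine ⟨fun t => t ^ ((q - 1) * (p * (d - j))) • B (t ^ q), ?_, fun _ => ⟨fun t => ?_, fun h => ?_, fun h => ?_⟩⟩
      · exact (contDiff_id.pow _).smul (hB.comp (contDiff_id.pow _))
      · beta_reduce
        rw [hBe (t ^ q), ← pow_mul, e, mul_smul]
      · exfalso; apply h; beta_reduce; rw [zero_pow hqpos.ne', hBf.zero, smul_zero]
      · subst h; exact absurd hjf hj0f
    · obtain ⟨h1, h2, h3⟩ := hob j hjf
      have hs := hslope j hj hjf
      refine ⟨fun t => t ^ (q * o j - p * (d - j)) • b j (t ^ q), (contDiff_id.pow _).smul (h1.comp (contDiff_id.pow _)),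
        fun _ => ⟨fun t => ?_, fun h => ?_, fun h => ?_⟩⟩
      · beta_reduce
        rw [h3, ← pow_mul, smul_smul, ← pow_add, Nat.add_sub_cancel' hs]
      · beta_reduce at h
        have he : q * o j = p * (d - j) := by
          by_contra hne
          rw [zero_pow (by omega), zero_smul] at h
          exact h rfl
        exact hcop.symm.dvd_of_dvd_mul_left (Dvd.intro _ he)
      · beta_reduce
        have he : q * o j - p * (d - j) = 0 := by
          rw [h, hp, hq, show q * (g * p) = p * (g * q) by ring, Nat.sub_self]
        rw [he, pow_zero, one_smul, zero_pow hqpos.ne']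
        exact h2
  choose B hBs hB using hB
  obtain ⟨Q, hQ, hQc⟩ := sp_of_coeffs (d := d) B hBs
  refine ⟨p, q, j0, Q, hqpos, by omega, hQ, ?_, ?_, ?_, ?_⟩
  · intro t
    ext j
    rw [coeff_scaleRoots, hQ.deg]
    rcases lt_trichotomy j d with h | h | h
    · rw [(hB j h).1, hQc t j h, Complex.real_smul]
      push_cast
      rw [pow_mul]; ring
    · subst h
      have h1 := (hP.monic (t ^ q)).coeff_natDegree
      have h2 := (hQ.monic t).coeff_natDegree
      rw [hP.deg] at h1
      rw [hQ.deg] at h2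
      rw [h1, h2]; simp
    · rw [coeff_eq_zero_of_natDegree_lt (by rw [hP.deg]; exact h), coeff_eq_zero_of_natDegree_lt (by rw [hQ.deg]; exact h), zero_mul]
  · intro j hj
    by_cases h : j < d
    · rw [hQc 0 j h] at hj
      exact (hB j h).2.1 hj
    · rw [Nat.sub_eq_zero_of_le (by omega)]; exact dvd_zero q
  · rw [hQc 0 j0 hj0]; exact (hB j0 hj0).2.2 rfl
  · rw [hQc 0 _ (by omega)]
    have h1 := (hB (d - 1) (by omega)).1
    simp only [htr] at h1
    have : B (d - 1) = fun _ => 0 := by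
      apply smul_pow_cancel (N := p * (d - (d - 1))) (hBs _).continuous continuous_const
      intro t; rw [← h1]; simp
    rw [this]

theorem puiseux (d : ℕ) : ∀ {P : ℝ → ℂ[X]} (_ : SP d P), Split (fun t => P (t ^ d.factorial)) := by
  induction d using Nat.strong_induction_on with
  | _ d ih =>
  -- reduced case
  have key : ∀ {P : ℝ → ℂ[X]} (_ : SP d P) (_ : ∀ t, (P t).coeff (d - 1) = 0) (_ : 0 < d), Split (fun t => P (t ^ d.factorial)) := by
    intro P hP htr hd
    by_cases hfl : ∀ j < d, Flat fun t => (P t).coeff j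
    · exact (pure_of_flat hP hfl).split.comp_pow (Nat.factorial_pos d)
    push Not at hfl
    obtain ⟨p, q, j0, Q, hq, hj0, hQ, hPQ, hdiv, hcj, hct⟩ := newton_step hP htr hfl
    set φ := Q 0 with hφ
    have hφm : φ.Monic := hQ.monic 0
    have hφd : φ.natDegree = d := hQ.deg 0
    have hsplit : φ.Splits := IsAlgClosed.splits φ
    have hprod : φ = ∏ r ∈ φ.roots.toFinset, (X - C r) ^ φ.rootMultiplicity r := by
      conv_lhs => rw [hsplit.eq_prod_roots_of_monic hφm]
      rw [Finset.prod_multiset_map_count]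
      exact Finset.prod_congr rfl fun r _ => by rw [count_roots]
    have hsum : ∑ r ∈ φ.roots.toFinset, φ.rootMultiplicity r = d := by
      have := congrArg natDegree hprod
      rw [hφd, natDegree_prod_of_monic _ _ fun s _ => (monic_X_sub_C s).pow _] at this
      simpa using this.symm
    obtain ⟨f, hf, hf0, hfe⟩ := hensel φ.roots.toFinset (fun r => φ.rootMultiplicity r) (P := Q) (by rw [hsum]; exact hQ) hprod
    have hqd : q ∣ d.factorial := Nat.dvd_factorial hq (by omega)
    obtain ⟨K, hK⟩ := hqd
    have hKpos : 0 < K := by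
      rcases Nat.eq_zero_or_pos K with h | h
      · rw [h] at hK; exact absurd hK (Nat.factorial_ne_zero d)
      · exact h
    have hs1 : Split (fun t => Q (t ^ K)) := by
      have h1 : ∀ r ∈ φ.roots.toFinset, Split (fun t => f r (t ^ K)) := by
        intro r hr
        have hroot : φ.IsRoot r := isRoot_of_mem_roots (Multiset.mem_toFinset.1 hr)
        obtain ⟨hlt, hdv⟩ := mult_bound hφm hφd hq hdiv hj0 hcj hct hroot
        obtain ⟨e, he⟩ := hdv
        have hKe : K = e * (φ.rootMultiplicity r).factorial := by
          apply Nat.eq_of_mul_eq_mul_left hq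
          rw [← hK, he]; ring
        have hepos : 0 < e := by
          rcases Nat.eq_zero_or_pos e with h | h
          · rw [h] at he; exact absurd he (Nat.factorial_ne_zero d)
          · exact h
        have := (ih _ hlt (hf r hr)).comp_pow hepos
        simpa only [← pow_mul, ← hKe] using this
      refine (Split.prod _ _ h1).congr ?_
      exact (tendsto_pow_right hKpos).eventually (hfe.filter_mono nhdsWithin_le_nhds)
    have hs2 := hs1.scale (K * p)
    refine hs2.congr ?_
    filter_upwards with t
    rw [hK, mul_comm, pow_mul, hPQ]
    push_cast
    rw [← pow_mul]
  intro P hP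
  rcases Nat.eq_zero_or_pos d with hd | hd
  · subst hd
    refine Split.one.congr ?_
    filter_upwards with t
    exact (hP.monic _).natDegree_eq_zero.1 (hP.deg _)
  · let a : ℝ → ℂ := fun t => -((P t).coeff (d - 1) / d)
    have ha : ContDiff ℝ ∞ a := ((hP.smooth _).div_const _).neg
    have hP' := hP.shift ha
    have htr : ∀ t, ((P t).comp (X + C (a t))).coeff (d - 1) = 0 := by
      intro t
      obtain ⟨e, rfl⟩ : ∃ e, d = e + 1 := ⟨d - 1, by omega⟩
      have hm := (hP.monic t).coeff_natDegree
      rw [hP.deg] at hm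
      simp only [Nat.add_sub_cancel]
      rw [comp, eval₂_eq_sum_range, hP.deg, finsetSum_coeff, Finset.sum_range_succ, Finset.sum_range_succ, Finset.sum_eq_zero]
      · simp only [coeff_C_mul, coeff_X_add_C_pow, hm, a]
        have : ((e + 1 : ℕ) : ℂ) ≠ 0 := by exact_mod_cast Nat.succ_ne_zero e
        simp only [Nat.choose_self, Nat.sub_self, Nat.add_sub_cancel_left, Nat.choose_succ_self_right, pow_one, pow_zero, Nat.add_sub_cancel]
        field_simp
        push_cast
        ring
      · intro j hj
        rw [coeff_C_mul, coeff_X_add_C_pow, Nat.choose_eq_zero_of_lt (by simpa using hj)]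
        simp
    have h1 := key hP' htr hd
    have ha' : ContDiff ℝ ∞ (fun t : ℝ => - a (t ^ d.factorial)) := (ha.comp (contDiff_id.pow _)).neg
    refine (h1.shift ha').congr ?_
    filter_upwards with t
    rw [comp_assoc]
    simp

end NP

namespace NP
open scoped ContDiff Topology
open Polynomial

/-- discrete chain lemma on the line -/
lemma chain_real {d : ℕ} (r : Fin d → ℝ) (x : ℕ → ℝ) {ω' : ℝ} (hω : 0 ≤ ω') {k l : ℕ} (hkl : k ≤ l)
    (hstep : ∀ i, k ≤ i → i < l → |x (i+1) - x i| ≤ ω') (hnear : ∀ i, k ≤ i → i ≤ l → ∃ j, |x i - r j| ≤ ω') :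
    x l - x k ≤ 4 * d * ω' := by
  by_cases hlt : x l ≤ x k
  · have : 0 ≤ 4 * d * ω' := by positivity
    linarith
  push Not at hlt
  have hcov : Icc (x k) (x l) ⊆ ⋃ j, Icc (r j - 2 * ω') (r j + 2 * ω') := by
    intro y hy
    -- first index with y ≤ x i
    have hex : ∃ i, k ≤ i ∧ i ≤ l ∧ |y - x i| ≤ ω' := by
      have hP : ∃ i, k ≤ i ∧ y ≤ x i := ⟨l, hkl, hy.2⟩
      obtain ⟨h1, h2⟩ := Nat.find_spec hP
      set i := Nat.find hP with hi
      have hil : i ≤ l := Nat.find_min' hP ⟨hkl, hy.2⟩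
      rcases Nat.eq_or_lt_of_le h1 with h | h
      · refine ⟨i, h1, hil, ?_⟩
        rw [← h] at h2 ⊢
        have : y = x k := le_antisymm h2 hy.1
        rw [this]; simpa using hω
      · obtain ⟨i', hi'⟩ : ∃ i', i = i' + 1 := ⟨i - 1, by omega⟩
        have hm := Nat.find_min hP (m := i') (by omega)
        push Not at hm
        have hm := hm (by omega)
        refine ⟨i, h1, hil, ?_⟩
        have hs := hstep i' (by omega) (by omega)
        rw [← hi'] at hs
        rw [abs_le] at hs ⊢
        constructor <;> linarith
    obtain ⟨i, h1, h2, h3⟩ := hex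
    obtain ⟨j, hj⟩ := hnear i h1 h2
    rw [mem_iUnion]
    refine ⟨j, ?_⟩
    rw [abs_le] at h3 hj
    constructor <;> linarith
  have hm := MeasureTheory.measure_mono (μ := MeasureTheory.volume) hcov
  have hm2 := hm.trans (MeasureTheory.measure_iUnion_le _)
  simp only [Real.volume_Icc, tsum_fintype] at hm2
  have h4 : ∀ j, r j + 2 * ω' - (r j - 2 * ω') = 4 * ω' := fun j => by ring
  simp only [h4, Finset.sum_const, Finset.card_univ, Fintype.card_fin] at hm2
  rw [← ENNReal.ofReal_nsmul, ENNReal.ofReal_le_ofReal_iff (by positivity)] at hm2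
  rw [nsmul_eq_mul] at hm2
  linarith

lemma chain_complex {d : ℕ} (r : Fin d → ℂ) (x : ℕ → ℂ) {ω' : ℝ} (hω : 0 ≤ ω') {k l : ℕ} (hkl : k ≤ l)
    (hstep : ∀ i, k ≤ i → i < l → ‖x (i+1) - x i‖ ≤ ω') (hnear : ∀ i, k ≤ i → i ≤ l → ∃ j, ‖x i - r j‖ ≤ ω') :
    ‖x l - x k‖ ≤ 8 * d * ω' := by
  have gen : ∀ f : ℂ → ℝ, (∀ a b, f (a - b) = f a - f b) → (∀ a, |f a| ≤ ‖a‖) → f (x l) - f (x k) ≤ 4 * d * ω' := by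
    intro f h1 h2
    apply chain_real (fun j => f (r j)) (fun i => f (x i)) hω hkl
    · intro i a b; rw [← h1]; exact (h2 _).trans (hstep i a b)
    · intro i a b
      obtain ⟨j, hj⟩ := hnear i a b
      exact ⟨j, by rw [← h1]; exact (h2 _).trans hj⟩
  have a1 := gen Complex.re (by simp) Complex.abs_re_le_norm
  have a2 := gen (fun z => - z.re) (by intro a b; simp; ring) (fun a => by rw [abs_neg]; exact Complex.abs_re_le_norm a)
  have a3 := gen Complex.im (by simp) Complex.abs_im_le_norm
  have a4 := gen (fun z => - z.im) (by intro a b; simp; ring) (fun a => by rw [abs_neg]; exact Complex.abs_im_le_norm a)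
  refine (Complex.norm_le_abs_re_add_abs_im _).trans ?_
  have b1 : |(x l - x k).re| ≤ 4 * d * ω' := by rw [abs_le, Complex.sub_re]; constructor <;> linarith
  have b2 : |(x l - x k).im| ≤ 4 * d * ω' := by rw [abs_le, Complex.sub_im]; constructor <;> linarith
  linarith

/-- enumerated roots over the unit interval -/
def KS {d : ℕ} (P : ℝ → ℂ[X]) : Set (ℝ × (Fin d → ℂ)) := {u | u.1 ∈ Icc (0:ℝ) 1 ∧ P u.1 = ∏ j, (X - C (u.2 j))}

lemma poly_cont {d : ℕ} {P : ℝ → ℂ[X]} (hP : SP d P) (y : ℂ) : Continuous fun t => (P t).eval y := by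
  simp only [eval_eq_sum_range, hP.deg]
  exact continuous_finsetSum _ fun i _ => ((hP.smooth i).continuous).mul continuous_const

lemma KS_closed {d : ℕ} {P : ℝ → ℂ[X]} (hP : SP d P) : IsClosed (KS (d := d) P) := by
  have : KS (d := d) P = {u | u.1 ∈ Icc (0:ℝ) 1} ∩ ⋂ y : ℂ, {u | (P u.1).eval y = ∏ j, (y - u.2 j)} := by
    ext u
    simp only [KS, Set.mem_ofPred_eq, mem_inter_iff, mem_iInter]
    refine and_congr_right fun _ => ⟨fun h y => ?_, fun h => ?_⟩
    · rw [h, eval_prod]; simp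
    · refine Polynomial.funext fun y => ?_
      rw [h, eval_prod]; simp
  rw [this]
  refine (isClosed_Icc.preimage continuous_fst).inter (isClosed_iInter fun y => ?_)
  exact isClosed_eq ((poly_cont hP y).comp continuous_fst) (by fun_prop)

lemma KS_compact {d : ℕ} {P : ℝ → ℂ[X]} (hP : SP d P) : IsCompact (KS (d := d) P) := by
  have hb : ∀ j, ∃ M : ℝ, ∀ t ∈ Icc (0:ℝ) 1, ‖(P t).coeff j‖ ≤ M := fun j =>
    isCompact_Icc.exists_bound_of_continuousOn (hP.smooth j).continuous.continuousOn
  choose M hM using hb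
  set R : ℝ := 1 + ∑ j ∈ Finset.range d, |M j| with hR
  have hR1 : 1 ≤ R := by
    have : 0 ≤ ∑ j ∈ Finset.range d, |M j| := Finset.sum_nonneg fun _ _ => abs_nonneg _
    linarith
  have hcpt : IsCompact (Icc (0:ℝ) 1 ×ˢ Metric.closedBall (0 : Fin d → ℂ) (2 * R)) :=
    isCompact_Icc.prod (isCompact_closedBall _ _)
  refine hcpt.of_isClosed_subset (KS_closed hP) ?_
  rintro ⟨t, z⟩ ⟨ht, hz⟩
  refine ⟨ht, ?_⟩
  simp only [mem_closedBall_zero_iff]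
  rw [pi_norm_le_iff_of_nonneg (by positivity)]
  intro j
  refine root_bound (hP.monic t) (hP.deg t) (by positivity) (fun i hi => ?_) (?_ : (P t).IsRoot (z j))
  · have h1 := hM i t ht
    have h2 := Finset.single_le_sum (f := fun j => |M j|) (fun i _ => abs_nonneg _) (Finset.mem_range.2 hi)
    have h3 := le_abs_self (M i)
    calc ‖(P t).coeff i‖ ≤ R := by linarith
      _ ≤ R ^ (d - i) := le_self_pow₀ hR1 (by omega)
  · simp only at hz
    rw [hz, IsRoot.def, eval_prod]
    exact Finset.prod_eq_zero (Finset.mem_univ j) (by simp)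

lemma equiv_of_fib {ι κ β : Type} [Fintype ι] [Fintype κ] (f : ι → β) (g : κ → β)
    (h : ∀ b, (Finset.univ.filter fun i => f i = b).card = (Finset.univ.filter fun i => g i = b).card) :
    ∃ e : ι ≃ κ, ∀ i, g (e i) = f i := by
  have h' : ∀ b, Nonempty ({i // f i = b} ≃ {i // g i = b}) := fun b => by
    rw [← Fintype.card_eq, Fintype.card_subtype, Fintype.card_subtype]; exact h b
  refine ⟨(Equiv.sigmaFiberEquiv f).symm.trans ((Equiv.sigmaCongrRight fun b => Classical.choice (h' b)).trans (Equiv.sigmaFiberEquiv g)), fun i => ?_⟩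
  simp only [Equiv.trans_apply]
  exact (Classical.choice (h' (f i)) ⟨i, rfl⟩).2

lemma perm_of_prod_eq {d : ℕ} {z w : Fin d → ℂ} (h : ∏ j, (X - C (z j)) = ∏ j, (X - C (w j))) : ∃ σ : Equiv.Perm (Fin d), z = w ∘ σ := by
  have h1 : ∀ z : Fin d → ℂ, (∏ j, (X - C (z j))).roots = Multiset.map z Finset.univ.val := by
    intro z
    have : ∏ j, (X - C (z j)) = ((Multiset.map z Finset.univ.val).map fun a => X - C a).prod := by
      rw [Multiset.map_map]; rfl
    rw [this, roots_multiset_prod_X_sub_C]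
  have h2 := congrArg roots h
  rw [h1, h1] at h2
  obtain ⟨σ, hσ⟩ := equiv_of_fib z w (fun b => by
    have h3 := congrArg (Multiset.count b) h2
    rw [Multiset.count_map, Multiset.count_map] at h3
    simp only [eq_comm (a := b)] at h3
    exact h3)
  exact ⟨σ, _root_.funext fun i => (hσ i).symm⟩

lemma matching {d : ℕ} {P : ℝ → ℂ[X]} (hP : SP d P) {ε : ℝ} (hε : 0 < ε) :
    ∃ δ > 0, ∀ s z t w, (s, z) ∈ KS (d := d) P → (t, w) ∈ KS (d := d) P → |s - t| < δ →
      ∃ σ : Equiv.Perm (Fin d), ∀ j, ‖z j - w (σ j)‖ < ε := by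
  let Bad : Set ((ℝ × (Fin d → ℂ)) × (ℝ × (Fin d → ℂ))) := (KS P ×ˢ KS P) ∩ ⋂ σ : Equiv.Perm (Fin d), ⋃ j, {u | ε ≤ ‖u.1.2 j - u.2.2 (σ j)‖}
  have hcl : IsClosed (⋂ σ : Equiv.Perm (Fin d), ⋃ j, {u : ((ℝ × (Fin d → ℂ)) × (ℝ × (Fin d → ℂ))) | ε ≤ ‖u.1.2 j - u.2.2 (σ j)‖}) := by
    refine isClosed_iInter fun σ => isClosed_iUnion_of_finite fun j => ?_
    exact isClosed_le continuous_const (by fun_prop)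
  have hBad : IsCompact Bad := ((KS_compact hP).prod (KS_compact hP)).inter_right hcl
  by_cases hne : Bad.Nonempty
  · obtain ⟨⟨⟨s0, z0⟩, ⟨t0, w0⟩⟩, hu0, hmin⟩ := hBad.exists_isMinOn hne (f := fun u => |u.1.1 - u.2.1|) (by fun_prop)
    obtain ⟨⟨hz0, hw0⟩, hb⟩ := hu0
    refine ⟨|s0 - t0|, ?_, ?_⟩
    · apply lt_of_le_of_ne (abs_nonneg _)
      intro h0
      have hst : s0 = t0 := by
        have := abs_eq_zero.1 h0.symm
        linarith
      obtain ⟨σ, hσ⟩ := perm_of_prod_eq (hz0.2.symm.trans ((by simp only [hst] : P s0 = P t0).trans hw0.2))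
      simp only [mem_iInter, mem_iUnion, Set.mem_ofPred_eq] at hb
      obtain ⟨j, hj⟩ := hb σ
      simp only at hσ hj
      rw [hσ] at hj
      simp at hj
      linarith
    · intro s z t w hz hw hst
      by_contra! hcon
      have : ((s, z), (t, w)) ∈ Bad := ⟨⟨hz, hw⟩, by simpa using hcon⟩
      have := hmin this
      simp only [Set.mem_ofPred_eq] at this
      linarith
  · refine ⟨1, one_pos, ?_⟩
    intro s z t w hz hw hst
    by_contra! hcon
    exact hne ⟨((s, z), (t, w)), ⟨hz, hw⟩, by simpa using hcon⟩

lemma KS_exists {d : ℕ} {P : ℝ → ℂ[X]} (hP : SP d P) {t : ℝ} (ht : t ∈ Icc (0:ℝ) 1) : ∃ z : Fin d → ℂ, (t, z) ∈ KS (d := d) P := by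
  have hs : (P t).Splits := IsAlgClosed.splits _
  have hc : (P t).roots.card = d := by rw [← hP.deg t]; exact hs.natDegree_eq_card_roots.symm
  obtain ⟨l, hl⟩ := Quot.exists_rep (P t).roots
  have hll : l.length = d := by rw [← hc, ← hl]; rfl
  refine ⟨fun j => l.get (j.cast hll.symm), ht, ?_⟩
  simp only
  conv_lhs => rw [hs.eq_prod_roots_of_monic (hP.monic t), ← hl]
  subst hll
  change (Multiset.map _ (l : Multiset ℂ)).prod = _
  rw [Multiset.map_coe, Multiset.prod_coe, ← List.prod_ofFn]
  congr 1
  conv_lhs => rw [← List.ofFn_get l, List.map_ofFn]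
  rfl

/-- discrete trajectories -/
lemma trajectories {d : ℕ} {P : ℝ → ℂ[X]} (hP : SP d P) {ε : ℝ} (hε : 0 < ε) :
    ∃ (N : ℕ) (z : ℕ → Fin d → ℂ), 0 < N ∧ 1 / (N:ℝ) < ε ∧ (∀ k : ℕ, (min ((k:ℝ) / N) 1, z k) ∈ KS (d := d) P) ∧
      ∀ k j, ‖z (k+1) j - z k j‖ ≤ ε := by
  obtain ⟨δ, hδ, hm⟩ := matching hP hε
  obtain ⟨n, hn⟩ := exists_nat_one_div_lt (lt_min hδ hε)
  set N := n + 1 with hN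
  have hN0 : (0:ℝ) < N := by rw [hN]; positivity
  have hn' : 1 / (N:ℝ) < min δ ε := by rw [hN]; push_cast; exact hn
  have hmem : ∀ k : ℕ, min ((k:ℝ) / N) 1 ∈ Icc (0:ℝ) 1 := fun k => ⟨le_min (by positivity) zero_le_one, min_le_right _ _⟩
  have hstep : ∀ k : ℕ, ∀ z : {z : Fin d → ℂ // (min ((k:ℝ) / N) 1, z) ∈ KS (d := d) P},
      ∃ w : {w : Fin d → ℂ // (min (((k+1:ℕ):ℝ) / N) 1, w) ∈ KS (d := d) P}, ∀ j, ‖w.1 j - z.1 j‖ ≤ ε := by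
    rintro k ⟨z, hz⟩
    obtain ⟨w, hw⟩ := KS_exists hP (hmem (k+1))
    obtain ⟨σ, hσ⟩ := hm _ z _ w hz hw (by
      refine lt_of_le_of_lt (abs_min_sub_min_le_max _ _ _ _) ?_
      rw [sub_self, abs_zero]
      have : |(k:ℝ) / N - ((k+1:ℕ):ℝ) / N| = 1 / N := by
        rw [← sub_div, abs_div, abs_of_pos hN0]
        push_cast
        rw [show (k:ℝ) - (k+1) = -1 by ring]; simp
      rw [this]
      exact max_lt (hn'.trans_le (min_le_left _ _)) hδ)
    refine ⟨⟨w ∘ σ, hw.1, ?_⟩, fun j => ?_⟩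
    · rw [hw.2]
      exact (Equiv.prod_comp σ (fun j => X - C (w j))).symm
    · rw [norm_sub_rev]; exact (hσ j).le
  choose nxt hnxt using hstep
  obtain ⟨z0, hz0⟩ := KS_exists hP (hmem 0)
  let z : ∀ k : ℕ, {z : Fin d → ℂ // (min ((k:ℝ) / N) 1, z) ∈ KS (d := d) P} := fun k => Nat.rec ⟨z0, hz0⟩ nxt k
  exact ⟨N, fun k => (z k).1, by omega, hn'.trans_le (min_le_right _ _), fun k => (z k).2, fun k j => hnxt k (z k) j⟩

theorem continuous_roots {d : ℕ} {P : ℝ → ℂ[X]} (hP : SP d P) :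
    ∃ ρ : Fin d → ℝ → ℂ, (∀ j, ContinuousOn (ρ j) (Icc 0 1)) ∧ ∀ t ∈ Icc (0:ℝ) 1, P t = ∏ j, (X - C (ρ j t)) := by
  have htr := fun m : ℕ => trajectories hP (ε := 1 / ((m:ℝ) + 1)) (by positivity)
  choose N z hN hNε hK hstp using htr
  let ix : ℕ → ℝ → ℕ := fun m t => ⌊t * N m⌋₊
  let f : ℕ → ℝ → Fin d → ℂ := fun m t => z m (ix m t)
  let U := Filter.hyperfilter ℕ
  have hU : (U : Filter ℕ) ≤ atTop := by rw [← Nat.cofinite_eq_atTop]; exact hyperfilter_le_cofinite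
  have hix : ∀ m t, t ∈ Icc (0:ℝ) 1 → ((ix m t : ℝ) / N m) ≤ t ∧ t < (ix m t : ℝ) / N m + 1 / N m := by
    intro m t ht
    have hNp : (0:ℝ) < N m := by exact_mod_cast hN m
    have h1 := Nat.floor_le (mul_nonneg ht.1 hNp.le)
    have h2 := Nat.lt_floor_add_one (t * N m)
    constructor
    · rw [div_le_iff₀ hNp]; exact h1
    · rw [← add_div, lt_div_iff₀ hNp]; exact h2
  have hKf : ∀ m t, t ∈ Icc (0:ℝ) 1 → ((ix m t : ℝ) / N m, f m t) ∈ KS (d := d) P := by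
    intro m t ht
    have := hK m (ix m t)
    rwa [min_eq_left ((hix m t ht).1.trans ht.2)] at this
  have hlim : ∀ t, ∃ v : Fin d → ℂ, t ∈ Icc (0:ℝ) 1 → Tendsto (fun m => f m t) U (𝓝 v) ∧ (t, v) ∈ KS (d := d) P := by
    intro t
    by_cases ht : t ∈ Icc (0:ℝ) 1
    swap
    · exact ⟨0, fun h => absurd h ht⟩
    have hmap : (U.map (fun m => (((ix m t : ℝ) / N m, f m t) : ℝ × (Fin d → ℂ))) : Filter _) ≤ 𝓟 (KS (d := d) P) := by
      rw [le_principal_iff]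
      exact Filter.mem_map.2 (Filter.univ_mem' fun m => hKf m t ht)
    obtain ⟨⟨t', v⟩, hv, hle⟩ := (KS_compact hP).ultrafilter_le_nhds _ hmap
    have hle : Tendsto (fun m => (((ix m t : ℝ) / N m, f m t) : ℝ × (Fin d → ℂ))) U (𝓝 (t', v)) := hle
    rw [nhds_prod_eq] at hle
    have h1 : Tendsto (fun m => (ix m t : ℝ) / N m) U (𝓝 t') := tendsto_fst.comp hle
    have h2 : Tendsto (fun m => f m t) U (𝓝 v) := tendsto_snd.comp hle
    have h3 : Tendsto (fun m => (ix m t : ℝ) / N m) U (𝓝 t) := by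
      refine Tendsto.mono_left ?_ hU
      have h4 : Tendsto (fun m : ℕ => t - 1 / ((m:ℝ) + 1)) atTop (𝓝 (t - 0)) := tendsto_const_nhds.sub tendsto_one_div_add_atTop_nhds_zero_nat
      rw [sub_zero] at h4
      refine tendsto_of_tendsto_of_tendsto_of_le_of_le h4 tendsto_const_nhds (fun m => ?_) (fun m => (hix m t ht).1)
      have := (hix m t ht).2
      have := hNε m
      simp only; linarith
    have : t' = t := tendsto_nhds_unique h1 h3
    subst this
    exact ⟨v, fun _ => ⟨h2, hv⟩⟩
  choose ρ hρ using hlim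
  refine ⟨fun j t => ρ t j, fun j => ?_, fun t ht => (hρ t ht).2.2⟩
  -- uniform estimate
  have hequi : ∀ η > 0, ∃ δ > 0, ∃ m0 : ℕ, ∀ m ≥ m0, ∀ s ∈ Icc (0:ℝ) 1, ∀ t ∈ Icc (0:ℝ) 1, s ≤ t → t - s < δ →
      ∀ j, ‖f m t j - f m s j‖ ≤ η := by
    intro η hη
    set w : ℝ := η / (8 * d + 1) with hw
    have hwp : 0 < w := by positivity
    obtain ⟨δ, hδ, hm⟩ := matching hP hwp
    obtain ⟨m0, hm0⟩ := exists_nat_one_div_lt (lt_min (half_pos hδ) hwp)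
    refine ⟨δ / 2, half_pos hδ, m0, fun m hmm s hs t ht hst hd j => ?_⟩
    have hεm : 1 / ((m:ℝ) + 1) < min (δ / 2) w := by
      refine lt_of_le_of_lt ?_ hm0
      apply one_div_le_one_div_of_le (by positivity)
      have : (m0:ℝ) ≤ m := by exact_mod_cast hmm
      linarith
    have hNp : (0:ℝ) < N m := by exact_mod_cast hN m
    have hkl : ix m s ≤ ix m t := Nat.floor_le_floor (mul_le_mul_of_nonneg_right hst hNp.le)
    have hfin : ‖f m t j - f m s j‖ ≤ 8 * d * w := by
      refine chain_complex (f m s) (fun i => z m i j) hwp.le hkl ?_ ?_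
      · intro i _ _
        exact (hstp m i j).trans (hεm.le.trans (min_le_right _ _))
      · intro i hi1 hi2
        have hi2' : (i:ℝ) / N m ≤ (ix m t : ℝ) / N m := by gcongr
        have hi1' : (ix m s : ℝ) / N m ≤ (i:ℝ) / N m := by gcongr
        have hi := hK m i
        rw [min_eq_left (hi2'.trans ((hix m t ht).1.trans ht.2))] at hi
        obtain ⟨σ, hσ⟩ := hm _ _ _ _ hi (hKf m s hs) (by
          rw [abs_of_nonneg (by linarith)]
          have a1 := (hix m t ht).1
          have a2 := (hix m s hs).2
          have a3 := hNε m
          have a4 := hεm.trans_le (min_le_left _ _)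
          linarith)
        exact ⟨σ j, (hσ j).le⟩
    refine hfin.trans ?_
    rw [hw]
    rw [mul_div_assoc', div_le_iff₀ (by positivity)]
    nlinarith
  have hlimest : ∀ η > 0, ∃ δ > 0, ∀ s ∈ Icc (0:ℝ) 1, ∀ t ∈ Icc (0:ℝ) 1, s ≤ t → t - s < δ → ‖ρ t j - ρ s j‖ ≤ η := by
    intro η hη
    obtain ⟨δ, hδ, m0, h⟩ := hequi η hη
    refine ⟨δ, hδ, fun s hs t ht hst hd => ?_⟩
    have t1 : Tendsto (fun m => f m t j) U (𝓝 (ρ t j)) := ((continuous_apply j).tendsto _).comp (hρ t ht).1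
    have t2 : Tendsto (fun m => f m s j) U (𝓝 (ρ s j)) := ((continuous_apply j).tendsto _).comp (hρ s hs).1
    refine le_of_tendsto (t1.sub t2).norm ?_
    exact hU (by filter_upwards [eventually_ge_atTop m0] with m hm; exact h m hm s hs t ht hst hd j)
  rw [Metric.continuousOn_iff]
  intro t ht η hη
  obtain ⟨δ, hδ, h⟩ := hlimest (η / 2) (half_pos hη)
  refine ⟨δ, hδ, fun s hs hd => ?_⟩
  rw [Real.dist_eq] at hd
  rw [dist_eq_norm]
  rcases le_total s t with hst | hst
  · rw [norm_sub_rev]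
    have := h s hs t ht hst (by rw [abs_sub_comm] at hd; exact (le_abs_self _).trans_lt hd)
    linarith
  · have := h t ht s hs hst ((le_abs_self _).trans_lt hd)
    linarith

end NP

namespace NP
open scoped ContDiff Topology

lemma np_sub {K : Set (ℕ × ℕ)} {γ : ℝ} (hγ : 0 < γ) {p : ℕ × ℕ}
    (hmin : ∀ q ∈ K, q ≠ p → (p.1:ℝ) + γ * p.2 < q.1 + γ * q.2) :
    newtonPolygon K ⊆ {z : ℝ × ℝ | (p.1:ℝ) + γ * p.2 < z.1 + γ * z.2 ∨ z = ((p.1:ℝ), (p.2:ℝ))} := by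
  apply convexHull_min
  · rintro z ⟨n, hn, q, h1, h2, rfl⟩
    simp only [mem_ofPred_eq]
    by_cases hnp : n = p
    · subst hnp
      by_cases hq : q = 0
      · right; simp [hq]
      · left
        have : 0 < q.1 ∨ 0 < q.2 := by
          by_contra! h
          exact hq (Prod.ext (le_antisymm h.1 h1) (le_antisymm h.2 h2))
        rcases this with h | h
        · nlinarith [mul_nonneg hγ.le h2]
        · nlinarith [mul_pos hγ h]
    · left
      have := hmin n hn hnp
      nlinarith [mul_nonneg hγ.le h2]
  · rw [convex_iff_forall_pos]
    intro z hz w hw a b ha hb hab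
    simp only [mem_ofPred_eq] at *
    have hb' : b = 1 - a := by linarith
    rcases hz with hz | hz
    · left
      simp only [Prod.fst_add, Prod.snd_add, Prod.smul_fst, Prod.smul_snd, smul_eq_mul]
      have hw' : (p.1:ℝ) + γ * p.2 ≤ w.1 + γ * w.2 := by
        rcases hw with hw | hw
        · exact hw.le
        · rw [hw]
      have e1 := mul_lt_mul_of_pos_left hz ha
      have e2 := mul_le_mul_of_nonneg_left hw' hb.le
      subst hb'
      nlinarith
    · rcases hw with hw | hw
      · left
        simp only [Prod.fst_add, Prod.snd_add, Prod.smul_fst, Prod.smul_snd, smul_eq_mul]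
        have e2 := mul_lt_mul_of_pos_left hw hb
        rw [hz]
        subst hb'
        simp only
        nlinarith
      · right
        rw [hz, hw, ← add_smul, hab, one_smul]

lemma np_mem {K : Set (ℕ × ℕ)} {p : ℕ × ℕ} (hp : p ∈ K) (q : ℝ × ℝ) (h1 : 0 ≤ q.1) (h2 : 0 ≤ q.2) :
    ((p.1:ℝ) + q.1, (p.2:ℝ) + q.2) ∈ newtonPolygon K :=
  subset_convexHull _ _ ⟨p, hp, q, h1, h2, rfl⟩

lemma ext_of_min {K : Set (ℕ × ℕ)} {γ : ℝ} (hγ : 0 < γ) {p : ℕ × ℕ} (hp : p ∈ K)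
    (hmin : ∀ q ∈ K, q ≠ p → (p.1:ℝ) + γ * p.2 < q.1 + γ * q.2) :
    ((p.1:ℝ), (p.2:ℝ)) ∈ Set.extremePoints ℝ (newtonPolygon K) := by
  have hsub := np_sub hγ hmin
  rw [mem_extremePoints_iff_left]
  refine ⟨by simpa using np_mem hp 0 le_rfl le_rfl, ?_⟩
  rintro x hx y hy ⟨a, b, ha, hb, hab, h⟩
  have e1 := congrArg Prod.fst h
  have e2 := congrArg Prod.snd h
  simp only [Prod.fst_add, Prod.snd_add, Prod.smul_fst, Prod.smul_snd, smul_eq_mul] at e1 e2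
  rcases hsub hx with hx | hx
  · exfalso
    have hy' : (p.1:ℝ) + γ * p.2 ≤ y.1 + γ * y.2 := by
      rcases hsub hy with hw | hw
      · exact hw.le
      · rw [hw]
    have e3 := mul_lt_mul_of_pos_left hx ha
    have e4 := mul_le_mul_of_nonneg_left hy' hb.le
    have hb' : b = 1 - a := by linarith
    rw [← e1, ← e2] at e3 e4
    subst hb'
    nlinarith
  · exact hx

lemma vert_mem {K : Set (ℕ × ℕ)} {p : ℕ × ℕ} (hp : ((p.1:ℝ), (p.2:ℝ)) ∈ Set.extremePoints ℝ (newtonPolygon K)) : p ∈ K := by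
  obtain ⟨n, hn, q, h1, h2, h⟩ := extremePoints_convexHull_subset hp
  have hq : n = p := by
    rw [mem_extremePoints_iff_left] at hp
    have := hp.2 _ (np_mem hn 0 le_rfl le_rfl) _ (np_mem hn (2 • q) (by simp [h1]) (by simp [h2]))
      ⟨1/2, 1/2, by norm_num, by norm_num, by norm_num, by
        rw [h]; ext <;> simp <;> ring⟩
    simp only [Prod.fst_zero, Prod.snd_zero, add_zero, Prod.mk.injEq, Nat.cast_inj] at this
    exact Prod.ext this.1 this.2
  exact hq ▸ hn

section
variable {K : Set (ℕ × ℕ)} {k : ℕ} {v : Fin (k + 1) → ℕ × ℕ}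

lemma edgeMult_cast (hanti : StrictAnti fun i => (v i).2) (α : Fin k) :
    ((edgeMult v α : ℕ) : ℝ) = (v α.castSucc).2 - (v α.succ).2 := by
  have := (hanti (Fin.castSucc_lt_succ (i := α))).le
  simp only at this
  rw [edgeMult, Nat.cast_sub this]

lemma edgeMult_pos (hanti : StrictAnti fun i => (v i).2) (α : Fin k) : 0 < edgeMult v α := by
  have := hanti (Fin.castSucc_lt_succ (i := α))
  simp only at this
  unfold edgeMult; omega

lemma edge_eq (hmono : StrictMono fun i => (v i).1) (hanti : StrictAnti fun i => (v i).2) (α : Fin k) :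
    (edgeMult v α : ℝ) * edgeSlope v α = (v α.succ).1 - (v α.castSucc).1 := by
  have h1 : (0:ℝ) < edgeMult v α := by exact_mod_cast edgeMult_pos hanti α
  have := (hmono (Fin.castSucc_lt_succ (i := α))).le
  simp only at this
  rw [edgeSlope, mul_div_cancel₀ _ h1.ne', Nat.cast_sub this]

lemma edgeSlope_pos (hmono : StrictMono fun i => (v i).1) (hanti : StrictAnti fun i => (v i).2) (α : Fin k) :
    0 < edgeSlope v α := by
  have h1 : (0:ℝ) < edgeMult v α := by exact_mod_cast edgeMult_pos hanti α
  have := hmono (Fin.castSucc_lt_succ (i := α))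
  simp only at this
  rw [edgeSlope]
  apply div_pos _ h1
  exact_mod_cast Nat.sub_pos_of_lt this

lemma slope_lt (hmono : StrictMono fun i => (v i).1) (hanti : StrictAnti fun i => (v i).2)
    (hvert : Set.extremePoints ℝ (newtonPolygon K) = Set.range fun i => (((v i).1 : ℝ), ((v i).2 : ℝ)))
    (α β : Fin k) (h : α.val + 1 = β.val) : edgeSlope v α < edgeSlope v β := by
  by_contra! hcon
  have hαβ : α.succ = β.castSucc := Fin.ext (by simp [h])
  have hmem : ∀ i, v i ∈ K := fun i => vert_mem (by rw [hvert]; exact ⟨i, rfl⟩)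
  have hext : (((v α.succ).1 : ℝ), ((v α.succ).2 : ℝ)) ∈ Set.extremePoints ℝ (newtonPolygon K) := by
    rw [hvert]; exact ⟨_, rfl⟩
  have e1 := edge_eq hmono hanti α
  have e2 := edge_eq hmono hanti β
  have m1 := edgeMult_cast hanti α
  have m2 := edgeMult_cast hanti β
  have p1 : (0:ℝ) < edgeMult v α := by exact_mod_cast edgeMult_pos hanti α
  have p2 : (0:ℝ) < edgeMult v β := by exact_mod_cast edgeMult_pos hanti β
  have g1 := edgeSlope_pos hmono hanti α
  have g2 := edgeSlope_pos hmono hanti β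
  rw [← hαβ] at e2 m2
  set n1 : ℝ := ((edgeMult v α : ℕ) : ℝ)
  set n2 : ℝ := ((edgeMult v β : ℕ) : ℝ)
  set γ1 := edgeSlope v α
  set γ2 := edgeSlope v β
  have d1 : 0 < n1 * γ1 := mul_pos p1 g1
  have d2 : 0 < n2 * γ2 := mul_pos p2 g2
  set a := n2 * γ2 / (n1 * γ1 + n2 * γ2) with ha
  set b := n1 * γ1 / (n1 * γ1 + n2 * γ2) with hb
  have hab : a + b = 1 := by rw [ha, hb]; field_simp; ring
  have hs : 0 ≤ ((v α.succ).2 : ℝ) - a * (v α.castSucc).2 - b * (v β.succ).2 := by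
    have : ((v α.succ).2 : ℝ) - a * (v α.castSucc).2 - b * (v β.succ).2 = b * n2 - a * n1 := by
      rw [m1, m2]
      have : b = 1 - a := by linarith
      rw [this]; ring
    rw [this, ha, hb]
    rw [div_mul_eq_mul_div, div_mul_eq_mul_div, ← sub_div]
    apply div_nonneg _ (by positivity)
    nlinarith [mul_pos p1 p2]
  set s := ((v α.succ).2 : ℝ) - a * (v α.castSucc).2 - b * (v β.succ).2 with hsdef
  rw [mem_extremePoints_iff_left] at hext
  have := hext.2 _ (np_mem (hmem α.castSucc) (0, s) le_rfl hs) _ (np_mem (hmem β.succ) (0, s) le_rfl hs)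
    ⟨a, b, by positivity, by positivity, hab, by
      ext
      · simp only [Prod.fst_add, Prod.smul_fst, smul_eq_mul, add_zero]
        have x1 : ((v α.castSucc).1 : ℝ) = (v α.succ).1 - n1 * γ1 := by linarith
        have x2 : ((v β.succ).1 : ℝ) = (v α.succ).1 + n2 * γ2 := by linarith
        rw [x1, x2, ha, hb]
        field_simp
        ring
      · simp only [Prod.snd_add, Prod.smul_snd, smul_eq_mul]
        have : b = 1 - a := by linarith
        rw [hsdef, this]; ring⟩
  simp only [add_zero, Prod.mk.injEq, Nat.cast_inj] at this
  have h3 := hmono (Fin.castSucc_lt_succ (i := α))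
  simp only at h3
  omega

lemma slope_mono (hmono : StrictMono fun i => (v i).1) (hanti : StrictAnti fun i => (v i).2)
    (hvert : Set.extremePoints ℝ (newtonPolygon K) = Set.range fun i => (((v i).1 : ℝ), ((v i).2 : ℝ)))
    (α β : Fin k) (h : α ≤ β) : edgeSlope v α ≤ edgeSlope v β := by
  obtain ⟨a, ha⟩ := α
  obtain ⟨b, hb⟩ := β
  simp only [Fin.mk_le_mk] at h
  induction b, h using Nat.le_induction with
  | base => exact le_rfl
  | succ m hm ih => exact (ih (by omega)).trans (slope_lt hmono hanti hvert _ _ rfl).le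

lemma ell_vert (hmono : StrictMono fun i => (v i).1) (hanti : StrictAnti fun i => (v i).2) (γ : ℝ) (i : ℕ) (hi : i < k + 1) :
    ((v ⟨i, hi⟩).1 : ℝ) + γ * (v ⟨i, hi⟩).2 = (v 0).1 + γ * (v 0).2 +
      ∑ β : Fin k, if β.val < i then (edgeMult v β : ℝ) * (edgeSlope v β - γ) else 0 := by
  induction i with
  | zero => simp
  | succ m ih =>
    have ih := ih (by omega)
    have hm : m < k := by omega
    have e1 := edge_eq hmono hanti ⟨m, hm⟩
    have m1 := edgeMult_cast hanti ⟨m, hm⟩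
    have s1 : (⟨m, hm⟩ : Fin k).castSucc = ⟨m, by omega⟩ := rfl
    have s2 : (⟨m, hm⟩ : Fin k).succ = ⟨m+1, hi⟩ := rfl
    rw [s1, s2] at e1 m1
    have hs : ∑ β : Fin k, (if β.val < m + 1 then (edgeMult v β : ℝ) * (edgeSlope v β - γ) else 0)
        = ∑ β : Fin k, (if β.val < m then (edgeMult v β : ℝ) * (edgeSlope v β - γ) else 0)
          + (edgeMult v ⟨m, hm⟩ : ℝ) * (edgeSlope v ⟨m, hm⟩ - γ) := by
      have : (edgeMult v ⟨m, hm⟩ : ℝ) * (edgeSlope v ⟨m, hm⟩ - γ) = ∑ β : Fin k, if β = ⟨m, hm⟩ then (edgeMult v β : ℝ) * (edgeSlope v β - γ) else 0 := by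
        simp
      rw [this, ← Finset.sum_add_distrib]
      refine Finset.sum_congr rfl fun β _ => ?_
      have : (β = ⟨m, hm⟩) ↔ β.val = m := Fin.ext_iff
      simp only [this]
      split_ifs <;> first | omega | simp
    rw [hs, ← add_assoc, ← ih, mul_sub, e1, m1]
    ring

/-- value of the support function -/
lemma np_min (hmono : StrictMono fun i => (v i).1) (hanti : StrictAnti fun i => (v i).2)
    (hvert : Set.extremePoints ℝ (newtonPolygon K) = Set.range fun i => (((v i).1 : ℝ), ((v i).2 : ℝ)))
    {γ : ℝ} (hγ : 0 < γ) (hirr : Irrational γ) :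
    ∃ p ∈ K, (∀ q ∈ K, q ≠ p → (p.1:ℝ) + γ * p.2 < q.1 + γ * q.2) ∧
      (p.1:ℝ) + γ * p.2 = (v 0).1 + γ * (v 0).2 + ∑ β : Fin k, (edgeMult v β : ℝ) * min (edgeSlope v β - γ) 0 := by
  have hmem : ∀ i, v i ∈ K := fun i => vert_mem (by rw [hvert]; exact ⟨i, rfl⟩)
  -- existence of the minimizer
  obtain ⟨p, hp, hpm⟩ : ∃ p ∈ K, ∀ q ∈ K, (p.1:ℝ) + γ * p.2 ≤ q.1 + γ * q.2 := by
    set C : ℝ := (v 0).1 + γ * (v 0).2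
    have hfin : (K ∩ {q : ℕ × ℕ | (q.1:ℝ) + γ * q.2 ≤ C}).Finite := by
      refine Set.Finite.subset ((Set.finite_Iic ⌈C⌉₊).prod (Set.finite_Iic ⌈C / γ⌉₊)) ?_
      rintro q ⟨_, hq⟩
      simp only [mem_ofPred_eq] at hq
      have a1 : (0:ℝ) ≤ q.1 := by positivity
      have a2 : (0:ℝ) ≤ γ * q.2 := by positivity
      constructor
      · have : (q.1:ℝ) ≤ ⌈C⌉₊ := le_trans (by linarith) (Nat.le_ceil C)
        exact_mod_cast this
      · have : (q.2:ℝ) ≤ ⌈C/γ⌉₊ := by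
          refine le_trans ?_ (Nat.le_ceil _)
          rw [le_div_iff₀ hγ]; linarith
        exact_mod_cast this
    obtain ⟨p, hp, hpm⟩ := Set.exists_min_image _ (fun q : ℕ × ℕ => (q.1:ℝ) + γ * q.2) hfin ⟨v 0, hmem 0, le_refl C⟩
    refine ⟨p, hp.1, fun q hq => ?_⟩
    by_cases h : (q.1:ℝ) + γ * q.2 ≤ C
    · exact hpm q ⟨hq, h⟩
    · exact hp.2.trans (not_le.1 h).le
  have hstrict : ∀ q ∈ K, q ≠ p → (p.1:ℝ) + γ * p.2 < q.1 + γ * q.2 := by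
    intro q hq hne
    refine lt_of_le_of_ne (hpm q hq) fun heq => hne ?_
    have h2 : q.2 = p.2 := by
      by_contra h2
      have h2' : ((q.2:ℤ) - (p.2:ℤ)) ≠ 0 := by omega
      have h3 : γ * (((q.2:ℤ) - (p.2:ℤ) : ℤ) : ℝ) = ((p.1:ℤ) - (q.1:ℤ) : ℤ) := by push_cast; linarith
      exact (hirr.mul_intCast h2').ne_int _ h3
    have h1 : (q.1:ℝ) = p.1 := by rw [h2] at heq; linarith
    exact Prod.ext (by exact_mod_cast h1) h2
  refine ⟨p, hp, hstrict, ?_⟩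
  have hge : ∀ i (hi : i < k + 1), (v 0).1 + γ * (v 0).2 + ∑ β : Fin k, (edgeMult v β : ℝ) * min (edgeSlope v β - γ) 0
      ≤ ((v ⟨i, hi⟩).1 : ℝ) + γ * (v ⟨i, hi⟩).2 := by
    intro i hi
    rw [ell_vert hmono hanti γ i hi]
    gcongr with β
    split_ifs
    · gcongr; exact min_le_left _ _
    · exact mul_nonpos_of_nonneg_of_nonpos (by positivity) (min_le_right _ _)
  apply le_antisymm
  · -- the optimal vertex
    have : ∃ i, ∃ hi : i < k + 1, ∀ β : Fin k, β.val < i ↔ edgeSlope v β < γ := by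
      by_cases hall : ∀ β : Fin k, edgeSlope v β < γ
      · exact ⟨k, by omega, fun β => ⟨fun _ => hall β, fun _ => β.2⟩⟩
      · push Not at hall
        have hex : ∃ i : ℕ, ∃ h : i < k, γ ≤ edgeSlope v ⟨i, h⟩ := by
          obtain ⟨β, hβ⟩ := hall; exact ⟨β.1, β.2, hβ⟩
        obtain ⟨h1, h2⟩ := Nat.find_spec hex
        refine ⟨Nat.find hex, by omega, fun β => ⟨fun hlt => ?_, fun hlt => ?_⟩⟩
        · have := Nat.find_min hex hlt
          push Not at this
          exact this β.2
        · by_contra! hle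
          have := slope_mono hmono hanti hvert ⟨_, h1⟩ β hle
          linarith
    obtain ⟨i, hi, hβ⟩ := this
    refine (hpm _ (hmem ⟨i, hi⟩)).trans ?_
    rw [ell_vert hmono hanti γ i hi]
    gcongr with β
    split_ifs with h <;> rw [hβ] at h
    · rw [min_eq_left (by linarith)]
    · rw [min_eq_right (by linarith), mul_zero]
  · have := ext_of_min hγ hp hstrict
    rw [hvert] at this
    obtain ⟨i, hi⟩ := this
    simp only [Prod.mk.injEq] at hi
    rw [← hi.1, ← hi.2]
    exact hge i.1 i.2

lemma np_lex (hmono : StrictMono fun i => (v i).1)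
    (hvert : Set.extremePoints ℝ (newtonPolygon K) = Set.range fun i => (((v i).1 : ℝ), ((v i).2 : ℝ))) :
    v 0 ∈ K ∧ (∀ i j, (i, j) ∈ K → (v 0).1 ≤ i) ∧ ∀ j, ((v 0).1, j) ∈ K → (v 0).2 ≤ j := by
  have hmem : ∀ i, v i ∈ K := fun i => vert_mem (by rw [hvert]; exact ⟨i, rfl⟩)
  have hex : ∃ i, ∃ j, (i, j) ∈ K := ⟨_, _, hmem 0⟩
  have hA := Nat.find_spec hex
  set A := Nat.find hex with hAd
  have hb := Nat.find_spec hA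
  set b := Nat.find hA with hbd
  have hext := ext_of_min (K := K) (γ := 1 / ((b:ℝ) + 1)) (by positivity) hb (by
    rintro ⟨i, j⟩ hq hne
    have hi : A ≤ i := Nat.find_min' hex ⟨j, hq⟩
    rcases hi.eq_or_lt with h | h
    · have hj : b ≤ j := Nat.find_min' hA (by rw [h]; exact hq)
      have hj' : b < j := lt_of_le_of_ne hj (by rintro rfl; exact hne (by rw [h]))
      have hj'' : (b:ℝ) < j := by exact_mod_cast hj'
      rw [h]
      simp only
      gcongr
    · have hi' : (A:ℝ) + 1 ≤ i := by exact_mod_cast h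
      have h1 : 1 / ((b:ℝ) + 1) * b < 1 := by rw [div_mul_eq_mul_div, div_lt_one (by positivity)]; linarith
      have h2 : 0 ≤ 1 / ((b:ℝ) + 1) * j := by positivity
      simp only
      linarith)
  rw [hvert] at hext
  obtain ⟨i, hi⟩ := hext
  simp only [Prod.mk.injEq, Nat.cast_inj] at hi
  have h0 : A ≤ (v 0).1 := Nat.find_min' hex ⟨_, hmem 0⟩
  have hi0 : i = 0 := by
    by_contra hne
    have := hmono (Fin.pos_of_ne_zero hne)
    simp only at this
    omega
  subst hi0
  refine ⟨hmem 0, fun i j h => ?_, fun j h => ?_⟩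
  · rw [hi.1]; exact Nat.find_min' hex ⟨j, h⟩
  · rw [hi.2]; rw [hi.1] at h; exact Nat.find_min' hA h

lemma totalDeg_eq (hanti : StrictAnti fun i => (v i).2) : totalDeg v = (v 0).2 := by
  have h : ∀ i (hi : i < k + 1), (v ⟨i, hi⟩).2 + ∑ β : Fin k, (if β.val < i then edgeMult v β else 0) = (v 0).2 := by
    intro i hi
    induction i with
    | zero => simp
    | succ m ih =>
      have hm : m < k := by omega
      rw [← ih (by omega)]
      have hs : ∑ β : Fin k, (if β.val < m + 1 then edgeMult v β else 0)
          = ∑ β : Fin k, (if β.val < m then edgeMult v β else 0) + edgeMult v ⟨m, hm⟩ := by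
        have : edgeMult v ⟨m, hm⟩ = ∑ β : Fin k, if β = ⟨m, hm⟩ then edgeMult v β else 0 := by
          simp
        rw [this, ← Finset.sum_add_distrib]
        refine Finset.sum_congr rfl fun β _ => ?_
        have : (β = ⟨m, hm⟩) ↔ β.val = m := Fin.ext_iff
        simp only [this]
        split_ifs <;> omega
      have s1 : (⟨m, hm⟩ : Fin k).castSucc = ⟨m, by omega⟩ := rfl
      have s2 : (⟨m, hm⟩ : Fin k).succ = ⟨m+1, hi⟩ := rfl
      have := hanti (Fin.castSucc_lt_succ (i := (⟨m, hm⟩ : Fin k)))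
      simp only [s1, s2] at this
      rw [hs]
      have he : edgeMult v ⟨m, hm⟩ = (v ⟨m, by omega⟩).2 - (v ⟨m+1, hi⟩).2 := rfl
      omega
  have := h k (by omega)
  rw [totalDeg, ← this]
  congr 1
  exact Finset.sum_congr rfl fun β _ => by simp [β.2]

end

end NP

namespace NP
open scoped ContDiff Topology
open Polynomial

lemma second_diff (w w0 : ℝ) : ∃ δ > 0, ∀ h, 0 < h → h < δ →
    min (w - (w0 + h)) 0 + min (w - (w0 - h)) 0 - 2 * min (w - w0) 0 = if w = w0 then -h else 0 := by
  by_cases hw : w = w0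
  · subst hw
    refine ⟨1, one_pos, fun h h0 _ => ?_⟩
    rw [if_pos rfl, sub_self, min_self, min_eq_left (by linarith), min_eq_right (by linarith)]
    ring
  · refine ⟨|w - w0|, abs_pos.2 (sub_ne_zero.2 hw), fun h h0 hlt => ?_⟩
    rw [if_neg hw]
    rcases lt_or_gt_of_ne hw with h1 | h1
    · rw [abs_of_neg (by linarith)] at hlt
      rw [min_eq_left (by linarith), min_eq_left (by linarith), min_eq_left (by linarith)]; ring
    · rw [abs_of_pos (by linarith)] at hlt
      rw [min_eq_right (by linarith), min_eq_right (by linarith), min_eq_right (by linarith)]; ring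

lemma sum_second_diff {ι : Type} [Fintype ι] (w m : ι → ℝ) (w0 : ℝ) : ∃ δ > 0, ∀ h, 0 < h → h < δ →
    (∑ i, m i * min (w i - (w0 + h)) 0) + (∑ i, m i * min (w i - (w0 - h)) 0) - 2 * ∑ i, m i * min (w i - w0) 0
      = -h * ∑ i, if w i = w0 then m i else 0 := by
  choose δ hδ hd using fun i => second_diff (w i) w0
  obtain ⟨δ0, h0, hle⟩ : ∃ δ0 > 0, ∀ i, δ0 ≤ δ i := by
    by_cases hne : Nonempty ι
    · obtain ⟨i, hi⟩ := Finite.exists_min δ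
      exact ⟨δ i, hδ i, hi⟩
    · exact ⟨1, one_pos, fun i => absurd ⟨i⟩ hne⟩
  refine ⟨δ0, h0, fun h h1 h2 => ?_⟩
  rw [← Finset.sum_add_distrib, Finset.mul_sum, ← Finset.sum_sub_distrib, Finset.mul_sum]
  refine Finset.sum_congr rfl fun i _ => ?_
  have := hd i h h1 (h2.trans_le (hle i))
  have e : m i * min (w i - (w0 + h)) 0 + m i * min (w i - (w0 - h)) 0 - 2 * (m i * min (w i - w0) 0)
      = m i * (min (w i - (w0 + h)) 0 + min (w i - (w0 - h)) 0 - 2 * min (w i - w0) 0) := by ring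
  rw [e, this]
  split_ifs <;> ring

lemma count_eq {ι κ : Type} [Fintype ι] [Fintype κ] (w m : ι → ℝ) (u n : κ → ℝ)
    (h : ∀ γ > 0, Irrational γ → ∑ i, m i * min (w i - γ) 0 = ∑ i, n i * min (u i - γ) 0) {w0 : ℝ} (h0 : 0 < w0) :
    (∑ i, if w i = w0 then m i else 0) = ∑ i, if u i = w0 then n i else 0 := by
  have hall : ∀ γ > 0, ∑ i, m i * min (w i - γ) 0 = ∑ i, n i * min (u i - γ) 0 := by
    have hcl : IsClosed {γ : ℝ | ∑ i, m i * min (w i - γ) 0 = ∑ i, n i * min (u i - γ) 0} :=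
      isClosed_eq (by fun_prop) (by fun_prop)
    intro γ hγ
    have h1 : Ioi (0:ℝ) ∩ {x | Irrational x} ⊆ {γ : ℝ | ∑ i, m i * min (w i - γ) 0 = ∑ i, n i * min (u i - γ) 0} :=
      fun x hx => h x hx.1 hx.2
    exact hcl.closure_subset_iff.2 h1 (dense_irrational.open_subset_closure_inter isOpen_Ioi hγ)
  obtain ⟨δ1, hδ1, e1⟩ := sum_second_diff w m w0
  obtain ⟨δ2, hδ2, e2⟩ := sum_second_diff u n w0
  obtain ⟨h', hp, hlt⟩ := exists_between (lt_min (lt_min hδ1 hδ2) h0)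
  have hlt1 := (lt_min_iff.1 (lt_min_iff.1 hlt).1)
  have hlt2 := (lt_min_iff.1 hlt).2
  have f1 := e1 h' hp hlt1.1
  have f2 := e2 h' hp hlt1.2
  rw [hall _ (by linarith), hall _ (by linarith), hall _ h0, f2] at f1
  exact (mul_left_cancel₀ (by linarith : -h' ≠ 0) f1).symm

lemma theta_congr {E G : Type} [NormedAddCommGroup E] [NormedAddCommGroup G] {l : Filter ℝ} {f1 f2 : ℝ → E} {g : ℝ → G}
    (h : f1 =Θ[l] g) (he : f1 =ᶠ[l] f2) : f2 =Θ[l] g := ⟨h.1.congr' he EventuallyEq.rfl, h.2.congr' EventuallyEq.rfl he⟩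

lemma rp_lt {a b : ℝ} (h : a < b) : (fun t : ℝ => t ^ b) =o[𝓝[>] (0:ℝ)] fun t => t ^ a := by
  refine isLittleO_of_tendsto' ?_ ?_
  · filter_upwards [self_mem_nhdsWithin] with t ht h0
    exact absurd h0 (Real.rpow_pos_of_pos ht _).ne'
  · have h1 : Tendsto (fun t : ℝ => t ^ (b - a)) (𝓝[>] 0) (𝓝 0) := by
      have := (Real.continuousAt_rpow_const 0 (b - a) (Or.inr (by linarith))).tendsto
      rw [Real.zero_rpow (by linarith)] at this
      exact this.mono_left nhdsWithin_le_nhds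
    refine h1.congr' ?_
    filter_upwards [self_mem_nhdsWithin] with t ht
    rw [Real.rpow_sub ht]

lemma rp_inj {a b : ℝ} (h : (fun t : ℝ => t ^ a) =Θ[𝓝[>] (0:ℝ)] fun t => t ^ b) : a = b := by
  have key : ∀ {a b : ℝ}, (fun t : ℝ => t ^ a) =Θ[𝓝[>] (0:ℝ)] (fun t => t ^ b) → ¬ a < b := by
    intro a b h hlt
    have h1 := h.1.trans_isLittleO (rp_lt hlt)
    have h2 := isLittleO_irrefl (f'' := fun t : ℝ => t ^ a) (l := 𝓝[>] (0:ℝ)) (Eventually.frequently (by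
      filter_upwards [self_mem_nhdsWithin] with t ht
      exact (Real.rpow_pos_of_pos ht _).ne'))
    exact h2 h1
  exact le_antisymm (not_lt.1 (key h.symm)) (not_lt.1 (key h))

lemma rp_le {a b : ℝ} (h : a ≤ b) : (fun t : ℝ => t ^ b) =O[𝓝[>] (0:ℝ)] fun t => t ^ a := by
  rcases h.eq_or_lt with h | h
  · subst h; exact isBigO_refl _ _
  · exact (rp_lt h).isBigO

/-- asymptotics of `F (x, x^γ)` -/
lemma F_theta {F : ℝ × ℝ → ℝ} (hF : ContDiff ℝ ∞ F) {γ : ℝ} (hγ : 0 < γ) {p : ℕ × ℕ}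
    (hp : taylorCoeff2 (fun x y => F (x, y)) p.1 p.2 ≠ 0)
    (hmin : ∀ q : ℕ × ℕ, taylorCoeff2 (fun x y => F (x, y)) q.1 q.2 ≠ 0 → q ≠ p → (p.1:ℝ) + γ * p.2 < q.1 + γ * q.2) :
    (fun x : ℝ => F (x, x ^ γ)) =Θ[𝓝[>] (0:ℝ)] fun x : ℝ => x ^ ((p.1:ℝ) + γ * p.2) := by
  set h : ℝ := (p.1:ℝ) + γ * p.2 with hh
  obtain ⟨M, hM⟩ := exists_nat_gt (max h (h / γ))
  have hM1 : h < M := (le_max_left _ _).trans_lt hM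
  have hM2 : h < γ * M := by
    have := (le_max_right _ _).trans_lt hM
    rw [div_lt_iff₀ hγ] at this; linarith
  have hp1 : p.1 < M := by
    have : (p.1:ℝ) < M := lt_of_le_of_lt (by rw [hh]; have : 0 ≤ γ * p.2 := by positivity
                                             linarith) hM1
    exact_mod_cast this
  have hp2 : p.2 < M := by
    have : γ * p.2 < γ * M := lt_of_le_of_lt (by rw [hh]; have : (0:ℝ) ≤ p.1 := by positivity
                                                 linarith) hM2
    exact_mod_cast lt_of_mul_lt_mul_left this hγ.le
  obtain ⟨g, q, hg, hq, hexp⟩ := hadamard_iter M (E := ℝ) (f := fun p => F (p.2, p.1)) (hF.comp (contDiff_snd.prodMk contDiff_fst))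
  simp only at hexp
  have hco : ∀ i < M, ∀ j, iteratedDeriv j (g i) 0 = j.factorial * taylorCoeff2 (fun x y => F (x, y)) i j :=
    fun i hi j => tc_coef hF hg hq hexp hi j
  choose b hb hgb using fun i => taylor1 M (hg i)
  have hyt : Tendsto (fun x : ℝ => x ^ γ) (𝓝[>] 0) (𝓝 0) := by
    have := (Real.continuousAt_rpow_const 0 γ (Or.inr hγ.le)).tendsto
    rw [Real.zero_rpow hγ.ne'] at this
    exact this.mono_left nhdsWithin_le_nhds
  have hxt : Tendsto (fun x : ℝ => x) (𝓝[>] 0) (𝓝 0) := tendsto_id.mono_left nhdsWithin_le_nhds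
  set T : ℕ → ℕ → ℝ → ℝ := fun i j x => taylorCoeff2 (fun x y => F (x, y)) i j * x ^ ((i:ℝ) + γ * j) with hT
  have hFe : (fun x : ℝ => F (x, x ^ γ)) =ᶠ[𝓝[>] (0:ℝ)] fun x =>
      T p.1 p.2 x + ((∑ ij ∈ (Finset.range M ×ˢ Finset.range M).erase p, T ij.1 ij.2 x)
        + (∑ i ∈ Finset.range M, x ^ ((i:ℝ) + γ * M) * b i (x ^ γ) + x ^ (M:ℝ) * q (x ^ γ, x))) := by
    filter_upwards [self_mem_nhdsWithin] with x hx
    have hx : 0 < x := hx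
    have e1 : ∀ i j : ℕ, x ^ ((i:ℝ) + γ * j) = x ^ i * (x ^ γ) ^ j := fun i j => by
      rw [Real.rpow_add hx, Real.rpow_natCast, Real.rpow_mul hx.le, Real.rpow_natCast]
    rw [← add_assoc, Finset.add_sum_erase _ (fun ij : ℕ × ℕ => T ij.1 ij.2 x) (by simp [Finset.mem_product, hp1, hp2]), Finset.sum_product, hexp, ← add_assoc, ← Finset.sum_add_distrib, Real.rpow_natCast, smul_eq_mul]
    congr 1
    refine Finset.sum_congr rfl fun i hi => ?_
    rw [hgb i, smul_eq_mul, mul_add, Finset.mul_sum, e1]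
    congr 1
    · refine Finset.sum_congr rfl fun j hj => ?_
      rw [hT]
      simp only
      rw [hco i (Finset.mem_range.1 hi) j, e1]
      have : (j.factorial : ℝ) ≠ 0 := by positivity
      simp only [smul_eq_mul]
      field_simp
    · simp only [smul_eq_mul]; ring
  refine theta_congr (IsTheta.add_isLittleO ?_ ?_) hFe.symm
  · exact IsTheta.const_mul_left hp (isTheta_refl _ _)
  · refine IsLittleO.add ?_ (IsLittleO.add ?_ ?_)
    · refine IsLittleO.fun_sum fun ij hij => ?_
      by_cases hc : taylorCoeff2 (fun x y => F (x, y)) ij.1 ij.2 = 0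
      · simp only [hT, hc, zero_mul]; exact isLittleO_zero _ _
      · exact (rp_lt (hmin ij hc (Finset.ne_of_mem_erase hij))).const_mul_left _
    · refine IsLittleO.fun_sum fun i hi => ?_
      have h1 : (fun x : ℝ => b i (x ^ γ)) =O[𝓝[>] (0:ℝ)] fun _ => (1:ℝ) :=
        (((hb i).continuous.tendsto 0).comp hyt).isBigO_one ℝ
      have h2 := (rp_lt (a := h) (b := (i:ℝ) + γ * M) (by
        have : (0:ℝ) ≤ i := by positivity
        linarith)).mul_isBigO h1
      simpa using h2
    · have h1 : (fun x : ℝ => q (x ^ γ, x)) =O[𝓝[>] (0:ℝ)] fun _ => (1:ℝ) :=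
        ((hq.continuous.tendsto (0, 0)).comp (hyt.prodMk_nhds hxt)).isBigO_one ℝ
      have h2 := (rp_lt (a := h) (b := M) hM1).mul_isBigO h1
      simpa using h2

lemma npow_rp (n : ℕ) : (fun t : ℝ => t ^ n) = fun t : ℝ => t ^ (n:ℝ) := by
  funext t; rw [Real.rpow_natCast]

lemma rpc (γ : ℝ) : (fun t : ℝ => ((t ^ γ : ℝ) : ℂ)) =Θ[𝓝[>] (0:ℝ)] fun t => t ^ γ :=
  IsTheta.of_norm_eventuallyEq_norm (Eventually.of_forall fun t => by simp)

lemma sub_theta_flat {r : ℝ → ℂ} (hr : ∀ N : ℕ, r =O[𝓝[>] (0:ℝ)] fun t => t ^ N) (γ : ℝ) :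
    (fun t : ℝ => ((t ^ γ : ℝ) : ℂ) - r t) =Θ[𝓝[>] (0:ℝ)] fun t => t ^ γ := by
  obtain ⟨N, hN⟩ := exists_nat_gt γ
  have h1 := hr N
  rw [npow_rp] at h1
  have h2 := (h1.trans_isLittleO (rp_lt hN)).neg_left
  exact theta_congr ((rpc γ).add_isLittleO h2) (Eventually.of_forall fun t => (sub_eq_add_neg _ _).symm)

lemma sub_theta {r : ℝ → ℂ} {o : ℕ} (hr : r =Θ[𝓝[>] (0:ℝ)] fun t => t ^ o) {γ : ℝ} (hne : (o:ℝ) ≠ γ) :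
    (fun t : ℝ => ((t ^ γ : ℝ) : ℂ) - r t) =Θ[𝓝[>] (0:ℝ)] fun t => t ^ (min (o:ℝ) γ) := by
  rw [npow_rp] at hr
  rcases lt_or_gt_of_ne hne with h | h
  · rw [min_eq_left h.le]
    have h1 := ((rpc γ).1.trans_isLittleO (rp_lt h)).neg_left
    have h2 := hr.add_isLittleO h1
    exact (IsTheta.of_norm_eventuallyEq_norm (Eventually.of_forall fun t => by
      simp only [Pi.add_apply]; rw [← sub_eq_add_neg, norm_sub_rev])).trans h2
  · rw [min_eq_right h.le]
    have h1 := (hr.1.trans_isLittleO (rp_lt h)).neg_left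
    exact theta_congr ((rpc γ).add_isLittleO h1) (Eventually.of_forall fun t => (sub_eq_add_neg _ _).symm)

/-- the roots of a pure factor as continuous functions -/
lemma Pure.roots {m : ℕ} {p : ℝ → ℂ[X]} {c : ℝ → ℂ} (h : Pure m p c) :
    ∃ ρ : Fin m → ℝ → ℂ, (∀ j, ContinuousOn (ρ j) (Icc 0 1)) ∧ (∀ t ∈ Icc (0:ℝ) 1, p t = ∏ j, (X - C (ρ j t))) ∧
      ∀ j, ∀ N : ℕ, (fun t => ρ j t - c t) =O[𝓝[>] (0:ℝ)] fun t => t ^ N := by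
  obtain ⟨ρ, h1, h2⟩ := continuous_roots h.sp
  refine ⟨ρ, h1, h2, fun j N => ?_⟩
  obtain ⟨K, hK⟩ := h.close N
  refine IsBigO.of_bound K ?_
  filter_upwards [hK, Ioo_mem_nhdsGT (one_pos : (0:ℝ) < 1)] with t ht ht1
  have := ht (ρ j t) (by
    rw [h2 t ⟨ht1.1.le, ht1.2.le⟩, IsRoot.def, eval_prod]
    exact Finset.prod_eq_zero (Finset.mem_univ j) (by simp))
  rwa [Real.norm_of_nonneg (pow_nonneg ht1.1.le _)]

lemma flat_root {r c : ℝ → ℂ} (hr : ∀ N : ℕ, (fun t => r t - c t) =O[𝓝[>] (0:ℝ)] fun t => t ^ N) (hc : Flat c) (N : ℕ) :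
    r =O[𝓝[>] (0:ℝ)] fun t => t ^ N := by
  have := (hr N).add ((hc.isBigO N).mono nhdsWithin_le_nhds)
  simpa using this

lemma ord_root {r c : ℝ → ℂ} (hr : ∀ N : ℕ, (fun t => r t - c t) =O[𝓝[>] (0:ℝ)] fun t => t ^ N)
    {o : ℕ} {b : ℝ → ℂ} (hb : ContDiff ℝ ∞ b) (hb0 : b 0 ≠ 0) (hc : ∀ t, c t = t ^ o • b t) :
    r =Θ[𝓝[>] (0:ℝ)] fun t => t ^ o := by
  have h1 : (fun t => r t - c t) =o[𝓝[>] (0:ℝ)] fun t => t ^ o := by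
    have := hr (o + 1)
    rw [npow_rp] at this ⊢
    exact this.trans_isLittleO (rp_lt (by push_cast; linarith))
  have h2 : c =Θ[𝓝[>] (0:ℝ)] fun t => t ^ o := by
    have hbt : Tendsto b (𝓝[>] 0) (𝓝 (b 0)) := (hb.continuous.tendsto 0).mono_left nhdsWithin_le_nhds
    have h3 : b =Θ[𝓝[>] (0:ℝ)] fun _ => (1:ℝ) :=
      ((isEquivalent_const_iff_tendsto hb0).2 hbt).isTheta.trans (isTheta_const_const hb0 one_ne_zero)
    have h4 := (isTheta_refl (fun t : ℝ => t ^ o) (𝓝[>] (0:ℝ))).smul h3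
    simp only [smul_eq_mul, mul_one] at h4
    exact theta_congr h4 (Eventually.of_forall fun t => (hc t).symm)
  exact theta_congr (h2.add_isLittleO h1) (Eventually.of_forall fun t => by simp)

end NP

namespace NP
open scoped ContDiff Topology
open Polynomial

/-- Taylor coefficients of a curve -/
def ser (c : ℝ → ℂ) (m : ℕ) : ℂ := ((m.factorial : ℝ))⁻¹ • iteratedDeriv m c 0

def ord (c : ℝ → ℂ) : ℕ := sInf {m | ser c m ≠ 0}

lemma ser_flat {c : ℝ → ℂ} (hc : ContDiff ℝ ∞ c) (h : ser c = 0) : Flat c := by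
  refine flat_of_coef hc fun j => ?_
  have := congrFun h j
  simp only [ser, Pi.zero_apply, smul_eq_zero, inv_eq_zero, Nat.cast_eq_zero] at this
  rcases this with h | h
  · exact absurd h (Nat.factorial_ne_zero j)
  · exact h

lemma ser_ord_ne {c : ℝ → ℂ} (h : ser c ≠ 0) : ser c (ord c) ≠ 0 := by
  have : {m | ser c m ≠ 0}.Nonempty := by
    by_contra hn
    rw [not_nonempty_iff_eq_empty] at hn
    apply h
    funext m
    by_contra hm
    have : m ∈ {m | ser c m ≠ 0} := hm
    rw [hn] at this
    exact this
  exact Nat.sInf_mem this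

lemma ser_lt_ord {c : ℝ → ℂ} {m : ℕ} (hm : m < ord c) : ser c m = 0 := by
  by_contra h
  exact Nat.notMem_of_lt_sInf hm h

lemma ord_div {c : ℝ → ℂ} (hc : ContDiff ℝ ∞ c) (h : ser c ≠ 0) :
    ∃ b, ContDiff ℝ ∞ b ∧ b 0 ≠ 0 ∧ ∀ t, c t = t ^ (ord c) • b t := by
  obtain ⟨u, hu, hu0, hcu⟩ := div_of_coef hc (ord c) (fun j hj => by
    have := ser_lt_ord hj
    simp only [ser, smul_eq_zero, inv_eq_zero, Nat.cast_eq_zero] at this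
    rcases this with h | h
    · exact absurd h (Nat.factorial_ne_zero j)
    · exact h)
  exact ⟨u, hu, by rw [hu0]; exact ser_ord_ne h, hcu⟩

lemma theta_congr_right {E G : Type} [NormedAddCommGroup E] [NormedAddCommGroup G] {l : Filter ℝ} {f : ℝ → E} {g1 g2 : ℝ → G}
    (h : f =Θ[l] g1) (he : g1 =ᶠ[l] g2) : f =Θ[l] g2 := (theta_congr h.symm he).symm

/-- exponent of `y - root` along `y = t^γ` -/
def ex (c : ℝ → ℂ) (γ : ℝ) : ℝ := if ser c = 0 then γ else min (ord c : ℝ) γ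

lemma pure_theta {m : ℕ} {p : ℝ → ℂ[X]} {c : ℝ → ℂ} (h : Pure m p c) {γ : ℝ} (hne : (ord c : ℝ) ≠ γ) :
    (fun t : ℝ => (p t).eval ((t ^ γ : ℝ) : ℂ)) =Θ[𝓝[>] (0:ℝ)] fun t => t ^ (m * ex c γ) := by
  obtain ⟨ρ, _, h2, h3⟩ := h.roots
  have key : ∀ j, (fun t : ℝ => ((t ^ γ : ℝ) : ℂ) - ρ j t) =Θ[𝓝[>] (0:ℝ)] fun t => t ^ (ex c γ) := by
    intro j
    unfold ex
    split_ifs with hs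
    · exact sub_theta_flat (flat_root (h3 j) (ser_flat h.smooth hs)) γ
    · obtain ⟨b, hb, hb0, hcb⟩ := ord_div h.smooth hs
      exact sub_theta (ord_root (h3 j) hb hb0 hcb) hne
  have := IsTheta.finsetProd (s := Finset.univ) (fun j _ => key j)
  refine theta_congr_right (theta_congr this ?_) ?_
  · filter_upwards [Ioo_mem_nhdsGT (one_pos : (0:ℝ) < 1)] with t ht
    rw [h2 t ⟨ht.1.le, ht.2.le⟩, eval_prod]
    simp
  · filter_upwards [self_mem_nhdsWithin] with t ht
    have ht : 0 < t := ht
    rw [Finset.prod_const, Finset.card_univ, Fintype.card_fin, mul_comm, Real.rpow_mul ht.le, Real.rpow_natCast]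

lemma tendsto_pow_pos {N : ℕ} (hN : 0 < N) : Tendsto (fun t : ℝ => t ^ N) (𝓝[>] 0) (𝓝[>] 0) := by
  refine tendsto_nhdsWithin_iff.2 ⟨?_, ?_⟩
  · have : Tendsto (fun t : ℝ => t ^ N) (𝓝 0) (𝓝 (0 ^ N)) := (continuous_pow N).tendsto 0
    rw [zero_pow hN.ne'] at this
    exact this.mono_left nhdsWithin_le_nhds
  · filter_upwards [self_mem_nhdsWithin] with t ht
    have ht : 0 < t := ht
    exact pow_pos ht N

lemma rpow_tendsto_zero {γ : ℝ} (hγ : 0 < γ) : Tendsto (fun x : ℝ => x ^ γ) (𝓝[>] 0) (𝓝 0) := by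
  have := (Real.continuousAt_rpow_const 0 γ (Or.inr hγ.le)).tendsto
  rw [Real.zero_rpow hγ.ne'] at this
  exact this.mono_left nhdsWithin_le_nhds

lemma Q_theta {A : ℕ} {lam : Fin A → ℝ → ℝ} (hlam : ∀ j, ∀ N : ℕ, lam j =O[𝓝 0] fun t => t ^ N) {γ : ℝ} (hγ : 0 < γ) :
    (fun x : ℝ => x ^ A + ∑ j : Fin A, lam j (x ^ γ) * x ^ (j:ℕ)) =Θ[𝓝[>] (0:ℝ)] fun x => x ^ (A:ℝ) := by
  have h0 : (fun x : ℝ => x ^ A) =Θ[𝓝[>] (0:ℝ)] fun x => x ^ (A:ℝ) := by rw [npow_rp]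
  refine h0.add_isLittleO (IsLittleO.fun_sum fun j _ => ?_)
  obtain ⟨L, hL⟩ := exists_nat_gt ((A:ℝ) / γ)
  rw [div_lt_iff₀ hγ] at hL
  have h1 := (hlam j L).comp_tendsto (rpow_tendsto_zero hγ)
  have h2 : (fun x : ℝ => x ^ (j:ℕ)) =O[𝓝[>] (0:ℝ)] fun _ => (1:ℝ) :=
    (((continuous_pow (j:ℕ)).tendsto (0:ℝ)).mono_left nhdsWithin_le_nhds).isBigO_one ℝ
  have h3 := h1.mul h2
  refine (h3.trans_isLittleO ?_)
  refine (rp_lt (a := A) (b := γ * L) (by linarith)).congr' ?_ EventuallyEq.rfl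
  filter_upwards [self_mem_nhdsWithin] with t ht
  have ht : 0 < t := ht
  simp only [Function.comp_apply, mul_one]
  rw [Real.rpow_mul ht.le, Real.rpow_natCast]

lemma mkp_eval {a : ℕ} (u : Fin a → ℂ) (y : ℂ) : (mkp u).eval y = y ^ a + ∑ j : Fin a, u j * y ^ (j:ℕ) := by
  simp [mkp, lin, eval_finsetSum]

/-- the comparison of exponents -/
lemma ident {F : ℝ × ℝ → ℝ} (hF : ContDiff ℝ ∞ F) {A n : ℕ} {U : ℝ × ℝ → ℝ} {lam : Fin A → ℝ → ℝ} {mu : Fin n → ℝ → ℝ}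
    (hU : ContDiff ℝ ∞ U) (hU0 : U 0 ≠ 0) (hlam : ∀ j, ∀ N : ℕ, lam j =O[𝓝 0] fun t => t ^ N)
    (hfac : ∀ᶠ p in 𝓝 (0 : ℝ × ℝ), F p = U p * (p.1 ^ A + ∑ j : Fin A, lam j p.2 * p.1 ^ (j:ℕ)) * (p.2 ^ n + ∑ j : Fin n, mu j p.1 * p.2 ^ (j:ℕ)))
    {N : ℕ} (hN : 0 < N) {k : ℕ} {m : Fin k → ℕ} {p : Fin k → ℝ → ℂ[X]} {c : Fin k → ℝ → ℂ} (hp : ∀ i, Pure (m i) (p i) (c i))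
    (hP : ∀ᶠ t in 𝓝[>] (0:ℝ), mkp (fun j : Fin n => (mu j (t ^ N) : ℂ)) = ∏ i, p i t)
    {γ : ℝ} (hγ : 0 < γ) (hirr : Irrational γ) {q : ℕ × ℕ}
    (hq : taylorCoeff2 (fun x y => F (x, y)) q.1 q.2 ≠ 0)
    (hmin : ∀ q' : ℕ × ℕ, taylorCoeff2 (fun x y => F (x, y)) q'.1 q'.2 ≠ 0 → q' ≠ q → (q.1:ℝ) + γ * q.2 < q'.1 + γ * q'.2) :
    N * ((q.1:ℝ) + γ * q.2) = N * A + ∑ i, m i * ex (c i) (N * γ) := by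
  have hFθ := F_theta hF hγ hq hmin
  have hF1 : (fun t : ℝ => F (t ^ N, (t ^ N) ^ γ)) =Θ[𝓝[>] (0:ℝ)] fun t : ℝ => (t ^ N) ^ ((q.1:ℝ) + γ * q.2) :=
    ⟨hFθ.1.comp_tendsto (tendsto_pow_pos hN), hFθ.2.comp_tendsto (tendsto_pow_pos hN)⟩
  have hQθ := Q_theta hlam hγ
  have hQ1 : (fun t : ℝ => (t ^ N) ^ A + ∑ j : Fin A, lam j ((t ^ N) ^ γ) * (t ^ N) ^ (j:ℕ)) =Θ[𝓝[>] (0:ℝ)] fun t : ℝ => (t ^ N) ^ (A : ℝ) :=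
    ⟨hQθ.1.comp_tendsto (tendsto_pow_pos hN), hQθ.2.comp_tendsto (tendsto_pow_pos hN)⟩
  have hpt : Tendsto (fun t : ℝ => ((t ^ N, (t ^ N) ^ γ) : ℝ × ℝ)) (𝓝[>] 0) (𝓝 0) := by
    have h1 := (tendsto_pow_pos hN).mono_right (nhdsWithin_le_nhds (a := (0:ℝ)) (s := Ioi 0))
    have h2 := (rpow_tendsto_zero hγ).comp (tendsto_pow_pos hN)
    exact h1.prodMk_nhds h2
  have hU1 : (fun t : ℝ => U (t ^ N, (t ^ N) ^ γ)) =Θ[𝓝[>] (0:ℝ)] fun _ => (1:ℝ) :=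
    ((isEquivalent_const_iff_tendsto hU0).2 ((hU.continuous.tendsto 0).comp hpt)).isTheta.trans (isTheta_const_const hU0 one_ne_zero)
  have hP1 : (fun t : ℝ => ∏ i, (p i t).eval ((t ^ (N * γ) : ℝ) : ℂ)) =Θ[𝓝[>] (0:ℝ)] fun t => ∏ i, t ^ (m i * ex (c i) (N * γ)) := by
    refine IsTheta.finsetProd fun i _ => pure_theta (hp i) fun h => ?_
    have h1 := (hirr.natCast_mul hN.ne').ne_nat (ord (c i))
    exact h1 h.symm
  have hP2 : (fun t : ℝ => ((t ^ N) ^ γ) ^ n + ∑ j : Fin n, mu j (t ^ N) * ((t ^ N) ^ γ) ^ (j:ℕ)) =Θ[𝓝[>] (0:ℝ)] fun t => ∏ i, t ^ (m i * ex (c i) (N * γ)) := by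
    refine IsTheta.trans (IsTheta.of_norm_eventuallyEq_norm ?_) hP1
    filter_upwards [hP, self_mem_nhdsWithin] with t ht ht0
    have ht0 : 0 < t := ht0
    rw [← eval_prod, ← ht, mkp_eval]
    have e : t ^ ((N:ℝ) * γ) = (t ^ N) ^ γ := by rw [Real.rpow_mul ht0.le, Real.rpow_natCast]
    rw [e, ← Complex.norm_real]
    push_cast
    rfl
  have hall := (hU1.mul hQ1).mul hP2
  have hall2 := theta_congr hall ((hpt.eventually hfac).mono fun t ht => ht.symm)
  have h4 := hF1.symm.trans hall2
  have h5 : (fun t : ℝ => t ^ (N * ((q.1:ℝ) + γ * q.2))) =Θ[𝓝[>] (0:ℝ)] fun t => t ^ (N * A + ∑ i, m i * ex (c i) (N * γ)) := by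
    refine theta_congr_right (theta_congr h4 ?_) ?_
    · filter_upwards [self_mem_nhdsWithin] with t ht0
      have ht0 : 0 < t := ht0
      rw [Real.rpow_mul ht0.le, Real.rpow_natCast]
    · filter_upwards [self_mem_nhdsWithin] with t ht0
      have ht0 : 0 < t := ht0
      rw [one_mul, Real.rpow_add ht0, Real.rpow_mul ht0.le, Real.rpow_natCast t N, Real.rpow_sum_of_pos ht0]
  exact rp_inj h5

end NP

namespace NP
open scoped ContDiff Topology
open Polynomial

lemma SP.prod {ι : Type*} (S : Finset ι) {m : ι → ℕ} {p : ι → ℝ → ℂ[X]} (h : ∀ i, SP (m i) (p i)) :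
    SP (∑ i ∈ S, m i) (fun t => ∏ i ∈ S, p i t) := by
  induction S using Finset.induction_on with
  | empty => simpa using SP.one
  | insert a S ha ih =>
    simp only [Finset.prod_insert ha, Finset.sum_insert ha]
    exact (h a).mul ih

lemma SP.eq_at_zero {a b : ℕ} {p q : ℝ → ℂ[X]} (hp : SP a p) (hq : SP b q) (h : ∀ᶠ t in 𝓝[>] (0:ℝ), p t = q t) :
    p 0 = q 0 := by
  ext i
  have h1 := ((hp.smooth i).continuous.tendsto 0).mono_left (nhdsWithin_le_nhds (s := Ioi (0:ℝ)))
  have h2 := ((hq.smooth i).continuous.tendsto 0).mono_left (nhdsWithin_le_nhds (s := Ioi (0:ℝ)))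
  exact tendsto_nhds_unique (h1.congr' (h.mono fun t ht => by rw [ht])) h2

lemma SP.deg_eq {a b : ℕ} {p q : ℝ → ℂ[X]} (hp : SP a p) (hq : SP b q) (h : ∀ᶠ t in 𝓝[>] (0:ℝ), p t = q t) :
    a = b := by
  rw [← hp.deg 0, ← hq.deg 0, hp.eq_at_zero hq h]

lemma SP_mu {n : ℕ} {mu : Fin n → ℝ → ℝ} (hmu : ∀ j, ContDiff ℝ ∞ (mu j)) :
    SP n (fun t => mkp (fun j : Fin n => (mu j t : ℂ))) :=
  SP_mkp (contDiff_pi.2 fun j => Complex.ofRealCLM.contDiff.comp (hmu j))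

lemma ord_pos {n : ℕ} {mu : Fin n → ℝ → ℝ} (hmu : ∀ j, ContDiff ℝ ∞ (mu j)) (hmu0 : ∀ j, mu j 0 = 0)
    {N : ℕ} (hN : 0 < N) {k : ℕ} {m : Fin k → ℕ} {p : Fin k → ℝ → ℂ[X]} {c : Fin k → ℝ → ℂ} (hp : ∀ i, Pure (m i) (p i) (c i))
    (hP : ∀ᶠ t in 𝓝[>] (0:ℝ), mkp (fun j : Fin n => (mu j (t ^ N) : ℂ)) = ∏ i, p i t)
    (i : Fin k) (hm : 0 < m i) (hs : ser (c i) ≠ 0) : 0 < ord (c i) := by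
  have h0 := ((SP_mu hmu).comp_smooth (f := fun t => t ^ N) (by fun_prop)).eq_at_zero
    (SP.prod Finset.univ fun i => (hp i).sp) hP
  simp only [zero_pow hN.ne', hmu0] at h0
  obtain ⟨ρ, h1, h2, h3⟩ := (hp i).roots
  have hr : ρ ⟨0, hm⟩ 0 = 0 := by
    have hroot : (mkp (fun j : Fin n => ((0:ℝ) : ℂ))).eval (ρ ⟨0, hm⟩ 0) = 0 := by
      rw [h0, eval_prod]
      apply Finset.prod_eq_zero (Finset.mem_univ i)
      rw [h2 0 (by simp), eval_prod]
      apply Finset.prod_eq_zero (Finset.mem_univ ⟨0, hm⟩)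
      simp
    rw [mkp_eval] at hroot
    simp only [Complex.ofReal_zero, zero_mul, Finset.sum_const_zero, add_zero] at hroot
    exact eq_zero_of_pow_eq_zero hroot
  have hc0 : c i 0 = 0 := by
    have t1 : Tendsto (ρ ⟨0, hm⟩) (𝓝[>] 0) (𝓝 0) := by
      have := (h1 ⟨0, hm⟩ 0 (by simp)).tendsto
      rw [hr] at this
      refine this.mono_left ?_
      rw [nhdsWithin_le_iff]
      exact mem_of_superset (Ioo_mem_nhdsGT (one_pos : (0:ℝ) < 1)) Ioo_subset_Icc_self
    have t2 : Tendsto (fun t => ρ ⟨0, hm⟩ t - c i t) (𝓝[>] 0) (𝓝 0) := by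
      refine (h3 ⟨0, hm⟩ 1).trans_tendsto ?_
      simp only [pow_one]
      exact (tendsto_id (x := 𝓝 (0:ℝ))).mono_left nhdsWithin_le_nhds
    have t3 := t1.sub t2
    simp only [sub_sub_cancel, sub_zero] at t3
    exact tendsto_nhds_unique (((hp i).smooth.continuous.tendsto 0).mono_left nhdsWithin_le_nhds) t3
  rw [Nat.pos_iff_ne_zero]
  intro ho
  have := ser_ord_ne hs
  rw [ho] at this
  apply this
  simp [ser, hc0]

def lab (N : ℕ) (c : ℝ → ℂ) : Option ℝ := if ser c = 0 then none else some (ord c / N)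

lemma ex_lab {c : ℝ → ℂ} {N : ℕ} (hN : 0 < N) (γ m : ℝ) :
    m * ex c (N * γ) = m * (N * γ) + N * ((if ser c = 0 then 0 else m) * min ((ord c : ℝ) / N - γ) 0) := by
  have hN' : (0:ℝ) < N := by exact_mod_cast hN
  unfold ex
  split_ifs with h
  · simp
  · rcases le_total (ord c : ℝ) (N * γ) with h1 | h1
    · rw [min_eq_left h1, min_eq_left]
      · field_simp; ring
      · rw [sub_nonpos, div_le_iff₀ hN']; linarith
    · rw [min_eq_right h1, min_eq_right]
      · ring
      · rw [sub_nonneg, le_div_iff₀ hN']; linarith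

lemma fib_last {ι κ β : Type} [Fintype ι] [Fintype κ] (f : ι → β) (g : κ → β) (b0 : β)
    (hc : Fintype.card ι = Fintype.card κ)
    (h : ∀ b ≠ b0, (Finset.univ.filter fun i => f i = b).card = (Finset.univ.filter fun i => g i = b).card) (b : β) :
    (Finset.univ.filter fun i => f i = b).card = (Finset.univ.filter fun i => g i = b).card := by
  by_cases hb : b = b0
  swap
  · exact h b hb
  subst hb
  let T : Finset β := insert b (Finset.univ.image f ∪ Finset.univ.image g)
  have h1 := Finset.card_eq_sum_card_fiberwise (s := Finset.univ) (t := T) (f := f) (fun i _ => by simp [T])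
  have h2 := Finset.card_eq_sum_card_fiberwise (s := Finset.univ) (t := T) (f := g) (fun i _ => by simp [T])
  rw [Finset.card_univ] at h1 h2
  rw [← Finset.add_sum_erase T _ (show b ∈ T by simp [T])] at h1 h2
  have h3 : ∑ x ∈ T.erase b, (Finset.univ.filter fun i => f i = x).card = ∑ x ∈ T.erase b, (Finset.univ.filter fun i => g i = x).card :=
    Finset.sum_congr rfl fun x hx => h x (Finset.ne_of_mem_erase hx)
  omega

lemma card_sigma_fib {β : Type} {k : ℕ} (m : Fin k → ℕ) (f : Fin k → β) (b : β) :
    (Finset.univ.filter fun x : (Σ i, Fin (m i)) => f x.1 = b).card = ∑ i, if f i = b then m i else 0 := by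
  have : (Finset.univ.filter fun x : (Σ i, Fin (m i)) => f x.1 = b) = (Finset.univ.filter fun i => f i = b).sigma fun i => Finset.univ := by
    ext ⟨i, j⟩; simp
  rw [this, Finset.card_sigma, Finset.sum_filter]
  simp

lemma card_sum_fib {β : Type} {B k : ℕ} (m : Fin k → ℕ) (b0 : β) (f : Fin k → β) (b : β) (hb : b ≠ b0) :
    (Finset.univ.filter fun x : (Fin B ⊕ (Σ i, Fin (m i))) => Sum.elim (fun _ => b0) (fun y => f y.1) x = b).card = ∑ i, if f i = b then m i else 0 := by
  rw [← card_sigma_fib]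
  refine Eq.trans ?_ (Finset.card_map (Function.Embedding.inr (α := Fin B)))
  refine congrArg Finset.card (Finset.ext fun x => ?_)
  rcases x with x | x
  · simp [hb.symm]
  · simp

/-- bijection between roots -/
lemma exists_equiv {F : ℝ × ℝ → ℝ} (hF : ContDiff ℝ ∞ F) {kk : ℕ} {v : Fin (kk + 1) → ℕ × ℕ}
    (hmono : StrictMono fun i => (v i).1)
    (hanti : StrictAnti fun i => (v i).2)
    (hvert : Set.extremePoints ℝ (newtonPolygonOf fun x y => F (x, y))
      = Set.range fun i => (((v i).1 : ℝ), ((v i).2 : ℝ)))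
    {U : ℝ × ℝ → ℝ} {lam : Fin (v 0).1 → ℝ → ℝ} {mu : Fin (v 0).2 → ℝ → ℝ}
    (hU : ContDiff ℝ ∞ U) (hU0 : U 0 ≠ 0) (hlam : ∀ j, ∀ N : ℕ, lam j =O[𝓝 0] fun t => t ^ N)
    (hmu : ∀ j, ContDiff ℝ ∞ (mu j)) (hmu0 : ∀ j, mu j 0 = 0)
    (hfac : ∀ᶠ p in 𝓝 (0 : ℝ × ℝ), F p = U p * (p.1 ^ (v 0).1 + ∑ j : Fin (v 0).1, lam j p.2 * p.1 ^ (j:ℕ)) * (p.2 ^ (v 0).2 + ∑ j : Fin (v 0).2, mu j p.1 * p.2 ^ (j:ℕ)))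
    {N : ℕ} (hN : 0 < N) {k : ℕ} {m : Fin k → ℕ} {p : Fin k → ℝ → ℂ[X]} {c : Fin k → ℝ → ℂ} (hp : ∀ i, Pure (m i) (p i) (c i))
    (hP : ∀ᶠ t in 𝓝[>] (0:ℝ), mkp (fun j : Fin (v 0).2 => (mu j (t ^ N) : ℂ)) = ∏ i, p i t) :
    ∃ e : (Σ i, Fin (m i)) ≃ (Fin (v (Fin.last kk)).2 ⊕ (Σ α, Fin (edgeMult v α))),
      ∀ x, Sum.elim (fun _ => none) (fun y => some (edgeSlope v y.1)) (e x) = lab N (c x.1) := by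
  have hN' : (0:ℝ) < N := by exact_mod_cast hN
  have hsum : ∑ i, m i = (v 0).2 :=
    (((SP_mu hmu).comp_smooth (f := fun t => t ^ N) (by fun_prop)).deg_eq (SP.prod Finset.univ fun i => (hp i).sp) hP).symm
  apply equiv_of_fib (fun x : (Σ i, Fin (m i)) => lab N (c x.1))
  have key : ∀ γ > 0, Irrational γ → ∑ i, (if ser (c i) = 0 then 0 else (m i : ℝ)) * min ((ord (c i) : ℝ) / N - γ) 0
      = ∑ β : Fin kk, (edgeMult v β : ℝ) * min (edgeSlope v β - γ) 0 := by
    intro γ hγ hirr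
    obtain ⟨q, hq, hmin, hval⟩ := np_min hmono hanti hvert hγ hirr
    have := ident hF hU hU0 hlam hfac hN hp hP hγ hirr hq (fun q' h1 h2 => hmin q' h1 h2)
    simp only [ex_lab hN] at this
    rw [Finset.sum_add_distrib, ← Finset.sum_mul, ← Finset.mul_sum, ← Nat.cast_sum, hsum, hval] at this
    have h2 : (N:ℝ) * (∑ β : Fin kk, (edgeMult v β : ℝ) * min (edgeSlope v β - γ) 0) = N * (∑ i, (if ser (c i) = 0 then 0 else (m i : ℝ)) * min ((ord (c i) : ℝ) / N - γ) 0) := by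
      linarith
    exact (mul_left_cancel₀ hN'.ne' h2).symm
  refine fib_last _ _ none ?_ ?_
  · simp only [Fintype.card_sigma, Fintype.card_fin, Fintype.card_sum]
    rw [hsum, ← totalDeg_eq hanti, totalDeg]
  · intro b hb
    obtain ⟨w0, rfl⟩ := Option.ne_none_iff_exists'.1 hb
    rw [card_sigma_fib m (fun i => lab N (c i)), card_sum_fib _ _ (fun α => some (edgeSlope v α)) _ hb]
    rcases lt_or_ge 0 w0 with h0 | h0
    · have h1 := count_eq _ _ _ _ key h0
      have : ((∑ i, if lab N (c i) = some w0 then m i else 0 : ℕ) : ℝ) = ((∑ i, if some (edgeSlope v i) = some w0 then edgeMult v i else 0 : ℕ) : ℝ) := by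
        push_cast
        simp only [Option.some.injEq]
        rw [← h1]
        refine Finset.sum_congr rfl fun i _ => ?_
        unfold lab
        by_cases hs : ser (c i) = 0
        · simp [hs]
        · simp [hs]
      have := Nat.cast_injective this
      convert this
    · rw [Finset.sum_eq_zero, Finset.sum_eq_zero]
      · intro α _
        rw [if_neg]
        intro h
        have := edgeSlope_pos hmono hanti α
        simp only [Option.some.injEq] at h
        linarith
      · intro i _
        split_ifs with h
        · by_contra hm
          unfold lab at h
          split_ifs at h with hs
          have := ord_pos hmu hmu0 hN hp hP i (Nat.pos_of_ne_zero hm) hs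
          simp only [Option.some.injEq] at h
          have : 0 < (ord (c i) : ℝ) / N := by positivity
          linarith
        · rfl

end NP

namespace NP
open scoped ContDiff Topology
open Polynomial

lemma globalize2 {f : ℝ × ℝ → ℝ}
    (h : ∀ᶠ t in 𝓝 (0:ℝ × ℝ), ContDiffAt ℝ ∞ f t) : ∃ g : ℝ × ℝ → ℝ, ContDiff ℝ ∞ g ∧ g =ᶠ[𝓝 0] f := by
  obtain ⟨χ, h1, -, h2, h3⟩ := exists_clamp
  obtain ⟨r, hr, hb⟩ := Metric.eventually_nhds_iff.1 h
  refine ⟨fun t => f (r / 3 * χ (3 / r * t.1), r / 3 * χ (3 / r * t.2)), ?_, ?_⟩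
  · rw [contDiff_iff_contDiffAt]
    intro t
    have hd : ∀ s : ℝ, |r / 3 * χ (3 / r * s)| < r := by
      intro s
      rw [abs_mul, abs_of_pos (by positivity : (0:ℝ) < r / 3)]
      nlinarith [h3 (3 / r * s)]
    refine ContDiffAt.comp (g := f) (f := fun t : ℝ × ℝ => (r / 3 * χ (3 / r * t.1), r / 3 * χ (3 / r * t.2))) t (hb ?_) ?_
    · rw [dist_zero_right, Prod.norm_def, max_lt_iff]
      exact ⟨hd _, hd _⟩
    · exact ((contDiff_const.mul (h1.comp (contDiff_const.mul contDiff_fst))).prodMk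
        (contDiff_const.mul (h1.comp (contDiff_const.mul contDiff_snd)))).contDiffAt
  · have t1 : ∀ᶠ t in 𝓝 (0:ℝ × ℝ), |3 / r * t.1| < 1 := by
      have hc : ContinuousAt (fun t : ℝ × ℝ => |3 / r * t.1|) 0 := by fun_prop
      exact hc.eventually_lt_const (by simp)
    have t2 : ∀ᶠ t in 𝓝 (0:ℝ × ℝ), |3 / r * t.2| < 1 := by
      have hc : ContinuousAt (fun t : ℝ × ℝ => |3 / r * t.2|) 0 := by fun_prop
      exact hc.eventually_lt_const (by simp)
    filter_upwards [t1, t2] with t ht1 ht2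
    rw [h2 _ ht1.le, h2 _ ht2.le]
    congr 1
    ext
    · simp only; field_simp
    · simp only; field_simp

lemma tc_congr {F G : ℝ × ℝ → ℝ} (h : F =ᶠ[𝓝 0] G) (i j : ℕ) :
    taylorCoeff2 (fun x y => F (x, y)) i j = taylorCoeff2 (fun x y => G (x, y)) i j := by
  unfold taylorCoeff2
  congr 1
  apply Filter.EventuallyEq.iteratedDeriv_eq
  have h' : ∀ᶠ p in 𝓝 ((0:ℝ), (0:ℝ)), F p = G p := h
  rw [nhds_prod_eq] at h'
  filter_upwards [h'.curry] with x hx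
  exact Filter.EventuallyEq.iteratedDeriv_eq _ hx

lemma root_tendsto {N : ℕ} (hN : 0 < N) : Tendsto (fun x : ℝ => x ^ (1 / (N:ℝ))) (𝓝[>] 0) (𝓝[>] 0) := by
  refine tendsto_nhdsWithin_iff.2 ⟨rpow_tendsto_zero (by positivity), ?_⟩
  filter_upwards [self_mem_nhdsWithin] with t ht
  have ht : 0 < t := ht
  exact Real.rpow_pos_of_pos ht _

lemma root_pow {N : ℕ} (hN : 0 < N) {x : ℝ} (hx : 0 ≤ x) : (x ^ (1 / (N:ℝ))) ^ N = x := by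
  rw [one_div, Real.rpow_inv_natCast_pow hx hN.ne']

lemma pow_root {N : ℕ} (hN : 0 < N) {x : ℝ} (hx : 0 ≤ x) : (x ^ N) ^ (1 / (N:ℝ)) = x := by
  rw [one_div, Real.pow_rpow_inv_natCast hx hN.ne']

lemma expansion {N : ℕ} (hN : 0 < N) {r c : ℝ → ℂ} (hc : ContDiff ℝ ∞ c)
    (hr : ∀ M : ℕ, (fun t => r t - c t) =O[𝓝[>] (0:ℝ)] fun t => t ^ M) :
    HasPuiseuxExpansion (fun x => r (x ^ (1 / (N:ℝ)))) (1 / (N:ℝ)) (ser c) := by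
  intro M
  obtain ⟨b, hb, h⟩ := taylor1 (M + 1) hc
  have h1 : (fun t : ℝ => t ^ (M+1) • b t) =O[𝓝[>] (0:ℝ)] fun t => t ^ (M + 1) := by
    have := (isBigO_refl (fun t : ℝ => t ^ (M + 1)) (𝓝[>] (0:ℝ))).smul
      ((hb.continuous.continuousAt (x := 0)).isBigO_one ℝ |>.mono (nhdsWithin_le_nhds (s := Ioi 0)))
    simpa using this
  have h2 := ((hr (M + 1)).add h1).comp_tendsto (root_tendsto hN)
  refine h2.congr' ?_ ?_
  · filter_upwards [self_mem_nhdsWithin] with x hx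
    have hx : 0 < x := hx
    simp only [Function.comp_apply]
    conv_lhs => rw [h (x ^ (1 / (N:ℝ)))]
    have : ∑ j ∈ Finset.range (M + 1), (x ^ (1 / (N:ℝ))) ^ j • (((j.factorial : ℝ))⁻¹ • iteratedDeriv j c 0)
        = ∑ m ∈ Finset.range (M + 1), ser c m * ((x ^ ((m : ℝ) * (1 / (N:ℝ))) : ℝ) : ℂ) := by
      refine Finset.sum_congr rfl fun j _ => ?_
      rw [mul_comm (j:ℝ), Real.rpow_mul hx.le, Real.rpow_natCast, ser, Complex.real_smul, mul_comm]
    rw [this]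
    ring
  · filter_upwards [self_mem_nhdsWithin] with x hx
    have hx : 0 < x := hx
    simp only [Function.comp_apply]
    rw [mul_comm, Real.rpow_mul hx.le, ← Real.rpow_natCast _ (M+1)]
    push_cast
    rfl

lemma flat_comp_root {N : ℕ} (hN : 0 < N) {r : ℝ → ℂ}
    (hr : ∀ M : ℕ, r =O[𝓝[>] (0:ℝ)] fun t => t ^ M) (M : ℕ) :
    (fun x => r (x ^ (1 / (N:ℝ)))) =O[𝓝[>] (0:ℝ)] fun t => t ^ M := by
  refine ((hr (N * M)).comp_tendsto (root_tendsto hN)).congr' EventuallyEq.rfl ?_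
  filter_upwards [self_mem_nhdsWithin] with x hx
  have hx : 0 < x := hx
  simp only [Function.comp_apply]
  rw [pow_mul, root_pow hN hx.le]

lemma cont_comp_root {N : ℕ} (hN : 0 < N) {r : ℝ → ℂ} (hr : ContinuousOn r (Icc 0 1)) {ε : ℝ} (hε : ε ≤ 1) :
    ContinuousOn (fun x => r (x ^ (1 / (N:ℝ)))) (Ico 0 ε) := by
  have h0 : 0 ≤ 1 / (N:ℝ) := by positivity
  refine hr.comp (Real.continuous_rpow_const h0).continuousOn fun x hx => ?_
  exact ⟨Real.rpow_nonneg hx.1 _, Real.rpow_le_one hx.1 (hx.2.le.trans hε) h0⟩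

lemma ser_sub {c d : ℝ → ℂ} (hc : ContDiff ℝ ∞ c) (hd : ContDiff ℝ ∞ d) : ser (c - d) = ser c - ser d := by
  funext m
  simp only [ser, Pi.sub_apply]
  rw [iteratedDeriv_sub (hc.of_le (by exact_mod_cast le_top)).contDiffAt (hd.of_le (by exact_mod_cast le_top)).contDiffAt, smul_sub]

lemma ser_conj {c : ℝ → ℂ} (hc : ContDiff ℝ ∞ c) (m : ℕ) :
    ser (fun t => (starRingEnd ℂ) (c t)) m = (starRingEnd ℂ) (ser c m) := by
  simp only [ser, iteratedDeriv]
  have := (Complex.conjCLE : ℂ ≃L[ℝ] ℂ).toContinuousLinearMap.iteratedFDeriv_comp_left (f := c) (x := 0) (n := ∞) hc.contDiffAt (i := m) (by exact_mod_cast le_top)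
  have h2 : (fun t => (starRingEnd ℂ) (c t)) = (Complex.conjCLE : ℂ ≃L[ℝ] ℂ).toContinuousLinearMap ∘ c := by
    funext t; simp
  rw [h2, this]
  simp

lemma smooth_conj {c : ℝ → ℂ} (hc : ContDiff ℝ ∞ c) : ContDiff ℝ ∞ (fun t => (starRingEnd ℂ) (c t)) :=
  (Complex.conjCLE : ℂ ≃L[ℝ] ℂ).contDiff.comp hc

lemma sep {c d : ℝ → ℂ} (hc : ContDiff ℝ ∞ c) (hd : ContDiff ℝ ∞ d) (hne : ser c ≠ ser d) :
    ∃ M : ℕ, ∀ K : ℝ, ∀ᶠ t in 𝓝[>] (0:ℝ), K * t ^ M < ‖c t - d t‖ := by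
  have h0 : ser (c - d) ≠ 0 := by rw [ser_sub hc hd]; exact sub_ne_zero.2 hne
  obtain ⟨b, hb, hb0, h⟩ := ord_div (c := c - d) (hc.sub hd) h0
  refine ⟨ord (c - d) + 1, fun K => ?_⟩
  have h1 : ∀ᶠ t in 𝓝[>] (0:ℝ), K * t < ‖b t‖ := by
    have t1 : Tendsto (fun t : ℝ => K * t) (𝓝[>] 0) (𝓝 (K * 0)) := ((continuous_const.mul continuous_id).tendsto 0).mono_left nhdsWithin_le_nhds
    have t2 : Tendsto (fun t : ℝ => ‖b t‖) (𝓝[>] 0) (𝓝 ‖b 0‖) := (hb.continuous.norm.tendsto 0).mono_left nhdsWithin_le_nhds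
    exact t1.eventually_lt t2 (by simpa using hb0)
  filter_upwards [h1, self_mem_nhdsWithin] with t ht ht0
  have ht0 : 0 < t := ht0
  have := h t
  rw [Pi.sub_apply] at this
  rw [this, norm_smul, norm_pow, Real.norm_of_nonneg ht0.le, pow_succ]
  have hp : 0 < t ^ ord (c - d) := by positivity
  nlinarith [mul_lt_mul_of_pos_left ht hp]

/-- realness of a class product -/
lemma real_class {n : ℕ} {mu : Fin n → ℝ → ℝ} {N k : ℕ} {m : Fin k → ℕ} {p : Fin k → ℝ → ℂ[X]} {c : Fin k → ℝ → ℂ}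
    (hp : ∀ i, Pure (m i) (p i) (c i))
    (hP : ∀ᶠ t in 𝓝[>] (0:ℝ), mkp (fun j : Fin n => (mu j (t ^ N) : ℂ)) = ∏ i, p i t)
    {s : ℕ → ℂ} (hs : ∀ m, (s m).im = 0) :
    ∀ᶠ t in 𝓝[>] (0:ℝ), (∏ i with ser (c i) = s, p i t).map (starRingEnd ℂ) = ∏ i with ser (c i) = s, p i t := by
  have hsep : ∀ᶠ t in 𝓝[>] (0:ℝ), ∀ i, ∀ l, ser (c i) = s → ser (c l) ≠ s → ∀ z, (p i t).IsRoot z → ¬ (p l t).IsRoot ((starRingEnd ℂ) z) := by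
    rw [eventually_all]
    intro i
    rw [eventually_all]
    intro l
    by_cases h1 : ser (c i) = s
    swap
    · exact Eventually.of_forall fun t h => absurd h h1
    by_cases h2 : ser (c l) = s
    · exact Eventually.of_forall fun t _ h => absurd h2 h
    obtain ⟨M, hM⟩ := sep (hp i).smooth (smooth_conj (hp l).smooth) (by
      intro h
      apply h2
      funext m
      have := congrFun h m
      rw [ser_conj (hp l).smooth, h1] at this
      rw [← Complex.conj_conj (ser (c l) m), ← this, Complex.conj_eq_iff_im.2 (hs m)])
    obtain ⟨K1, hK1⟩ := (hp i).close M
    obtain ⟨K2, hK2⟩ := (hp l).close M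
    filter_upwards [hM (K1 + K2), hK1, hK2] with t g1 g2 g3 _ _ z hz hz'
    have a1 := g2 z hz
    have a2 := g3 _ hz'
    have a3 : ‖z - (starRingEnd ℂ) (c l t)‖ ≤ K2 * t ^ M := by
      rw [← RCLike.norm_conj, map_sub, Complex.conj_conj]; exact a2
    have : ‖c i t - (starRingEnd ℂ) (c l t)‖ ≤ ‖z - c i t‖ + ‖z - (starRingEnd ℂ) (c l t)‖ := by
      rw [norm_sub_rev z (c i t)]
      simpa using norm_add_le (c i t - z) (z - (starRingEnd ℂ) (c l t))
    nlinarith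
  filter_upwards [hsep, hP] with t h1 h2
  set f := ∏ i with ser (c i) = s, p i t with hf
  set g := ∏ i with ¬ ser (c i) = s, p i t with hg
  have hfg : f * g = mkp (fun j : Fin n => (mu j (t ^ N) : ℂ)) := by
    rw [h2, hf, hg, Finset.prod_filter_mul_prod_filter_not]
  have hreal : (f * g).map (starRingEnd ℂ) = f * g := by
    rw [hfg, mkp, lin, Polynomial.map_add, Polynomial.map_pow, map_X, Polynomial.map_sum]
    simp
  rw [Polynomial.map_mul] at hreal
  have hfm : f.Monic := monic_prod_of_monic _ _ fun i _ => (hp i).sp.monic t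
  have hcop : IsCoprime f (g.map (starRingEnd ℂ)) := by
    refine (isCoprime_iff_aeval_ne_zero_of_isAlgClosed ℂ ℂ _ _).2 ?_
    intro z
    by_contra hz
    push Not at hz
    obtain ⟨z1, z2⟩ := hz
    simp only [coe_aeval_eq_eval] at z1 z2
    rw [hf, eval_prod, Finset.prod_eq_zero_iff] at z1
    obtain ⟨i, hi, hi'⟩ := z1
    rw [hg, Polynomial.map_prod, eval_prod, Finset.prod_eq_zero_iff] at z2
    obtain ⟨l, hl, hl'⟩ := z2
    refine h1 i l (by simpa using hi) (by simpa using hl) z hi' ?_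
    rw [IsRoot]
    have e : (starRingEnd ℂ) (((p l t).map (starRingEnd ℂ)).eval z) = (p l t).eval ((starRingEnd ℂ) z) := by
      conv_lhs => rw [← Complex.conj_conj z]
      rw [eval_map_apply, Complex.conj_conj]
    rw [← e, hl', map_zero]
  have hdvd : f ∣ f.map (starRingEnd ℂ) := by
    apply hcop.dvd_of_dvd_mul_right
    rw [hreal]
    exact dvd_mul_right _ _
  exact eq_of_monic_of_dvd_of_natDegree_le hfm (hfm.map _) hdvd (natDegree_map_le)

end NP

namespace NP
open scoped ContDiff Topology
open Polynomial

lemma reindex {ι M : Type} [Fintype ι] [CommMonoid M] {B k : ℕ} {nn : Fin k → ℕ} (e : ι ≃ (Fin B ⊕ (Σ α, Fin (nn α))))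
    (H : ι → M) (G : Fin k → ℕ → M) (hG : ∀ α i (h : i < nn α), G α i = H (e.symm (Sum.inr ⟨α, ⟨i, h⟩⟩))) :
    (∏ i, H (e.symm (Sum.inl i))) * ∏ α, ∏ i ∈ Finset.range (nn α), G α i = ∏ x, H x := by
  rw [← e.symm.prod_comp, Fintype.prod_sum_type, Fintype.prod_sigma]
  congr 1
  refine Finset.prod_congr rfl fun α _ => ?_
  rw [Finset.prod_range]
  exact Finset.prod_congr rfl fun i _ => hG α i i.2

lemma class_prod {M : Type} [CommMonoid M] {B k k' : ℕ} {nn : Fin k → ℕ} {m : Fin k' → ℕ}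
    (e : (Σ i, Fin (m i)) ≃ (Fin B ⊕ (Σ α, Fin (nn α)))) (S : Fin k' → ℕ → ℂ) (s : ℕ → ℂ)
    (hB : ∀ i, S (e.symm (Sum.inl i)).1 ≠ s)
    (H : (Σ i, Fin (m i)) → M) (G : Fin k → ℕ → M) (hG : ∀ α i (h : i < nn α), G α i = H (e.symm (Sum.inr ⟨α, ⟨i, h⟩⟩)))
    (C : Fin k → ℕ → ℕ → ℂ) (hC : ∀ α i (h : i < nn α), C α i = S (e.symm (Sum.inr ⟨α, ⟨i, h⟩⟩)).1) :
    ∏ α, ∏ i ∈ (Finset.range (nn α)).filter (fun i => C α i = s), G α i = ∏ i with S i = s, ∏ j, H ⟨i, j⟩ := by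
  have h := reindex e (fun x => if S x.1 = s then H x else 1) (fun α i => if C α i = s then G α i else 1)
    (fun α i h => by simp only [hC α i h, hG α i h])
  rw [Finset.prod_eq_one (fun i _ => if_neg (hB i)), one_mul, Fintype.prod_sigma] at h
  simp only [Finset.prod_filter]
  rw [h]
  refine Finset.prod_congr rfl fun i _ => ?_
  by_cases hi : S i = s
  · simp [hi]
  · simp [hi]

theorem main (F : ℝ → ℝ → ℝ) (W : Set (ℝ × ℝ)) (hW : W ∈ nhds (0 : ℝ × ℝ))
    (hF : ContDiffOn ℝ (⊤ : ℕ∞) (fun p : ℝ × ℝ => F p.1 p.2) W)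
    (k : ℕ) (v : Fin (k + 1) → ℕ × ℕ)
    (hmono : StrictMono fun i => (v i).1)
    (hanti : StrictAnti fun i => (v i).2)
    (hvert : Set.extremePoints ℝ (newtonPolygonOf F)
      = Set.range fun i => (((v i).1 : ℝ), ((v i).2 : ℝ))) :
    ∃ ε : ℝ, 0 < ε ∧
    ∃ (U : ℝ → ℝ → ℝ) (X : Fin (v 0).1 → ℝ → ℂ)
      (Y : Fin (v (Fin.last k)).2 → ℝ → ℂ)
      (Z : Fin k → ℕ → ℝ → ℂ) (c : Fin k → ℕ → ℕ → ℂ),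
      -- the factorization, valid for 0 < x, y < ε
      (∀ x y : ℝ, 0 < x → x < ε → 0 < y → y < ε →
        (F x y : ℂ) =
          (U x y : ℂ) * (∏ i, ((x : ℂ) - X i y)) * (∏ i, ((y : ℂ) - Y i x)) *
            ∏ α : Fin k, ∏ i ∈ Finset.range (edgeMult v α), ((y : ℂ) - Z α i x)) ∧
      -- (1)
      (∃ W' ∈ nhds (0 : ℝ × ℝ), ContDiffOn ℝ (⊤ : ℕ∞) (fun p : ℝ × ℝ => U p.1 p.2) W') ∧
      U 0 0 ≠ 0 ∧
      -- (2)
      (∀ i, ContinuousOn (X i) (Set.Ico 0 ε) ∧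
        ∀ N : ℕ, (X i) =O[nhdsWithin 0 (Set.Ioi 0)] fun t : ℝ => t ^ N) ∧
      (∀ i, ContinuousOn (Y i) (Set.Ico 0 ε) ∧
        ∀ N : ℕ, (Y i) =O[nhdsWithin 0 (Set.Ioi 0)] fun t : ℝ => t ^ N) ∧
      -- (3)
      (∀ α : Fin k, ∀ i ∈ Finset.range (edgeMult v α),
        ContinuousOn (Z α i) (Set.Ico 0 ε) ∧
        HasPuiseuxExpansion (Z α i) (1 / (totalDeg v).factorial) (c α i) ∧
        (∀ m : ℕ, (m : ℝ) / (totalDeg v).factorial < edgeSlope v α → c α i m = 0) ∧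
        (∃ m : ℕ, (m : ℝ) / (totalDeg v).factorial = edgeSlope v α ∧ c α i m ≠ 0)) ∧
      -- (4) and (5): for each root `Y = Z α i`, the product `f(x,y)` of the
      -- factors whose roots have exactly the same asymptotic expansion
      (∀ α : Fin k, ∀ i ∈ Finset.range (edgeMult v α),
        ∃ ε' : ℝ, 0 < ε' ∧
        ∃ a : ℕ → ℝ → ℂ,
          -- (4): the coefficients of `f(x^{n!}, y)` are C∞ up to `0`
          (∀ m : ℕ, ContDiffOn ℝ (⊤ : ℕ∞) (a m) (Set.Ico 0 ε')) ∧
          (∀ x : ℝ, 0 < x → x < ε' → ∀ y : ℂ,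
            (∏ α' : Fin k,
              ∏ i' ∈ (Finset.range (edgeMult v α')).filter fun i' => c α' i' = c α i,
                (y - Z α' i' (x ^ (totalDeg v).factorial)))
              = ∑ m ∈ Finset.range
                    ((∑ α' : Fin k,
                      ((Finset.range (edgeMult v α')).filter
                        fun i' => c α' i' = c α i).card) + 1),
                  a m x * y ^ m) ∧
          -- (5): if the asymptotic expansion of `Y` is real then `f` is real
          ((∀ m : ℕ, (c α i m).im = 0) →
            ∀ x : ℝ, 0 < x → x < ε' → ∀ y : ℝ,
              (∏ α' : Fin k,
                ∏ i' ∈ (Finset.range (edgeMult v α')).filter fun i' => c α' i' = c α i,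
                  ((y : ℂ) - Z α' i' x)).im = 0)) := by
  -- globalize
  have hsm : ∀ᶠ p in 𝓝 (0 : ℝ × ℝ), ContDiffAt ℝ ∞ (fun p : ℝ × ℝ => F p.1 p.2) p := by
    filter_upwards [eventually_mem_nhds_iff.2 hW] with p hp
    exact hF.contDiffAt hp
  obtain ⟨G, hG, hGF⟩ := globalize2 hsm
  have hnp : newtonPolygonOf F = newtonPolygonOf fun x y => G (x, y) := by
    unfold newtonPolygonOf
    congr 1
    ext q
    rw [Set.mem_ofPred_eq, Set.mem_ofPred_eq, tc_congr hGF]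
  rw [hnp] at hvert
  obtain ⟨l1, l2, l3⟩ := np_lex hmono hvert
  obtain ⟨U, lam, mu, hU, hU0, hlam, hlamO, hmu, hmu0, hfac⟩ := prep2 hG (A := (v 0).1) (n := (v 0).2)
    (fun i hi j => by
      by_contra h
      exact absurd (l2 i j h) (by omega))
    (fun j hj => by
      by_contra h
      exact absurd (l3 j h) (by omega)) l1
  simp only [totalDeg_eq hanti]
  set N := ((v 0).2).factorial with hNd
  have hN : 0 < N := Nat.factorial_pos _
  have hN' : (0:ℝ) < N := by exact_mod_cast hN
  obtain ⟨k', m, p, cc, hp, hP⟩ := puiseux _ (SP_mu hmu)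
  obtain ⟨e, he⟩ := exists_equiv hG hmono hanti hvert hU hU0 hlamO hmu hmu0 hfac hN hp hP
  choose ρ hρc hρp hρO using fun i => (hp i).roots
  -- the X side
  have hX := pure_of_flat (SP_mu hlam) (fun j hj => by
    have h1 : (fun t => (mkp (fun j : Fin (v 0).1 => (lam j t : ℂ))).coeff j) = fun t => (lam ⟨j, hj⟩ t : ℂ) := by
      funext t
      rw [mkp_coeff, coeff_X_pow, if_neg hj.ne, zero_add, Lc, dif_pos hj]
      rfl
    rw [h1]
    refine flat_of_isBigO (Complex.ofRealCLM.contDiff.comp (hlam _)) (l := 𝓝[≠] 0) le_rfl fun M => ?_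
    refine IsBigO.of_norm_left ?_
    simp only [Function.comp_apply, Complex.ofRealCLM_apply, Complex.norm_real]
    exact (((hlamO ⟨j, hj⟩ M).mono nhdsWithin_le_nhds)).norm_left)
  obtain ⟨ξ, hξc, hξp, hξO⟩ := hX.roots
  -- labels
  have hlabY : ∀ i, ser (cc (e.symm (Sum.inl i)).1) = 0 := by
    intro i
    have := he (e.symm (Sum.inl i))
    rw [Equiv.apply_symm_apply, Sum.elim_inl, lab] at this
    by_contra h
    rw [if_neg h] at this
    exact absurd this (by simp)
  have hlabZ : ∀ y, ser (cc (e.symm (Sum.inr y)).1) ≠ 0 ∧ (ord (cc (e.symm (Sum.inr y)).1) : ℝ) / N = edgeSlope v y.1 := by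
    intro y
    have := he (e.symm (Sum.inr y))
    rw [Equiv.apply_symm_apply, Sum.elim_inr, lab] at this
    split_ifs at this with h
    exact ⟨h, (Option.some.inj this).symm⟩
  let R : (Σ i, Fin (m i)) → ℝ → ℂ := fun x t => ρ x.1 x.2 (t ^ (1 / (N:ℝ)))
  let Z : Fin k → ℕ → ℝ → ℂ := fun α i => if h : i < edgeMult v α then R (e.symm (Sum.inr ⟨α, ⟨i, h⟩⟩)) else 0
  let c : Fin k → ℕ → ℕ → ℂ := fun α i => if h : i < edgeMult v α then ser (cc (e.symm (Sum.inr ⟨α, ⟨i, h⟩⟩)).1) else 0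
  have hZ : ∀ α i (h : i < edgeMult v α), Z α i = R (e.symm (Sum.inr ⟨α, ⟨i, h⟩⟩)) := fun α i h => dif_pos h
  have hc : ∀ α i (h : i < edgeMult v α), c α i = ser (cc (e.symm (Sum.inr ⟨α, ⟨i, h⟩⟩)).1) := fun α i h => dif_pos h
  -- the radius
  have hball : ∀ᶠ q in 𝓝 (0 : ℝ × ℝ), G q = F q.1 q.2 ∧ G q = U q * (q.1 ^ (v 0).1 + ∑ j : Fin (v 0).1, lam j q.2 * q.1 ^ (j:ℕ)) * (q.2 ^ (v 0).2 + ∑ j : Fin (v 0).2, mu j q.1 * q.2 ^ (j:ℕ)) :=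
    hGF.and hfac
  obtain ⟨ε1, hε1, hb1⟩ := Metric.eventually_nhds_iff.1 hball
  obtain ⟨ε2, hε2, hb2⟩ := mem_nhdsGT_iff_exists_Ioo_subset.1 ((root_tendsto hN).eventually hP)
  have hε2 : 0 < ε2 := hε2
  refine ⟨min 1 (min ε1 ε2), by positivity, fun x y => U (x, y), ξ, fun i => R (e.symm (Sum.inl i)), Z, c, ?_, ?_, hU0, ?_, ?_, ?_, ?_⟩
  · -- factorization
    intro x y hx hxε hy hyε
    rw [lt_min_iff, lt_min_iff] at hxε hyε
    obtain ⟨g1, g2⟩ := hb1 (y := (x, y)) (by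
      rw [dist_zero_right, Prod.norm_def, max_lt_iff, Real.norm_of_nonneg hx.le, Real.norm_of_nonneg hy.le]
      exact ⟨hxε.2.1, hyε.2.1⟩)
    have g3 := hb2 ⟨hx, hxε.2.2⟩
    have g3 : mkp (fun j : Fin (v 0).2 => (mu j ((x ^ (1 / (N:ℝ))) ^ N) : ℂ)) = ∏ i, p i (x ^ (1 / (N:ℝ))) := g3
    rw [root_pow hN hx.le] at g3
    simp only at g1 g2
    rw [← g1, g2]
    have q1 : ((x ^ (v 0).1 + ∑ j : Fin (v 0).1, lam j y * x ^ (j:ℕ) : ℝ) : ℂ) = ∏ i, ((x:ℂ) - ξ i y) := by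
      have := congrArg (eval (x:ℂ)) (hξp y ⟨hy.le, hyε.1.le⟩)
      rw [mkp_eval, eval_prod] at this
      simp only [eval_sub, eval_X, eval_C] at this
      rw [← this]
      push_cast
      rfl
    have q2 : ((y ^ (v 0).2 + ∑ j : Fin (v 0).2, mu j x * y ^ (j:ℕ) : ℝ) : ℂ) = ∏ z, ((y:ℂ) - R z x) := by
      have := congrArg (eval (y:ℂ)) g3
      rw [mkp_eval, eval_prod] at this
      rw [Fintype.prod_sigma]
      push_cast
      rw [this]
      refine Finset.prod_congr rfl fun i _ => ?_
      rw [hρp i _ ⟨Real.rpow_nonneg hx.le _, Real.rpow_le_one hx.le hxε.1.le (by positivity)⟩, eval_prod]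
      simp [R]
    rw [Complex.ofReal_mul, Complex.ofReal_mul, q1, q2, mul_assoc (_ * _) (∏ i, _) (∏ α, _)]
    congr 1
    exact (reindex e (fun z => (y:ℂ) - R z x) (fun α i => (y:ℂ) - Z α i x) (fun α i h => by rw [hZ α i h])).symm
  · exact ⟨univ, univ_mem, hU.contDiffOn⟩
  · intro i
    refine ⟨(hξc i).mono fun x hx => ⟨hx.1, (hx.2.trans_le (min_le_left _ _)).le⟩, fun M => ?_⟩
    simpa using hξO i M
  · intro i
    refine ⟨cont_comp_root hN (hρc _ _) (min_le_left _ _), flat_comp_root hN (flat_root (hρO _ _) (ser_flat (hp _).smooth (hlabY i)))⟩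
  · intro α i hi
    rw [Finset.mem_range] at hi
    obtain ⟨s1, s2⟩ := hlabZ ⟨α, ⟨i, hi⟩⟩
    rw [hZ α i hi, hc α i hi]
    refine ⟨cont_comp_root hN (hρc _ _) (min_le_left _ _), expansion hN (hp _).smooth (hρO _ _), fun m' hm' => ?_, ?_⟩
    · apply ser_lt_ord
      simp only at s2
      rw [← s2, div_lt_div_iff_of_pos_right hN'] at hm'
      exact_mod_cast hm'
    · exact ⟨_, s2, ser_ord_ne s1⟩
  · intro α i hi
    rw [Finset.mem_range] at hi
    set s := c α i with hs
    have hs0 : s ≠ 0 := by rw [hs, hc α i hi]; exact (hlabZ _).1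
    have hSP := SP.prod (Finset.univ.filter fun i => ser (cc i) = s) fun i => (hp i).sp
    have hpoly : ∀ t : ℝ, 0 < t → t < 1 → ∏ α' : Fin k, ∏ i' ∈ (Finset.range (edgeMult v α')).filter (fun i' => c α' i' = s), (X - C (Z α' i' (t ^ N)))
        = ∏ i with ser (cc i) = s, p i t := by
      intro t ht ht1
      rw [class_prod e (fun i => ser (cc i)) s (fun i => by rw [hlabY i]; exact hs0.symm)
        (fun z => X - C (R z (t ^ N))) (fun α' i' => X - C (Z α' i' (t ^ N))) (fun α i h => by rw [hZ α i h]) c hc]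
      refine Finset.prod_congr rfl fun i _ => ?_
      rw [hρp i t ⟨ht.le, ht1.le⟩]
      simp only [R, pow_root hN ht.le]
    have heval : ∀ t : ℝ, 0 < t → t < 1 → ∀ y : ℂ, ∏ α' : Fin k, ∏ i' ∈ (Finset.range (edgeMult v α')).filter (fun i' => c α' i' = s), (y - Z α' i' (t ^ N))
        = (∏ i with ser (cc i) = s, p i t).eval y := by
      intro t ht ht1 y
      rw [← hpoly t ht ht1, eval_prod]
      simp [eval_prod]
    have hdeg : ∑ α' : Fin k, ((Finset.range (edgeMult v α')).filter (fun i' => c α' i' = s)).card = ∑ i with ser (cc i) = s, m i := by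
      have h1 := congrArg natDegree (hpoly (1/2) (by norm_num) (by norm_num))
      rw [hSP.deg, natDegree_prod_of_monic _ _ (fun α' _ => monic_prod_of_monic _ _ fun i' _ => monic_X_sub_C _)] at h1
      rw [← h1]
      refine Finset.sum_congr rfl fun α' _ => ?_
      rw [natDegree_prod_of_monic _ _ (fun i' _ => monic_X_sub_C _)]
      simp
    -- realness radius
    have hreal : ∃ δ : ℝ, 0 < δ ∧ δ ≤ 1 ∧ ((∀ m : ℕ, (s m).im = 0) → ∀ t : ℝ, 0 < t → t < δ →
        (∏ i with ser (cc i) = s, p i t).map (starRingEnd ℂ) = ∏ i with ser (cc i) = s, p i t) := by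
      by_cases hr : ∀ m : ℕ, (s m).im = 0
      · obtain ⟨δ, hδ, h⟩ := mem_nhdsGT_iff_exists_Ioo_subset.1 (real_class hp hP hr)
        have hδ : 0 < δ := hδ
        exact ⟨min 1 δ, by positivity, min_le_left _ _, fun _ t ht htδ => h ⟨ht, htδ.trans_le (min_le_right _ _)⟩⟩
      · exact ⟨1, one_pos, le_rfl, fun h => absurd h hr⟩
    obtain ⟨δ, hδ, hδ1, hreal⟩ := hreal
    have hδN : δ ^ N ≤ δ := pow_le_of_le_one hδ.le hδ1 hN.ne'
    refine ⟨δ ^ N, by positivity, fun j t => (∏ i with ser (cc i) = s, p i t).coeff j, fun j => (hSP.smooth j).contDiffOn, ?_, ?_⟩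
    · intro x hx hxδ y
      rw [heval x hx (by linarith), eval_eq_sum_range, hSP.deg, hdeg]
    · intro hr x hx hxδ y
      have ht0 : 0 < x ^ (1 / (N:ℝ)) := Real.rpow_pos_of_pos hx _
      have htδ : x ^ (1 / (N:ℝ)) < δ := by
        have := Real.rpow_lt_rpow hx.le hxδ (show 0 < 1 / (N:ℝ) by positivity)
        rwa [pow_root hN hδ.le] at this
      have h1 := heval _ ht0 (by linarith) y
      rw [root_pow hN hx.le] at h1
      rw [h1, ← Complex.conj_eq_iff_im]
      conv_rhs => rw [← hreal hr _ ht0 htδ]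
      have := eval_map_apply (f := starRingEnd ℂ) (p := ∏ i with ser (cc i) = s, p i (x ^ (1 / (N:ℝ)))) (y:ℂ)
      rw [Complex.conj_ofReal] at this
      exact this.symm

end NP

/-- factorization of C∞ functions, Proposition 2.1 of the paper:
if `F` is C∞ near the origin with nonempty Newton polygon `Γ` whose extreme
points are the lattice points `v 0, …, v k` (with `A = (v 0).1` the abscissa of
the vertical infinite edge and `B = (v k).2` the ordinate of the horizontal
infinite edge), then for `0 < x, y < ε` one has the factorization
`F(x,y) = U(x,y) ∏_{i<A} (x - X_i(y)) ∏_{i<B} (y - Y_i(x)) ∏_α ∏_{i<n_α} (y - Y_{αi}(x))`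
with properties (1)–(5) below. -/
theorem statement2 (F : ℝ → ℝ → ℝ) (W : Set (ℝ × ℝ)) (hW : W ∈ nhds (0 : ℝ × ℝ))
    (hF : ContDiffOn ℝ (⊤ : ℕ∞) (fun p : ℝ × ℝ => F p.1 p.2) W)
    (k : ℕ) (v : Fin (k + 1) → ℕ × ℕ)
    (hmono : StrictMono fun i => (v i).1)
    (hanti : StrictAnti fun i => (v i).2)
    (hvert : Set.extremePoints ℝ (newtonPolygonOf F)
      = Set.range fun i => (((v i).1 : ℝ), ((v i).2 : ℝ))) :
    ∃ ε : ℝ, 0 < ε ∧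
    ∃ (U : ℝ → ℝ → ℝ) (X : Fin (v 0).1 → ℝ → ℂ)
      (Y : Fin (v (Fin.last k)).2 → ℝ → ℂ)
      (Z : Fin k → ℕ → ℝ → ℂ) (c : Fin k → ℕ → ℕ → ℂ),
      -- the factorization, valid for 0 < x, y < ε
      (∀ x y : ℝ, 0 < x → x < ε → 0 < y → y < ε →
        (F x y : ℂ) =
          (U x y : ℂ) * (∏ i, ((x : ℂ) - X i y)) * (∏ i, ((y : ℂ) - Y i x)) *
            ∏ α : Fin k, ∏ i ∈ Finset.range (edgeMult v α), ((y : ℂ) - Z α i x)) ∧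
      -- (1)
      (∃ W' ∈ nhds (0 : ℝ × ℝ), ContDiffOn ℝ (⊤ : ℕ∞) (fun p : ℝ × ℝ => U p.1 p.2) W') ∧
      U 0 0 ≠ 0 ∧
      -- (2)
      (∀ i, ContinuousOn (X i) (Set.Ico 0 ε) ∧
        ∀ N : ℕ, (X i) =O[nhdsWithin 0 (Set.Ioi 0)] fun t : ℝ => t ^ N) ∧
      (∀ i, ContinuousOn (Y i) (Set.Ico 0 ε) ∧
        ∀ N : ℕ, (Y i) =O[nhdsWithin 0 (Set.Ioi 0)] fun t : ℝ => t ^ N) ∧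
      -- (3)
      (∀ α : Fin k, ∀ i ∈ Finset.range (edgeMult v α),
        ContinuousOn (Z α i) (Set.Ico 0 ε) ∧
        HasPuiseuxExpansion (Z α i) (1 / (totalDeg v).factorial) (c α i) ∧
        (∀ m : ℕ, (m : ℝ) / (totalDeg v).factorial < edgeSlope v α → c α i m = 0) ∧
        (∃ m : ℕ, (m : ℝ) / (totalDeg v).factorial = edgeSlope v α ∧ c α i m ≠ 0)) ∧
      -- (4) and (5): for each root `Y = Z α i`, the product `f(x,y)` of the
      -- factors whose roots have exactly the same asymptotic expansion
      (∀ α : Fin k, ∀ i ∈ Finset.range (edgeMult v α),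
        ∃ ε' : ℝ, 0 < ε' ∧
        ∃ a : ℕ → ℝ → ℂ,
          -- (4): the coefficients of `f(x^{n!}, y)` are C∞ up to `0`
          (∀ m : ℕ, ContDiffOn ℝ (⊤ : ℕ∞) (a m) (Set.Ico 0 ε')) ∧
          (∀ x : ℝ, 0 < x → x < ε' → ∀ y : ℂ,
            (∏ α' : Fin k,
              ∏ i' ∈ (Finset.range (edgeMult v α')).filter fun i' => c α' i' = c α i,
                (y - Z α' i' (x ^ (totalDeg v).factorial)))
              = ∑ m ∈ Finset.range
                    ((∑ α' : Fin k,
                      ((Finset.range (edgeMult v α')).filter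
                        fun i' => c α' i' = c α i).card) + 1),
                  a m x * y ^ m) ∧
          -- (5): if the asymptotic expansion of `Y` is real then `f` is real
          ((∀ m : ℕ, (c α i m).im = 0) →
            ∀ x : ℝ, 0 < x → x < ε' → ∀ y : ℝ,
              (∏ α' : Fin k,
                ∏ i' ∈ (Finset.range (edgeMult v α')).filter fun i' => c α' i' = c α i,
                  ((y : ℂ) - Z α' i' x)).im = 0)) := by
  exact NP.main F W hW hF k v hmono hanti hvert
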